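/- Let f be a nonzero cusp form of weight k for SL₂(ℤ) all of whose Fourier coefficients a_f(n) are real. Then there exist δ > 0 and x_0 such that Σ_{p ≤ x, p prime} a_f(p)² ≥ δ x^k / log x for all x ≥ x_0. -/

import Mathlib

open Complex Filter Finset

noncomputable section

/-- `a` is the Fourier coefficient sequence of the cusp form `f` of weight `k` for `SL₂(ℤ)`:
`f(τ) = Σ_{n ≥ 1} a(n) e^{2πinτ}` (with `a 0 = 0`). -/
def CuspFormCoeffs (k : ℤ) (f : CuspForm (CongruenceSubgroup.Gamma 1) k) (a : ℕ → ℂ) : Prop :=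
  a 0 = 0 ∧ ∀ τ : UpperHalfPlane,
    Summable (fun n : ℕ => a n * Complex.exp (2 * (Real.pi : ℂ) * Complex.I * (n : ℂ) * (τ : ℂ))) ∧
    f τ = ∑' n : ℕ, a n * Complex.exp (2 * (Real.pi : ℂ) * Complex.I * (n : ℂ) * (τ : ℂ))

/-- `S` is the coefficient sequence of a quasimodular cusp form for `SL₂(ℤ)`, i.e. of a linear
combination of cusp forms and their iterated derivatives under `D = q d/dq`. -/
def IsQuasiCuspCoeff (S : ℕ → ℂ) : Prop :=
  ∃ (m : ℕ) (A : Fin m → ℂ) (j : Fin m → ℕ) (k : Fin m → ℤ)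
    (f : ∀ i, CuspForm (CongruenceSubgroup.Gamma 1) (k i)) (a : Fin m → ℕ → ℂ),
    (∀ i, CuspFormCoeffs (k i) (f i) (a i)) ∧ S 0 = 0 ∧
      ∀ n : ℕ, 1 ≤ n → S n = ∑ i, A i * (n : ℂ) ^ (j i) * a i n

/-- `E` is the coefficient sequence of a quasimodular Eisenstein series, i.e. of a linear
combination of the Eisenstein series `G_k` and their iterated derivatives under `D = q d/dq`. -/
def IsQuasiEisCoeff (E : ℕ → ℂ) : Prop :=
  ∃ (s : Finset (ℕ × ℕ)) (α : ℕ × ℕ → ℂ),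
    (∀ p ∈ s, 2 ≤ p.1 ∧ Even p.1) ∧
    E 0 = ∑ p ∈ s.filter (fun p => p.2 = 0), α p * (bernoulli p.1 : ℂ) / (2 * (p.1 : ℂ)) ∧
    ∀ n : ℕ, 1 ≤ n →
      E n = ∑ p ∈ s, α p * (n : ℂ) ^ p.2 * ((ArithmeticFunction.sigma (p.1 - 1) n : ℕ) : ℂ)

namespace CuspPrime

open scoped Topology
open MeasureTheory

/-- The Fejér-type kernel, the cosine transform of the triangle function on `[0, T]`. -/
def fej (T u : ℝ) : ℝ := ∫ t in (0 : ℝ)..T, (1 - t / T) * Real.cos (t * u)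

lemma fej_of_ne {T u : ℝ} (hT : 0 < T) (hu : u ≠ 0) :
    fej T u = (1 - Real.cos (T * u)) / (T * u ^ 2) := by
  have hd : ∀ t ∈ Set.uIcc 0 T, HasDerivAt
      (fun t : ℝ => (1 - t / T) * (Real.sin (t * u) / u) - Real.cos (t * u) / (T * u ^ 2))
      ((1 - t / T) * Real.cos (t * u)) t := by
    intro t _
    have h1 : HasDerivAt (fun t : ℝ => 1 - t / T) (-(1 / T)) t := by
      simpa using ((hasDerivAt_id t).div_const T).const_sub 1
    have h0 : HasDerivAt (fun t : ℝ => t * u) u t := by simpa using (hasDerivAt_id t).mul_const u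
    have h2 := h0.sin
    have h3 := h0.cos
    refine ((h1.mul (h2.div_const u)).sub (h3.div_const (T * u ^ 2))).congr_deriv ?_
    have := hT.ne'
    field_simp
    ring
  rw [fej, intervalIntegral.integral_eq_sub_of_hasDerivAt hd (by
    apply Continuous.intervalIntegrable; fun_prop)]
  simp [hT.ne']
  field_simp
  ring

lemma fej_zero {T : ℝ} (hT : 0 < T) : fej T 0 = T / 2 := by
  simp only [fej, mul_zero, Real.cos_zero, mul_one]
  rw [intervalIntegral.integral_sub (by simp) (by apply Continuous.intervalIntegrable; fun_prop)]
  simp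
  field_simp
  ring

lemma fej_nonneg {T : ℝ} (hT : 0 < T) (u : ℝ) : 0 ≤ fej T u := by
  by_cases hu : u = 0
  · rw [hu, fej_zero hT]; positivity
  · rw [fej_of_ne hT hu]
    have := Real.cos_le_one (T * u)
    have : 0 ≤ 1 - Real.cos (T * u) := by linarith
    positivity

lemma fej_scale {T : ℝ} (hT : 0 < T) (u : ℝ) : fej T u = T * fej 1 (T * u) := by
  by_cases hu : u = 0
  · simp [hu, fej_zero hT, fej_zero one_pos]; ring
  · rw [fej_of_ne hT hu, fej_of_ne one_pos (by positivity)]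
    have := hT.ne'
    field_simp

lemma fej_one_le (u : ℝ) : fej 1 u ≤ 4 * (1 + u ^ 2)⁻¹ := by
  by_cases hu : u = 0
  · simp [hu, fej_zero one_pos]; norm_num
  · rw [fej_of_ne one_pos hu, ← div_eq_mul_inv, div_le_div_iff₀ (by positivity) (by positivity)]
    have h1 := Real.neg_one_le_cos (1 * u)
    have h2 := Real.one_sub_sq_div_two_le_cos (x := 1 * u)
    have : 0 ≤ u ^ 2 := by positivity
    nlinarith

lemma fej_measurable {T : ℝ} (hT : 0 < T) : Measurable (fej T) := by
  have : fej T = fun u => if u = 0 then T / 2 else (1 - Real.cos (T * u)) / (T * u ^ 2) := by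
    ext u
    split_ifs with h
    · rw [h, fej_zero hT]
    · exact fej_of_ne hT h
  rw [this]
  refine Measurable.ite (measurableSet_singleton 0) measurable_const (by fun_prop)

lemma fej_one_integrable : Integrable (fej 1) := by
  refine Integrable.mono' (integrable_inv_one_add_sq.const_mul 4)
    (fej_measurable one_pos).aestronglyMeasurable (ae_of_all _ fun u => ?_)
  rw [Real.norm_of_nonneg (fej_nonneg one_pos u)]
  exact fej_one_le u

lemma fej_integrable {T : ℝ} (hT : 0 < T) : Integrable (fej T) := by
  have : fej T = fun u => T * fej 1 (T * u) := funext (fej_scale hT)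
  rw [this]
  exact (fej_one_integrable.comp_mul_left' hT.ne').const_mul T

lemma integral_fej {T : ℝ} (hT : 0 < T) : ∫ u, fej T u = ∫ u, fej 1 u := by
  simp_rw [fej_scale hT]
  rw [integral_const_mul, Measure.integral_comp_mul_left, abs_of_pos (by positivity)]
  rw [smul_eq_mul, ← mul_assoc, mul_inv_cancel₀ hT.ne', one_mul]

lemma fej_lower {T u : ℝ} (hT : 0 < T) (hu : |u| ≤ 1 / T) : T / 4 ≤ fej T u := by
  by_cases h0 : u = 0
  · rw [h0, fej_zero hT]; linarith
  rw [fej_scale hT, fej_of_ne one_pos (by positivity)]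
  have hx : |T * u| ≤ 1 := by
    rw [abs_mul, abs_of_pos hT]
    calc T * |u| ≤ T * (1 / T) := by gcongr
      _ = 1 := by field_simp
  have hx0 : T * u ≠ 0 := by positivity
  generalize T * u = x at hx hx0
  have hc : Real.cos x ≤ 1 - x ^ 2 / 2 + x ^ 4 * (5 / 96) := by
    have := Real.cos_bound hx
    rw [abs_le] at this
    have h4 : |x| ^ 4 = x ^ 4 := by rw [← abs_pow, abs_of_nonneg (by positivity)]
    rw [h4] at this
    linarith [this.2]
  have hx2 : x ^ 2 ≤ 1 := by rwa [sq_le_one_iff_abs_le_one]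
  have hxp : 0 < x ^ 2 := by positivity
  have : (1 : ℝ) / 4 ≤ (1 - Real.cos (1 * x)) / (1 * x ^ 2) := by
    rw [le_div_iff₀ (by positivity), one_mul, one_mul]
    nlinarith
  nlinarith

lemma integral_fej_one_pos : 0 < ∫ u, fej 1 u := by
  have h : ∫ u in Set.Icc (-1 : ℝ) 1, (1 / 4 : ℝ) ≤ ∫ u in Set.Icc (-1 : ℝ) 1, fej 1 u := by
    refine setIntegral_mono_on (by simp) fej_one_integrable.integrableOn measurableSet_Icc ?_
    intro u hu
    exact fej_lower one_pos (by rw [abs_le]; simpa using hu)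
  have h2 : ∫ u in Set.Icc (-1 : ℝ) 1, fej 1 u ≤ ∫ u, fej 1 u :=
    setIntegral_le_integral fej_one_integrable (ae_of_all _ (fej_nonneg one_pos))
  simp at h
  norm_num at h
  linarith

lemma fej_upper {T u : ℝ} (hT : 0 < T) (hu : u ≠ 0) : fej T u ≤ 2 / (T * u ^ 2) := by
  rw [fej_of_ne hT hu]
  have := Real.neg_one_le_cos (T * u)
  gcongr
  linarith

end CuspPrime

namespace CuspPrime

open scoped Topology
open MeasureTheory

lemma fej_eq_re (T u : ℝ) :
    fej T u = (∫ t in (0 : ℝ)..T, ((1 - t / T : ℝ) : ℂ) * cexp (I * t * (-u))).re := by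
  have : ∀ t : ℝ, (1 - t / T) * Real.cos (t * u) =
      (((1 - t / T : ℝ) : ℂ) * cexp (I * t * (-u))).re := by
    intro t
    have : I * t * (-u) = ((-(t * u) : ℝ) : ℂ) * I := by push_cast; ring
    rw [this, re_ofReal_mul, exp_ofReal_mul_I_re, Real.cos_neg]
  simp_rw [fej, this]
  have hi : IntervalIntegrable (fun t : ℝ => ((1 - t / T : ℝ) : ℂ) * cexp (I * t * (-u)))
      volume 0 T := by
    apply Continuous.intervalIntegrable; fun_prop
  have := Complex.reCLM.intervalIntegral_comp_comm hi
  simpa using this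

lemma norm_weight_le {T : ℝ} (hT : 0 < T) (y : ℝ) {t : ℝ} (ht : t ∈ Set.uIoc 0 T) :
    ‖((1 - t / T : ℝ) : ℂ) * cexp (I * t * y)‖ ≤ 1 := by
  rw [Set.uIoc_of_le hT.le] at ht
  have h1 : ‖cexp (I * t * y)‖ = 1 := by
    rw [show I * t * y = ((t * y : ℝ) : ℂ) * I by push_cast; ring, norm_exp_ofReal_mul_I]
  rw [norm_mul, h1, mul_one, norm_real, Real.norm_eq_abs, abs_le]
  have := div_nonneg ht.1.le hT.le
  have : t / T ≤ 1 := (div_le_one hT).2 ht.2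
  constructor <;> linarith

lemma fej_series {T : ℝ} (hT : 0 < T) (y : ℝ) {b : ℕ → ℝ} {σ : ℝ} (hσ : 0 < σ)
    (hs : LSeriesSummable (fun n => (b n : ℂ)) σ) :
    HasSum (fun n => b n * (n : ℝ) ^ (-σ) * fej T (Real.log n - y))
      (∫ t in (0 : ℝ)..T, ((1 - t / T : ℝ) : ℂ) * cexp (I * t * y) *
        LSeries (fun n => (b n : ℂ)) (σ + I * t)).re := by
  have hsum : ∀ t : ℝ, LSeriesSummable (fun n => (b n : ℂ)) (σ + I * t) := fun t =>
    hs.of_re_le_re (by simp)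
  have key := intervalIntegral.hasSum_integral_of_dominated_convergence (a := 0) (b := T)
    (μ := volume)
    (F := fun n (t : ℝ) => ((1 - t / T : ℝ) : ℂ) * cexp (I * t * y) *
      LSeries.term (fun n => (b n : ℂ)) (σ + I * t) n)
    (f := fun t : ℝ => ((1 - t / T : ℝ) : ℂ) * cexp (I * t * y) *
        LSeries (fun n => (b n : ℂ)) (σ + I * t))
    (fun n _ => ‖LSeries.term (fun n => (b n : ℂ)) σ n‖) (fun n => ?_) (fun n => ?_) ?_ ?_ ?_
  · have hre := Complex.hasSum_re key
    refine hre.congr_fun (fun n => ?_)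
    rcases eq_or_ne n 0 with rfl | hn
    · simp [hσ.ne']
    have hn' : (n : ℂ) ≠ 0 := by exact_mod_cast hn
    rw [fej_eq_re, ← re_ofReal_mul, ← intervalIntegral.integral_const_mul]
    congr 1
    refine intervalIntegral.integral_congr fun t _ => ?_
    simp only [LSeries.term_of_ne_zero hn]
    rw [cpow_def_of_ne_zero hn', ofReal_mul, ofReal_cpow (Nat.cast_nonneg n), ofReal_natCast,
      cpow_def_of_ne_zero hn', div_eq_mul_inv (b n : ℂ), ← Complex.exp_neg, ← natCast_log]
    rw [show ((b n : ℂ) * cexp (Real.log n * ((-σ : ℝ) : ℂ))) * (((1 - t / T : ℝ) : ℂ) *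
      cexp (I * t * (-((Real.log n - y : ℝ) : ℂ)))) = ((1 - t / T : ℝ) : ℂ) * b n *
      (cexp (Real.log n * ((-σ : ℝ) : ℂ)) * cexp (I * t * (-((Real.log n - y : ℝ) : ℂ)))) by ring,
      ← Complex.exp_add]
    rw [show ((1 - t / T : ℝ) : ℂ) * cexp (I * t * y) * (b n * cexp (-(Real.log n * (σ + I * t)))) =
      ((1 - t / T : ℝ) : ℂ) * b n * (cexp (I * t * y) * cexp (-(Real.log n * (σ + I * t)))) by ring,
      ← Complex.exp_add]
    congr 2
    push_cast; ring
  · refine Continuous.aestronglyMeasurable ?_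
    rcases eq_or_ne n 0 with rfl | hn
    · simp only [LSeries.term_zero]; fun_prop
    · simp only [LSeries.term_of_ne_zero hn]
      have : (n : ℂ) ≠ 0 := by exact_mod_cast hn
      refine Continuous.mul (by fun_prop) (Continuous.div continuous_const ?_ ?_)
      · exact Continuous.const_cpow (by fun_prop) (Or.inl this)
      · intro t; simp [cpow_eq_zero_iff, this]
  · refine ae_of_all _ fun t ht => ?_
    rw [norm_mul]
    have : ‖LSeries.term (fun n => (b n : ℂ)) (σ + I * t) n‖ =
        ‖LSeries.term (fun n => (b n : ℂ)) σ n‖ := by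
      simp [LSeries.norm_term_eq]
    rw [this]
    exact mul_le_of_le_one_left (norm_nonneg _) (norm_weight_le hT y ht)
  · exact ae_of_all _ fun t _ => hs.norm
  · simp
  · exact ae_of_all _ fun t _ => (hsum t).hasSum.mul_left _

lemma pole_part {T : ℝ} (hT : 0 < T) (y : ℝ) {ε : ℝ} (hε : 0 < ε) :
    (∫ t in (0 : ℝ)..T, ((1 - t / T : ℝ) : ℂ) * cexp (I * t * y) * (1 / (ε + I * t))).re =
      ∫ v in Set.Ioi (0 : ℝ), Real.exp (-v * ε) * fej T (v - y) := by
  have h1 : ∀ t : ℝ, (1 / (ε + I * t) : ℂ) =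
      ∫ v in Set.Ioi (0 : ℝ), cexp (-(ε + I * t) * v) := by
    intro t
    rw [integral_exp_mul_complex_Ioi (by simpa using hε)]
    simp only [ofReal_zero, mul_zero, Complex.exp_zero, neg_div_neg_eq]
  have hF : Integrable (Function.uncurry fun (t v : ℝ) => ((1 - t / T : ℝ) : ℂ) *
      cexp (I * t * y) * cexp (-(ε + I * t) * v))
      ((volume.restrict (Set.uIoc 0 T)).prod (volume.restrict (Set.Ioi (0 : ℝ)))) := by
    have hb : Integrable (fun p : ℝ × ℝ => (1 : ℝ) * Real.exp (-ε * p.2))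
        ((volume.restrict (Set.uIoc 0 T)).prod (volume.restrict (Set.Ioi (0 : ℝ)))) := by
      refine Integrable.mul_prod (f := fun _ : ℝ => (1 : ℝ)) (g := fun v => Real.exp (-ε * v)) ?_ ?_
      · exact (continuous_const.intervalIntegrable 0 T).def'
      · exact integrableOn_exp_mul_Ioi (by linarith) 0
    refine hb.mono' (Continuous.aestronglyMeasurable (by fun_prop)) ?_
    rw [Measure.prod_restrict]
    refine (ae_restrict_mem (measurableSet_uIoc.prod measurableSet_Ioi)).mono ?_
    rintro ⟨t, v⟩ ⟨ht, hv⟩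
    rw [Set.uIoc_of_le hT.le] at ht
    simp only [Function.uncurry_apply_pair, norm_mul, norm_exp]
    have h1 : |1 - t / T| ≤ 1 := by
      have := div_nonneg ht.1.le hT.le
      have : t / T ≤ 1 := (div_le_one hT).2 ht.2
      rw [abs_le]
      constructor <;> linarith
    have h2 : ‖((1 - t / T : ℝ) : ℂ)‖ ≤ 1 := by rwa [norm_real, Real.norm_eq_abs]
    have h3 : (I * t * y).re = 0 := by simp
    have h4 : (-(ε + I * t) * v : ℂ).re = -ε * v := by simp
    rw [h3, h4, Real.exp_zero, mul_one]
    gcongr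
  simp_rw [h1, ← integral_const_mul]
  rw [intervalIntegral_integral_swap hF]
  have h3 : ∀ v : ℝ, (∫ t in (0 : ℝ)..T, ((1 - t / T : ℝ) : ℂ) *
      cexp (I * t * y) * cexp (-(ε + I * t) * v)) = Real.exp (-v * ε) *
      ∫ t in (0 : ℝ)..T, ((1 - t / T : ℝ) : ℂ) * cexp (I * t * (-(v - y : ℝ))) := by
    intro v
    rw [← intervalIntegral.integral_const_mul]
    refine intervalIntegral.integral_congr fun t _ => ?_
    rw [ofReal_exp, mul_assoc, ← Complex.exp_add, mul_left_comm, ← Complex.exp_add]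
    congr 2
    push_cast; ring
  have hintg := hF.integral_prod_right
  simp only [Function.uncurry_apply_pair] at hintg
  simp_rw [intervalIntegral.integral_of_le hT.le,
    ← Set.uIoc_of_le hT.le] at h3 ⊢
  have := integral_re hintg
  simp only [RCLike.re_to_complex] at this
  rw [← this]
  refine integral_congr_ae (ae_of_all _ fun v => ?_)
  beta_reduce
  rw [h3, re_ofReal_mul, fej_eq_re, intervalIntegral.integral_of_le hT.le,
    ← Set.uIoc_of_le hT.le]

theorem fejer_identity {T : ℝ} (hT : 0 < T) {b : ℕ → ℝ} (hb : ∀ n, 0 ≤ b n) {c : ℝ}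
    {R : ℂ → ℂ} (hs : ∀ σ : ℝ, 1 < σ → LSeriesSummable (fun n => (b n : ℂ)) σ)
    (hR : ContinuousOn R {s | 1 ≤ s.re ∧ s.re ≤ 1 + T ∧ |s.im| ≤ T})
    (hL : ∀ s : ℂ, 1 < s.re → s.re ≤ 1 + T → |s.im| ≤ T →
      LSeries (fun n => (b n : ℂ)) s = c / (s - 1) + R s) (y : ℝ) :
    HasSum (fun n => b n / n * fej T (Real.log n - y))
      (c * (∫ v in Set.Ioi (0 : ℝ), fej T (v - y)) +
        (∫ t in (0 : ℝ)..T, ((1 - t / T : ℝ) : ℂ) * cexp (I * t * y) * R (1 + I * t)).re) := by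
  have hS : ∀ σ : ℝ, 1 < σ → σ ≤ 1 + T →
      HasSum (fun n => b n * (n : ℝ) ^ (-σ) * fej T (Real.log n - y))
        (c * (∫ v in Set.Ioi (0 : ℝ), Real.exp (-v * (σ - 1)) * fej T (v - y)) +
        (∫ t in (0 : ℝ)..T, ((1 - t / T : ℝ) : ℂ) * cexp (I * t * y) * R (σ + I * t)).re) := by
    intro σ h1 h2
    convert fej_series hT y (by linarith) (hs σ h1) using 1
    rw [← pole_part hT y (sub_pos.2 h1), ← re_ofReal_mul, ← intervalIntegral.integral_const_mul,
      ← add_re, ← intervalIntegral.integral_add]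
    · congr 1
      refine intervalIntegral.integral_congr fun t ht => ?_
      rw [Set.uIcc_of_le hT.le] at ht
      rw [hL _ (by simpa using h1) (by simpa using h2)
        (by simpa [abs_of_nonneg ht.1] using ht.2)]
      push_cast
      ring
    · apply Continuous.intervalIntegrable
      refine continuous_const.mul (Continuous.mul (by fun_prop) ?_)
      refine continuous_const.div (by fun_prop) fun t h => ?_
      have := congrArg re h
      simp at this
      linarith
    · apply ContinuousOn.intervalIntegrable
      refine ContinuousOn.mul (by fun_prop) (hR.comp (by fun_prop) fun t ht => ?_)
      rw [Set.uIcc_of_le hT.le] at ht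
      simp only [Set.mem_ofPred_eq]
      simp [abs_of_nonneg ht.1, h1.le, h2, ht.2]
  have hlim : Tendsto (fun σ : ℝ => c * (∫ v in Set.Ioi (0 : ℝ), Real.exp (-v * (σ - 1)) *
      fej T (v - y)) + (∫ t in (0 : ℝ)..T, ((1 - t / T : ℝ) : ℂ) * cexp (I * t * y) *
        R (σ + I * t)).re) (𝓝[>] 1) (𝓝 (c * (∫ v in Set.Ioi (0 : ℝ), fej T (v - y)) +
        (∫ t in (0 : ℝ)..T, ((1 - t / T : ℝ) : ℂ) * cexp (I * t * y) * R (1 + I * t)).re)) := by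
    refine Tendsto.add (Tendsto.const_mul _ ?_) ((continuous_re.tendsto _).comp ?_)
    · refine tendsto_integral_filter_of_dominated_convergence (fun v => fej T (v - y)) ?_ ?_ ?_ ?_
      · refine Eventually.of_forall fun σ => Measurable.aestronglyMeasurable ?_
        have := fej_measurable hT
        fun_prop
      · filter_upwards [self_mem_nhdsWithin] with σ hσ
        filter_upwards [ae_restrict_mem measurableSet_Ioi] with v hv
        rw [norm_mul, Real.norm_of_nonneg (fej_nonneg hT _), Real.norm_of_nonneg (Real.exp_pos _).le]
        refine mul_le_of_le_one_left (fej_nonneg hT _) (Real.exp_le_one_iff.2 ?_)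
        have : 0 ≤ v * (σ - 1) := mul_nonneg (le_of_lt hv) (sub_nonneg.2 (le_of_lt hσ))
        linarith
      · exact ((fej_integrable hT).comp_sub_right y).integrableOn
      · refine ae_of_all _ fun v => ?_
        have : Continuous fun σ : ℝ => Real.exp (-v * (σ - 1)) * fej T (v - y) := by fun_prop
        have := this.tendsto 1
        simp only [sub_self, mul_zero, Real.exp_zero, one_mul] at this
        exact this.mono_left nhdsWithin_le_nhds
    · have hK : IsCompact {s : ℂ | 1 ≤ s.re ∧ s.re ≤ 1 + T ∧ |s.im| ≤ T} := by
        have : {s : ℂ | 1 ≤ s.re ∧ s.re ≤ 1 + T ∧ |s.im| ≤ T} =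
            Set.Icc 1 (1 + T) ×ℂ Set.Icc (-T) T := by
          ext s; simp [mem_reProdIm, abs_le, and_assoc]
        rw [this]
        exact isCompact_Icc.reProdIm isCompact_Icc
      obtain ⟨B, hB⟩ := hK.exists_bound_of_continuousOn hR
      have hmem : ∀ᶠ σ : ℝ in 𝓝[>] 1, 1 < σ ∧ σ ≤ 1 + T := by
        filter_upwards [Ioc_mem_nhdsGT (show (1 : ℝ) < 1 + T by linarith)] with σ hσ using hσ
      have hin : ∀ σ : ℝ, 1 ≤ σ → σ ≤ 1 + T → ∀ t ∈ Set.Icc 0 T,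
          (σ + I * t : ℂ) ∈ {s : ℂ | 1 ≤ s.re ∧ s.re ≤ 1 + T ∧ |s.im| ≤ T} := by
        intro σ h1 h2 t ht
        simp only [Set.mem_ofPred_eq]
        simp [abs_of_nonneg ht.1, h1, h2, ht.2]
      refine intervalIntegral.tendsto_integral_filter_of_dominated_convergence (fun _ => B) ?_ ?_ ?_ ?_
      · filter_upwards [hmem] with σ hσ
        rw [Set.uIoc_of_le hT.le]
        refine (ContinuousOn.mono ?_ Set.Ioc_subset_Icc_self).aestronglyMeasurable measurableSet_Ioc
        exact ContinuousOn.mul (by fun_prop) (hR.comp (by fun_prop) (hin σ hσ.1.le hσ.2))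
      · filter_upwards [hmem] with σ hσ
        refine ae_of_all _ fun t ht => ?_
        rw [norm_mul]
        have := hB _ (hin σ hσ.1.le hσ.2 t (by
          rw [Set.uIoc_of_le hT.le] at ht; exact Set.Ioc_subset_Icc_self ht))
        calc _ ≤ 1 * B := mul_le_mul (norm_weight_le hT y ht) this (norm_nonneg _) zero_le_one
          _ = B := one_mul B
      · simp
      · refine ae_of_all _ fun t ht => ?_
        rw [Set.uIoc_of_le hT.le] at ht
        have ht' := Set.Ioc_subset_Icc_self ht
        refine Tendsto.const_mul _ ?_
        have h1 := hR _ (hin 1 le_rfl (by linarith) t ht')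
        simp only [ofReal_one] at h1
        refine h1.tendsto.comp (tendsto_nhdsWithin_iff.2 ⟨?_, ?_⟩)
        · have : Continuous fun σ : ℝ => (σ + I * t : ℂ) := by fun_prop
          simpa using (this.tendsto 1).mono_left nhdsWithin_le_nhds
        · filter_upwards [hmem] with σ hσ using hin σ hσ.1.le hσ.2 t ht'
  have hmem : ∀ᶠ σ : ℝ in 𝓝[>] 1, 1 < σ ∧ σ ≤ 1 + T := by
    filter_upwards [Ioc_mem_nhdsGT (show (1 : ℝ) < 1 + T by linarith)] with σ hσ using hσ
  set F := fun n : ℕ => b n / n * fej T (Real.log n - y)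
  have hF0 : ∀ n, 0 ≤ F n := fun n => mul_nonneg (div_nonneg (hb n) (Nat.cast_nonneg n))
    (fej_nonneg hT _)
  have hterm : ∀ n : ℕ, Tendsto (fun σ : ℝ => b n * (n : ℝ) ^ (-σ) * fej T (Real.log n - y))
      (𝓝[>] 1) (𝓝 (F n)) := by
    intro n
    rcases eq_or_ne n 0 with rfl | hn
    · refine Tendsto.congr' (f₁ := fun _ => F 0) ?_ tendsto_const_nhds
      filter_upwards [hmem] with σ hσ
      have : -σ ≠ 0 := by linarith [hσ.1]
      simp [F, Real.zero_rpow this]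
    · have hn' : (0 : ℝ) < n := by positivity
      have : Continuous fun σ : ℝ => b n * (n : ℝ) ^ (-σ) * fej T (Real.log n - y) := by
        refine (continuous_const.mul ?_).mul continuous_const
        exact continuous_const.rpow continuous_neg (fun _ => Or.inl hn'.ne')
      have := (this.tendsto 1).mono_left (nhdsWithin_le_nhds (s := Set.Ioi 1))
      simpa [F, Real.rpow_neg_one, div_eq_mul_inv] using this
  have hle : ∀ σ : ℝ, 1 < σ → ∀ n : ℕ, b n * (n : ℝ) ^ (-σ) * fej T (Real.log n - y) ≤ F n := by
    intro σ hσ n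
    refine mul_le_mul_of_nonneg_right ?_ (fej_nonneg hT _)
    rw [div_eq_mul_inv]
    refine mul_le_mul_of_nonneg_left ?_ (hb n)
    rcases eq_or_ne n 0 with rfl | hn
    · have : -σ ≠ 0 := by linarith
      simp [Real.zero_rpow this]
    · have hn' : (1 : ℝ) ≤ n := by exact_mod_cast Nat.one_le_iff_ne_zero.2 hn
      rw [← Real.rpow_neg_one]
      exact Real.rpow_le_rpow_of_exponent_le hn' (by linarith)
  have hpos : ∀ (σ : ℝ) (n : ℕ), 0 ≤ b n * (n : ℝ) ^ (-σ) * fej T (Real.log n - y) :=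
    fun σ n => mul_nonneg (mul_nonneg (hb n) (by positivity)) (fej_nonneg hT _)
  have hsummable : Summable F := by
    refine summable_of_sum_le hF0 (c := c * (∫ v in Set.Ioi (0 : ℝ), fej T (v - y)) +
      (∫ t in (0 : ℝ)..T, ((1 - t / T : ℝ) : ℂ) * cexp (I * t * y) * R (1 + I * t)).re) fun u => ?_
    refine le_of_tendsto_of_tendsto (tendsto_finsetSum u fun n _ => hterm n) hlim ?_
    filter_upwards [hmem] with σ hσ
    exact sum_le_hasSum u (fun n _ => hpos σ n) (hS σ hσ.1 hσ.2)
  have hlim2 := tendsto_tsum_of_dominated_convergence hsummable hterm (by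
    filter_upwards [hmem] with σ hσ n
    rw [Real.norm_of_nonneg (hpos σ n)]
    exact hle σ hσ.1 n)
  have heq := tendsto_nhds_unique (hlim2.congr' (by
    filter_upwards [hmem] with σ hσ using (hS σ hσ.1 hσ.2).tsum_eq)) hlim
  rw [← heq]
  exact hsummable.hasSum

end CuspPrime

namespace CuspPrime

open scoped Topology
open MeasureTheory

/-- The Dirichlet series of the nonnegative sequence `b` converges for `re s > 1` and, after
subtracting the polar part `c / (s - 1)`, extends continuously to height `T` on `re s = 1`. -/
structure PolarData (T : ℝ) (b : ℕ → ℝ) (c : ℝ) : Prop where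
  nonneg : ∀ n, 0 ≤ b n
  summable : ∀ σ : ℝ, 1 < σ → LSeriesSummable (fun n => (b n : ℂ)) σ
  continuation : ∃ R : ℂ → ℂ, ContinuousOn R {s | 1 ≤ s.re ∧ s.re ≤ 1 + T ∧ |s.im| ≤ T} ∧
    ∀ s : ℂ, 1 < s.re → s.re ≤ 1 + T → |s.im| ≤ T →
      LSeries (fun n => (b n : ℂ)) s = c / (s - 1) + R s

lemma PolarData.mono {T T' : ℝ} {b : ℕ → ℝ} {c : ℝ} (h : PolarData T b c) (hT : T' ≤ T) :
    PolarData T' b c := by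
  obtain ⟨h1, h2, R, h3, h4⟩ := h
  refine ⟨h1, h2, R, h3.mono fun s hs => ⟨hs.1, hs.2.1.trans (by linarith), hs.2.2.trans hT⟩, ?_⟩
  exact fun s a b c => h4 s a (by linarith) (by linarith)

/-- The Fejér-smoothed mass of `b n / n` around `log n = y`. -/
def fejMass (T : ℝ) (b : ℕ → ℝ) (y : ℝ) : ℝ := ∑' n : ℕ, b n / n * fej T (Real.log n - y)

lemma PolarData.summable_fej {T : ℝ} (hT : 0 < T) {b : ℕ → ℝ} {c : ℝ} (h : PolarData T b c)
    (y : ℝ) : Summable fun n : ℕ => b n / n * fej T (Real.log n - y) := by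
  obtain ⟨h1, h2, R, h3, h4⟩ := h
  exact (fejer_identity hT h1 h2 h3 h4 y).summable

lemma continuousOn_line {T : ℝ} {R : ℂ → ℂ} (hT : 0 < T)
    (hR : ContinuousOn R {s | 1 ≤ s.re ∧ s.re ≤ 1 + T ∧ |s.im| ≤ T}) :
    ContinuousOn (fun t : ℝ => R (1 + I * t)) (Set.Icc 0 T) := by
  refine hR.comp (by fun_prop) fun t ht => ?_
  simp only [Set.mem_ofPred_eq]
  simp [abs_of_nonneg ht.1, ht.2, hT.le]

lemma PolarData.bounded {T : ℝ} (hT : 0 < T) {b : ℕ → ℝ} {c : ℝ} (h : PolarData T b c) :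
    ∃ C, ∀ y, fejMass T b y ≤ C := by
  obtain ⟨h1, h2, R, h3, h4⟩ := h
  refine ⟨|c| * (∫ v, fej T v) + ∫ t in (0 : ℝ)..T, ‖R (1 + I * t)‖, fun y => ?_⟩
  rw [fejMass, (fejer_identity hT h1 h2 h3 h4 y).tsum_eq]
  have hintg := fej_integrable hT
  refine add_le_add ?_ ?_
  · have : (∫ v in Set.Ioi (0 : ℝ), fej T (v - y)) ≤ ∫ v, fej T v := by
      refine (setIntegral_le_integral (hintg.comp_sub_right y)
        (ae_of_all _ fun v => fej_nonneg hT _)).trans_eq ?_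
      exact integral_sub_right_eq_self (fej T) y
    have h0 : 0 ≤ ∫ v in Set.Ioi (0 : ℝ), fej T (v - y) :=
      integral_nonneg fun v => fej_nonneg hT _
    exact mul_le_mul (le_abs_self c) this h0 (abs_nonneg c)
  · refine (re_le_norm _).trans (intervalIntegral.norm_integral_le_of_norm_le hT.le ?_ ?_)
    · refine ae_of_all _ fun t ht => ?_
      rw [norm_mul]
      refine mul_le_of_le_one_left (norm_nonneg _) (norm_weight_le hT y ?_)
      rwa [Set.uIoc_of_le hT.le]
    · refine ContinuousOn.intervalIntegrable ?_
      rw [Set.uIcc_of_le hT.le]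
      exact (continuousOn_line hT h3).norm

lemma PolarData.tendsto {T : ℝ} (hT : 0 < T) {b : ℕ → ℝ} {c : ℝ} (h : PolarData T b c) :
    Tendsto (fejMass T b) atTop (𝓝 (c * ∫ v, fej 1 v)) := by
  obtain ⟨h1, h2, R, h3, h4⟩ := h
  have hintg := fej_integrable hT
  have : fejMass T b = fun y => c * (∫ v in Set.Ioi (0 : ℝ), fej T (v - y)) +
        (∫ t in (0 : ℝ)..T, ((1 - t / T : ℝ) : ℂ) * cexp (I * t * y) * R (1 + I * t)).re :=
    funext fun y => (fejer_identity hT h1 h2 h3 h4 y).tsum_eq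
  rw [this, ← integral_fej hT]
  have key : Tendsto (fun y : ℝ => ∫ t in (0 : ℝ)..T, ((1 - t / T : ℝ) : ℂ) * cexp (I * t * y) *
      R (1 + I * t)) atTop (𝓝 0) := by
    have h5 := Real.tendsto_integral_exp_smul_cocompact ((Set.Ioc 0 T).indicator
      fun t : ℝ => ((1 - t / T : ℝ) : ℂ) * R (1 + I * t))
    have h6 : Tendsto (fun y : ℝ => -y / (2 * Real.pi)) atTop (cocompact ℝ) := by
      have h7 : Tendsto (fun y : ℝ => y / (2 * Real.pi)) atTop atTop :=
        tendsto_id.atTop_div_const (by positivity)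
      refine (Tendsto.mono_right (tendsto_neg_atTop_atBot.comp h7)
        atBot_le_cocompact).congr fun y => ?_
      simp [neg_div]
    refine (h5.comp h6).congr fun y => ?_
    simp only [Function.comp_def]
    rw [intervalIntegral.integral_of_le hT.le, ← integral_indicator measurableSet_Ioc]
    refine integral_congr_ae (ae_of_all _ fun t => ?_)
    beta_reduce
    by_cases ht : t ∈ Set.Ioc 0 T
    · rw [Set.indicator_of_mem ht, Set.indicator_of_mem ht, Circle.smul_def, Real.fourierChar_apply,
        smul_eq_mul]
      rw [show ((2 * Real.pi * -(t * (-y / (2 * Real.pi))) : ℝ) : ℂ) * I = I * t * y by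
        have := Real.pi_ne_zero
        rw [show 2 * Real.pi * -(t * (-y / (2 * Real.pi))) = t * y by field_simp]
        push_cast; ring]
      ring
    · rw [Set.indicator_of_notMem ht, Set.indicator_of_notMem ht, smul_zero]
  have h8 : Tendsto (fun y : ℝ => ∫ v in Set.Ioi (0 : ℝ), fej T (v - y)) atTop
      (𝓝 (∫ v, fej T v)) := by
    have h9 := (aecover_Ioi (μ := volume) tendsto_neg_atTop_atBot).integral_tendsto_of_countably_generated
      hintg
    refine h9.congr fun y => ?_
    rw [← integral_indicator measurableSet_Ioi, ← integral_indicator measurableSet_Ioi,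
      ← integral_sub_right_eq_self _ y]
    refine integral_congr_ae (ae_of_all _ fun v => ?_)
    simp [Set.indicator_apply]
  simpa using (h8.const_mul c).add ((continuous_re.tendsto _).comp key)

/-- The integers `n ≥ 1` with `|log n - y| ≤ M`. -/
def win (M y : ℝ) : Finset ℕ :=
  (Finset.Icc 1 ⌊Real.exp (y + M)⌋₊).filter fun n => |Real.log n - y| ≤ M

lemma mem_win {M y : ℝ} {n : ℕ} : n ∈ win M y ↔ 1 ≤ n ∧ |Real.log n - y| ≤ M := by
  simp only [win, Finset.mem_filter, Finset.mem_Icc]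
  refine ⟨fun h => ⟨h.1.1, h.2⟩, fun h => ⟨⟨h.1, ?_⟩, h.2⟩⟩
  rw [Nat.le_floor_iff (Real.exp_pos _).le]
  have hn : (0 : ℝ) < n := by exact_mod_cast h.1
  rw [← Real.log_le_iff_le_exp hn]
  linarith [(abs_le.1 h.2).2]

lemma PolarData.win_le {T : ℝ} (hT : 0 < T) {b : ℕ → ℝ} {c : ℝ} (h : PolarData T b c) (M : ℝ) :
    ∃ C, ∀ y, ∑ n ∈ win M y, b n / n ≤ C := by
  wlog hM : 0 < M generalizing M
  · obtain ⟨C, hC⟩ := this 1 one_pos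
    refine ⟨C, fun y => (Finset.sum_le_sum_of_subset_of_nonneg ?_ ?_).trans (hC y)⟩
    · intro n
      simp only [mem_win]
      exact fun hn => ⟨hn.1, hn.2.trans (by linarith)⟩
    · exact fun n _ _ => div_nonneg (h.nonneg n) (Nat.cast_nonneg n)
  set T' := min T (1 / M)
  have hT' : 0 < T' := lt_min hT (by positivity)
  have h' := h.mono (min_le_left T (1 / M))
  obtain ⟨C, hC⟩ := h'.bounded hT'
  refine ⟨4 / T' * C, fun y => ?_⟩
  have h1 : ∑ n ∈ win M y, b n / n * fej T' (Real.log n - y) ≤ fejMass T' b y :=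
    (h'.summable_fej hT' y).sum_le_tsum _ fun n _ =>
      mul_nonneg (div_nonneg (h.nonneg n) (Nat.cast_nonneg n)) (fej_nonneg hT' _)
  have h2 : ∑ n ∈ win M y, b n / n * (T' / 4) ≤ ∑ n ∈ win M y, b n / n * fej T' (Real.log n - y) := by
    refine Finset.sum_le_sum fun n hn => ?_
    refine mul_le_mul_of_nonneg_left (fej_lower hT' ((mem_win.1 hn).2.trans ?_))
      (div_nonneg (h.nonneg n) (Nat.cast_nonneg n))
    rw [le_div_iff₀ hT', ← le_div_iff₀' hM]
    exact min_le_right _ _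
  rw [← Finset.sum_mul] at h2
  have h3 := (h2.trans h1).trans (hC y)
  rw [div_mul_eq_mul_div, le_div_iff₀ hT']
  linarith

lemma tendsto_div_of_polarData {b : ℕ → ℝ} {c : ℝ} (h : ∀ T, 0 < T → PolarData T b c) :
    Tendsto (fun n : ℕ => b n / n) atTop (𝓝 0) := by
  set J := ∫ v, fej 1 v
  have hb := (h 1 one_pos).nonneg
  have hlog : Tendsto (fun n : ℕ => Real.log n) atTop atTop :=
    Real.tendsto_log_atTop.comp tendsto_natCast_atTop_atTop
  rw [Metric.tendsto_atTop']
  intro ε hε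
  set T := 2 * (|c * J| + 1) / ε
  have hT : 0 < T := by positivity
  have h1 := ((h T hT).tendsto hT).comp hlog
  have h2 : ∀ᶠ n : ℕ in atTop, fejMass T b (Real.log n) < |c * J| + 1 := by
    refine h1.eventually (Iio_mem_nhds ?_)
    have := le_abs_self (c * J)
    linarith
  obtain ⟨N, hN⟩ := eventually_atTop.1 h2
  refine ⟨N, fun n hn => ?_⟩
  have h3 : b n / n * fej T (Real.log n - Real.log n) ≤ fejMass T b (Real.log n) :=
    ((h T hT).summable_fej hT _).le_tsum n fun n _ =>
      mul_nonneg (div_nonneg (hb n) (Nat.cast_nonneg n)) (fej_nonneg hT _)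
  have h4 := h3.trans_lt (hN n hn.le)
  rw [sub_self, fej_zero hT] at h4
  have h5 : 0 ≤ b n / n := div_nonneg (hb n) (Nat.cast_nonneg n)
  rw [Real.dist_0_eq_abs, abs_of_nonneg h5]
  have h6 : T / 2 = (|c * J| + 1) / ε := by simp only [T]; ring
  rw [h6, ← mul_div_assoc, div_lt_iff₀ hε] at h4
  have : (0 : ℝ) < |c * J| + 1 := by positivity
  nlinarith

lemma fej_le {T : ℝ} (hT : 0 < T) (u : ℝ) : fej T u ≤ T / 2 := by
  rw [← fej_zero hT, fej, fej]
  refine intervalIntegral.integral_mono_on hT.le ?_ ?_ fun t ht => ?_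
  · apply Continuous.intervalIntegrable; fun_prop
  · apply Continuous.intervalIntegrable; fun_prop
  · have : t / T ≤ 1 := (div_le_one hT).2 ht.2
    have := Real.cos_le_one (t * u)
    simp only [mul_zero, Real.cos_zero]
    nlinarith

lemma PolarData.win_ge {T : ℝ} (hT : 0 < T) {b : ℕ → ℝ} {c : ℝ} (h : PolarData T b c)
    (hc : 0 < c) : ∃ M : ℝ, 0 < M ∧ ∃ δ : ℝ, 0 < δ ∧ ∃ y₀ : ℝ, ∀ y, y₀ ≤ y →
      δ ≤ ∑ n ∈ win M y, b n / n := by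
  set J := ∫ v, fej 1 v
  have hJ : 0 < J := integral_fej_one_pos
  have hb : ∀ n : ℕ, 0 ≤ b n / n := fun n => div_nonneg (h.nonneg n) (Nat.cast_nonneg n)
  obtain ⟨C, hC⟩ := h.win_le hT (1 / T)
  have hC0 : 0 ≤ C := (Finset.sum_nonneg fun n _ => hb n).trans (hC 0)
  have hsumm : Summable fun k : ℤ => 1 / (k : ℝ) ^ 2 :=
    Real.summable_one_div_int_pow.2 one_lt_two
  set ε := c * J / 4 / (8 * T * (C + 1))
  have hε : 0 < ε := by positivity
  obtain ⟨S, hS⟩ := summable_iff_vanishing_norm.1 hsumm ε hε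
  obtain ⟨B, hB⟩ := (S.image fun k : ℤ => |(k : ℝ)|).bddAbove
  have hB' : ∀ k ∈ S, |(k : ℝ)| ≤ B := fun k hk =>
    hB (Finset.mem_coe.2 (Finset.mem_image_of_mem _ hk))
  set M := (|B| + 3) / T
  have hM : 0 < M := by positivity
  -- the contribution of the tail
  have htail : ∀ y, ∀ s : Finset ℕ, (∀ n ∈ s, M < |Real.log n - y|) → (∀ n ∈ s, 1 ≤ n) →
      ∑ n ∈ s, b n / n * fej T (Real.log n - y) ≤ c * J / 4 := by
    intro y s hs hs1
    set κ : ℕ → ℤ := fun n => ⌊(Real.log n - y) * T⌋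
    have hκ : ∀ n ∈ s, |B| + 2 < |(κ n : ℝ)| := by
      intro n hn
      have h1 := hs n hn
      rw [div_lt_iff₀ hT, ← abs_of_pos hT, ← abs_mul] at h1
      have h2 := Int.floor_le ((Real.log n - y) * T)
      have h3 := Int.lt_floor_add_one ((Real.log n - y) * T)
      have h4 : |(Real.log n - y) * T - κ n| ≤ 1 := by
        rw [abs_le]; constructor <;> linarith
      have h5 := abs_sub_abs_le_abs_sub ((Real.log n - y) * T) (κ n)
      linarith
    have hfej : ∀ n ∈ s, fej T (Real.log n - y) ≤ 8 * T * (1 / (κ n : ℝ) ^ 2) := by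
      intro n hn
      have h1 := hκ n hn
      have h2 := Int.floor_le ((Real.log n - y) * T)
      have h3 := Int.lt_floor_add_one ((Real.log n - y) * T)
      have hB0 := abs_nonneg B
      have hu : Real.log n - y ≠ 0 := by
        intro h0
        have := hs n hn
        rw [h0, abs_zero] at this
        linarith
      have hk0 : (κ n : ℝ) ≠ 0 := by
        intro h0; rw [h0, abs_zero] at h1; linarith
      have h6 : (κ n : ℝ) ^ 2 ≤ 4 * ((Real.log n - y) * T) ^ 2 := by
        have : |(κ n : ℝ)| ≤ |2 * ((Real.log n - y) * T)| := by
          rw [abs_mul, abs_two]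
          have h4 : |(Real.log n - y) * T - κ n| ≤ 1 := by
            rw [abs_le]; constructor <;> linarith
          have h5 := abs_sub_abs_le_abs_sub (κ n : ℝ) ((Real.log n - y) * T)
          rw [abs_sub_comm] at h5
          linarith
        have := sq_le_sq.2 this
        nlinarith
      refine (fej_upper hT hu).trans ?_
      rw [mul_one_div, div_le_div_iff₀ (by positivity) (by positivity)]
      nlinarith
    calc ∑ n ∈ s, b n / n * fej T (Real.log n - y)
        ≤ ∑ n ∈ s, b n / n * (8 * T * (1 / (κ n : ℝ) ^ 2)) :=
          Finset.sum_le_sum fun n hn => mul_le_mul_of_nonneg_left (hfej n hn) (hb n)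
      _ = ∑ k ∈ s.image κ, ∑ n ∈ s with κ n = k, b n / n * (8 * T * (1 / (κ n : ℝ) ^ 2)) :=
          (Finset.sum_fiberwise_of_maps_to (fun n hn => Finset.mem_image_of_mem κ hn) _).symm
      _ ≤ ∑ k ∈ s.image κ, C * (8 * T * (1 / (k : ℝ) ^ 2)) := by
          refine Finset.sum_le_sum fun k _ => ?_
          have : ∑ n ∈ s with κ n = k, b n / n * (8 * T * (1 / (κ n : ℝ) ^ 2)) =
              (∑ n ∈ s with κ n = k, b n / n) * (8 * T * (1 / (k : ℝ) ^ 2)) := by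
            rw [Finset.sum_mul]
            refine Finset.sum_congr rfl fun n hn => ?_
            rw [(Finset.mem_filter.1 hn).2]
          rw [this]
          refine mul_le_mul_of_nonneg_right ?_ (by positivity)
          refine (Finset.sum_le_sum_of_subset_of_nonneg ?_ fun n _ _ => hb n).trans
            (hC (y + k / T))
          intro n hn
          obtain ⟨hn1, hn2⟩ := Finset.mem_filter.1 hn
          refine mem_win.2 ⟨hs1 n hn1, ?_⟩
          have h2 := Int.floor_le ((Real.log n - y) * T)
          have h3 := Int.lt_floor_add_one ((Real.log n - y) * T)
          have h4 : |(Real.log n - y) * T - k| ≤ 1 := by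
            rw [← hn2, abs_le]; constructor <;> linarith
          have h5 : (Real.log n - (y + k / T)) * T = (Real.log n - y) * T - k := by
            field_simp
            ring
          rw [le_div_iff₀ hT]
          rwa [← h5, abs_mul, abs_of_pos hT] at h4
      _ = C * (8 * T) * ∑ k ∈ s.image κ, 1 / (k : ℝ) ^ 2 := by
          rw [Finset.mul_sum]; exact Finset.sum_congr rfl fun k _ => by ring
      _ ≤ C * (8 * T) * ε := by
          refine mul_le_mul_of_nonneg_left ?_ (by positivity)
          refine (le_abs_self _).trans (hS _ ?_).le
          rw [Finset.disjoint_left]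
          intro k hk hkS
          obtain ⟨n, hn, rfl⟩ := Finset.mem_image.1 hk
          have h1 := hκ n hn
          have h2 := hB' _ hkS
          have := le_abs_self B
          linarith
      _ ≤ (C + 1) * (8 * T) * ε := by gcongr; linarith
      _ = c * J / 4 := by simp only [ε]; field_simp
  have hev := (h.tendsto hT).eventually (lt_mem_nhds (show c * J / 2 < c * J by
    have : 0 < c * J := by positivity
    linarith))
  obtain ⟨y₀, hy₀⟩ := eventually_atTop.1 hev
  refine ⟨M, hM, 2 / T * (c * J / 4), by positivity, y₀, fun y hy => ?_⟩
  have h1 : fejMass T b y ≤ T / 2 * (∑ n ∈ win M y, b n / n) + c * J / 4 := by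
    refine Real.tsum_le_of_sum_le (fun n => mul_nonneg (hb n) (fej_nonneg hT _)) fun s => ?_
    rw [← Finset.sum_filter_add_sum_filter_not s (fun n => n ∈ win M y)]
    gcongr ?_ + ?_
    · rw [Finset.mul_sum]
      calc ∑ n ∈ s with n ∈ win M y, b n / n * fej T (Real.log n - y)
          ≤ ∑ n ∈ s with n ∈ win M y, T / 2 * (b n / n) :=
            Finset.sum_le_sum fun n _ => by
              rw [mul_comm (T / 2)]; exact mul_le_mul_of_nonneg_left (fej_le hT _) (hb n)
        _ ≤ ∑ n ∈ win M y, T / 2 * (b n / n) := by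
            refine Finset.sum_le_sum_of_subset_of_nonneg ?_ fun n _ _ =>
              mul_nonneg (by positivity) (hb n)
            intro n hn
            exact (Finset.mem_filter.1 hn).2
    · rw [← Finset.sum_filter_of_ne (p := fun n => 1 ≤ n)]
      · refine htail y _ (fun n hn => ?_) (fun n hn => (Finset.mem_filter.1 hn).2)
        obtain ⟨hn1, hn2⟩ := Finset.mem_filter.1 hn
        have := (Finset.mem_filter.1 hn1).2
        rw [mem_win, not_and, not_le] at this
        exact this hn2
      · intro n _ hn
        by_contra h0
        have : n = 0 := by omega
        simp [this] at hn
  have h2 := hy₀ y hy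
  rw [div_mul_eq_mul_div, div_le_iff₀ hT]
  nlinarith

end CuspPrime

namespace CuspPrime

open ArithmeticFunction

/-- The generating series of the values of an arithmetic function at powers of `p`. -/
def bell (p : ℕ) (f : ArithmeticFunction ℂ) : PowerSeries ℂ := PowerSeries.mk fun v => f (p ^ v)

lemma bell_mul {p : ℕ} (hp : p.Prime) (f g : ArithmeticFunction ℂ) :
    bell p (f * g) = bell p f * bell p g := by
  ext v
  rw [bell, PowerSeries.coeff_mk, PowerSeries.coeff_mul, ArithmeticFunction.mul_apply,
    Nat.sum_divisorsAntidiagonal (f := fun i j => f i * g j), Nat.divisors_prime_pow hp,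
    Finset.sum_map, Finset.Nat.sum_antidiagonal_eq_sum_range_succ_mk]
  refine Finset.sum_congr rfl fun i hi => ?_
  have hi' : i ≤ v := Nat.lt_succ_iff.1 (Finset.mem_range.1 hi)
  simp [bell, Nat.pow_div hi' hp.pos]

/-- The completely multiplicative function with prescribed values at primes. -/
def cmul (α : ℕ → ℂ) : ArithmeticFunction ℂ :=
  ⟨fun n => if n = 0 then 0 else n.factorization.prod fun p k => α p ^ k, by simp⟩

lemma cmul_one (α : ℕ → ℂ) : cmul α 1 = 1 := by simp [cmul]

lemma cmul_mul (α : ℕ → ℂ) (m n : ℕ) : cmul α (m * n) = cmul α m * cmul α n := by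
  rcases eq_or_ne m 0 with rfl | hm
  · simp
  rcases eq_or_ne n 0 with rfl | hn
  · simp
  simp only [cmul, ArithmeticFunction.coe_mk, hm, hn, mul_eq_zero, or_self, if_false]
  rw [Nat.factorization_mul hm hn, Finsupp.prod_add_index' (by simp) (by simp [pow_add])]

lemma cmul_prime_pow (α : ℕ → ℂ) {p : ℕ} (hp : p.Prime) (k : ℕ) : cmul α (p ^ k) = α p ^ k := by
  have : p ^ k ≠ 0 := pow_ne_zero _ hp.ne_zero
  simp only [cmul, ArithmeticFunction.coe_mk, this, if_false]
  rw [hp.factorization_pow, Finsupp.prod_single_index (by simp)]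

/-- Multiplication of an arithmetic function by the logarithm. -/
def lmul (f : ArithmeticFunction ℂ) : ArithmeticFunction ℂ := ⟨LSeries.logMul f, by simp [LSeries.logMul]⟩

lemma lmul_apply (f : ArithmeticFunction ℂ) (n : ℕ) : lmul f n = Real.log n * f n := by
  simp [lmul, LSeries.logMul, natCast_log]

lemma lmul_mul (f g : ArithmeticFunction ℂ) : lmul (f * g) = lmul f * g + f * lmul g := by
  ext n
  simp only [lmul_apply, ArithmeticFunction.mul_apply, ArithmeticFunction.add_apply]
  rw [Finset.mul_sum, ← Finset.sum_add_distrib]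
  refine Finset.sum_congr rfl fun x hx => ?_
  obtain ⟨h1, h2⟩ := Nat.mem_divisorsAntidiagonal.1 hx
  have hx1 : x.1 ≠ 0 := by rintro h; simp [h] at h1; exact h2 h1.symm
  have hx2 : x.2 ≠ 0 := by rintro h; simp [h] at h1; exact h2 h1.symm
  rw [← h1, Nat.cast_mul, Real.log_mul (by exact_mod_cast hx1) (by exact_mod_cast hx2)]
  push_cast
  ring

/-- The von Mangoldt function weighted by `w`. -/
def vMul (w : ℕ → ℂ) : ArithmeticFunction ℂ := ⟨fun n => (vonMangoldt n : ℂ) * w n, by simp⟩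

lemma vMul_apply (w : ℕ → ℂ) (n : ℕ) : vMul w n = (vonMangoldt n : ℂ) * w n := rfl

/-- `g` is the arithmetic logarithmic derivative of `f`. -/
def LogDer (f g : ArithmeticFunction ℂ) : Prop := lmul f = g * f

lemma LogDer.mul {f f' g g' : ArithmeticFunction ℂ} (h : LogDer f g) (h' : LogDer f' g') :
    LogDer (f * f') (g + g') := by
  unfold LogDer at *
  rw [lmul_mul, h, h']
  ring

lemma logDer_cm {f : ArithmeticFunction ℂ} (hf : ∀ m n, f (m * n) = f m * f n) :
    LogDer f (vMul f) := by
  ext n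
  rw [lmul_apply, ArithmeticFunction.mul_apply]
  have h := congrArg (fun F : ArithmeticFunction ℝ => ((F n : ℝ) : ℂ)) vonMangoldt_mul_zeta
  simp only [ArithmeticFunction.log_apply] at h
  rw [← h, ArithmeticFunction.mul_apply, ofReal_sum, Finset.sum_mul]
  refine Finset.sum_congr rfl fun x hx => ?_
  obtain ⟨h1, h2⟩ := Nat.mem_divisorsAntidiagonal.1 hx
  have hx2 : x.2 ≠ 0 := by rintro h; simp [h] at h1; exact h2 h1.symm
  rw [← h1, hf, vMul_apply]
  simp [zeta_apply, hx2]
  ring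

/-- The indicator function of the positive squares. -/
def sqInd : ArithmeticFunction ℂ := ⟨fun n => if n ≠ 0 ∧ IsSquare n then 1 else 0, by simp⟩

lemma sqInd_apply (n : ℕ) : sqInd n = if n ≠ 0 ∧ IsSquare n then 1 else 0 := rfl

lemma sqInd_mult : sqInd.IsMultiplicative := by
  refine ⟨by simp [sqInd_apply], fun {m n} h => ?_⟩
  rcases eq_or_ne m 0 with rfl | hm
  · simp
  rcases eq_or_ne n 0 with rfl | hn
  · simp
  have : IsSquare (m * n) ↔ IsSquare m ∧ IsSquare n := by
    refine ⟨fun hs => ?_, fun hs => hs.1.mul hs.2⟩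
    obtain ⟨r, hr⟩ := hs
    have hr' : m * n = r ^ 2 := by rw [hr, sq]
    obtain ⟨d, hd⟩ := exists_associated_pow_of_mul_eq_pow (Nat.isUnit_iff.2 h) hr'
    obtain ⟨e, he⟩ := exists_associated_pow_of_mul_eq_pow (Nat.isUnit_iff.2 h.symm)
      (mul_comm m n ▸ hr')
    rw [associated_iff_eq] at hd he
    exact ⟨⟨d, by rw [← hd, sq]⟩, ⟨e, by rw [← he, sq]⟩⟩
  simp only [sqInd_apply, this, mul_ne_zero hm hn, hm, hn, ne_eq, not_false_eq_true, true_and]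
  by_cases h1 : IsSquare m <;> by_cases h2 : IsSquare n <;> simp [h1, h2]

lemma bell_sqInd {p : ℕ} (hp : p.Prime) : bell p sqInd * (1 - PowerSeries.X ^ 2) = 1 := by
  have key : ∀ v, (sqInd (p ^ v) : ℂ) = if Even v then 1 else 0 := by
    intro v
    have : IsSquare (p ^ v) ↔ Even v := by
      constructor
      · rintro ⟨r, hr⟩
        have := congrArg (fun n => n.factorization p) hr
        have hr0 : r ≠ 0 := by rintro rfl; simp [hp.ne_zero] at hr
        simp [hp.factorization_pow, Nat.factorization_mul hr0 hr0] at this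
        exact ⟨_, this⟩
      · exact fun h => h.isSquare_pow p
    simp [sqInd_apply, this, hp.ne_zero]
  ext n
  rw [mul_sub, mul_one, map_sub, PowerSeries.coeff_mul_X_pow', bell, PowerSeries.coeff_mk, key,
    PowerSeries.coeff_one]
  match n with
  | 0 => simp
  | 1 => simp
  | n + 2 => simp [key, Nat.even_add]

lemma bell_cm {p : ℕ} {f : ArithmeticFunction ℂ} {x : ℂ} (h : ∀ k, f (p ^ k) = x ^ k) :
    bell p f * (1 - PowerSeries.C x * PowerSeries.X) = 1 := by
  ext n
  rw [mul_sub, mul_one, map_sub, ← mul_assoc, bell]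
  cases n with
  | zero => simp [h]
  | succ n => simp [h, PowerSeries.coeff_one, pow_succ, mul_comm]

end CuspPrime

namespace CuspPrime

open ArithmeticFunction

/-- The Hecke relations for normalised eigenvalues. -/
structure HeckeRel (l : ℕ → ℝ) : Prop where
  zero : l 0 = 0
  one : l 1 = 1
  rel : ∀ p : ℕ, p.Prime → ∀ n : ℕ, 1 ≤ n →
    l (p * n) + (if p ∣ n then l (n / p) else 0) = l p * l n

lemma HeckeRel.pow {l : ℕ → ℝ} (h : HeckeRel l) {p : ℕ} (hp : p.Prime) (k : ℕ) :
    l (p ^ (k + 2)) = l p * l (p ^ (k + 1)) - l (p ^ k) := by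
  have := h.rel p hp (p ^ (k + 1)) (Nat.pos_of_ne_zero (pow_ne_zero _ hp.ne_zero))
  rw [if_pos (dvd_pow_self p (by omega)), pow_succ p k, Nat.mul_div_cancel _ hp.pos] at this
  rw [show p ^ (k + 2) = p * (p ^ k * p) by ring, pow_succ]
  linarith

lemma HeckeRel.mul_prime_pow {l : ℕ → ℝ} (h : HeckeRel l) {p : ℕ} (hp : p.Prime) {n : ℕ}
    (hn : n.Coprime p) (k : ℕ) : l (p ^ k * n) = l (p ^ k) * l n := by
  have hn0 : n ≠ 0 := by rintro rfl; simp [hp.ne_one] at hn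
  have hpn : ¬ p ∣ n := fun hd => hp.one_lt.ne' (Nat.dvd_one.1 (hn ▸ Nat.dvd_gcd hd dvd_rfl))
  induction k using Nat.twoStepInduction with
  | zero => simp [h.one]
  | one => simpa [hpn] using h.rel p hp n (Nat.pos_of_ne_zero hn0)
  | more k ih1 ih2 =>
    have := h.rel p hp (p ^ (k + 1) * n) (Nat.pos_of_ne_zero (mul_ne_zero (pow_ne_zero _ hp.ne_zero) hn0))
    rw [if_pos (Dvd.dvd.mul_right (dvd_pow_self p (by omega)) n),
      show p ^ (k + 1) * n = p * (p ^ k * n) by ring, Nat.mul_div_cancel_left _ hp.pos] at this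
    rw [h.pow hp, show p ^ (k + 2) * n = p * (p * (p ^ k * n)) by ring]
    rw [show p * (p ^ k * n) = p ^ (k + 1) * n by ring, ih2, ih1] at this
    rw [show p * (p ^ k * n) = p ^ (k + 1) * n by ring]
    linarith

lemma HeckeRel.mul_coprime {l : ℕ → ℝ} (h : HeckeRel l) {m n : ℕ} (hmn : m.Coprime n) :
    l (m * n) = l m * l n := by
  induction m using Nat.recOnPosPrimePosCoprime generalizing n with
  | prime_pow p k hp hk =>
    exact h.mul_prime_pow hp ((Nat.coprime_pow_left_iff hk p n).1 hmn).symm k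
  | zero => simp [h.zero]
  | one => simp [h.one]
  | coprime a b ha hb hab iha ihb =>
    have h1 := Nat.Coprime.coprime_mul_left hmn
    have h2 := Nat.Coprime.coprime_mul_right hmn
    rw [mul_assoc, iha (Nat.Coprime.mul_right hab h2), ihb h1, iha hab, mul_assoc]

/-- A real sequence as a complex arithmetic function. -/
def toAF (l : ℕ → ℝ) : ArithmeticFunction ℂ := ⟨fun n => if n = 0 then 0 else (l n : ℂ), by simp⟩

lemma toAF_apply {l : ℕ → ℝ} {n : ℕ} (hn : n ≠ 0) : toAF l n = l n := by
  simp [toAF, hn]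

/-- The Rankin–Selberg convolution coefficients of two sequences. -/
def rsCoef (l l' : ℕ → ℝ) : ArithmeticFunction ℂ := toAF (fun n => l n * l' n) * sqInd

lemma toAF_mult {l l' : ℕ → ℝ} (h : HeckeRel l) (h' : HeckeRel l') :
    (toAF fun n => l n * l' n).IsMultiplicative := by
  refine ⟨by simp [toAF, h.one, h'.one], fun {m n} hmn => ?_⟩
  rcases eq_or_ne m 0 with rfl | hm
  · simp
  rcases eq_or_ne n 0 with rfl | hn
  · simp
  rw [toAF_apply hm, toAF_apply hn, toAF_apply (mul_ne_zero hm hn), h.mul_coprime hmn,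
    h'.mul_coprime hmn]
  push_cast
  ring

lemma exists_add_inv (t : ℂ) : ∃ α : ℂ, α ≠ 0 ∧ α + α⁻¹ = t := by
  obtain ⟨w, hw⟩ := IsAlgClosed.exists_pow_nat_eq (t ^ 2 - 4) two_pos
  have h1 : (t + w) / 2 * ((t - w) / 2) = 1 := by linear_combination -hw / 4
  have h0 : (t + w) / 2 ≠ 0 := left_ne_zero_of_mul_eq_one h1
  refine ⟨(t + w) / 2, h0, ?_⟩
  rw [← eq_inv_of_mul_eq_one_right h1]
  ring

/-- A Satake parameter of `l` at `p`. -/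
def sat (l : ℕ → ℝ) (p : ℕ) : ℂ := (exists_add_inv (l p)).choose

lemma sat_ne_zero (l : ℕ → ℝ) (p : ℕ) : sat l p ≠ 0 := (exists_add_inv (l p)).choose_spec.1

lemma sat_add_inv (l : ℕ → ℝ) (p : ℕ) : sat l p + (sat l p)⁻¹ = l p :=
  (exists_add_inv (l p)).choose_spec.2

/-- The completely multiplicative functions attached to the Satake parameters. -/
def satA (l : ℕ → ℝ) : ArithmeticFunction ℂ := cmul (sat l)

def satB (l : ℕ → ℝ) : ArithmeticFunction ℂ := cmul fun p => (sat l p)⁻¹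

/-- The power sums of the Satake parameters. -/
def tau (l : ℕ → ℝ) (n : ℕ) : ℝ := (satA l n + satB l n).re

lemma satA_add_satB_prime_pow (l : ℕ → ℝ) {p : ℕ} (hp : p.Prime) (k : ℕ) :
    satA l (p ^ k) + satB l (p ^ k) = tau l (p ^ k) := by
  have key : (satA l (p ^ k) + satB l (p ^ k)).im = 0 := by
    rw [satA, satB, cmul_prime_pow _ hp, cmul_prime_pow _ hp]
    have h0 := sat_ne_zero l p
    have h1 := sat_add_inv l p
    generalize sat l p = α at h0 h1
    induction k using Nat.twoStepInduction with
    | zero => simp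
    | one => simp [h1]
    | more k ih1 ih2 =>
      have : α ^ (k + 2) + α⁻¹ ^ (k + 2) = (l p : ℂ) * (α ^ (k + 1) + α⁻¹ ^ (k + 1)) -
          (α ^ k + α⁻¹ ^ k) := by
        rw [← h1]
        have h2 : α * α⁻¹ = 1 := mul_inv_cancel₀ h0
        linear_combination (-α ^ k - α⁻¹ ^ k) * h2
      rw [this, sub_im, im_ofReal_mul, ih1, ih2]
      simp
  rw [tau]
  exact Complex.ext (by simp) (by simpa using key)

lemma tau_prime (l : ℕ → ℝ) {p : ℕ} (hp : p.Prime) : tau l p = l p := by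
  rw [tau, satA, satB, ← pow_one p, cmul_prime_pow _ hp, cmul_prime_pow _ hp, pow_one, pow_one,
    sat_add_inv, pow_one, ofReal_re]

/-- The arithmetic logarithmic derivative of the Rankin–Selberg convolution. -/
def rsLog (l l' : ℕ → ℝ) : ArithmeticFunction ℂ := vMul fun n => ((tau l n * tau l' n : ℝ) : ℂ)

lemma vMul_congr {w w' : ℕ → ℂ} (h : ∀ p k : ℕ, p.Prime → w (p ^ k) = w' (p ^ k)) :
    vMul w = vMul w' := by
  ext n
  rw [vMul_apply, vMul_apply]
  by_cases hn : IsPrimePow n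
  · obtain ⟨p, k, hp, -, rfl⟩ := hn
    rw [h p k hp.nat_prime]
  · rw [vonMangoldt_eq_zero_iff.2 hn]; simp

lemma vMul_add (w w' : ℕ → ℂ) : vMul w + vMul w' = vMul fun n => w n + w' n := by
  ext n
  simp [vMul_apply, mul_add]

/-- The four-fold Euler product form of the Rankin–Selberg convolution. -/
lemma rsCoef_eq {l l' : ℕ → ℝ} (h : HeckeRel l) (h' : HeckeRel l') :
    rsCoef l l' = (cmul fun p => sat l p * sat l' p) * (cmul fun p => sat l p * (sat l' p)⁻¹) *
      ((cmul fun p => (sat l p)⁻¹ * sat l' p) * (cmul fun p => (sat l p)⁻¹ * (sat l' p)⁻¹)) := by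
  have hm : ∀ α : ℕ → ℂ, (cmul α).IsMultiplicative := fun α => ⟨cmul_one α, fun _ => cmul_mul α _ _⟩
  unfold rsCoef
  rw [IsMultiplicative.eq_iff_eq_on_prime_powers _ ((toAF_mult h h').mul sqInd_mult) _
    (((hm _).mul (hm _)).mul ((hm _).mul (hm _)))]
  intro p i hp
  suffices H : bell p ((toAF fun n => l n * l' n) * sqInd) = bell p ((cmul fun p => sat l p * sat l' p) *
      (cmul fun p => sat l p * (sat l' p)⁻¹) * ((cmul fun p => (sat l p)⁻¹ * sat l' p) *
      (cmul fun p => (sat l p)⁻¹ * (sat l' p)⁻¹))) by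
    have := congrArg (PowerSeries.coeff i) H
    simpa only [bell, PowerSeries.coeff_mk] using this
  simp only [bell_mul hp]
  have g : ∀ α : ℕ → ℂ, bell p (cmul α) * (1 - PowerSeries.C (α p) * PowerSeries.X) = 1 :=
    fun α => bell_cm (cmul_prime_pow α hp)
  have g1 := g fun p => sat l p * sat l' p
  have g2 := g fun p => sat l p * (sat l' p)⁻¹
  have g3 := g fun p => (sat l p)⁻¹ * sat l' p
  have g4 := g fun p => (sat l p)⁻¹ * (sat l' p)⁻¹
  have gs := bell_sqInd hp
  generalize bell p (cmul fun p => sat l p * sat l' p) = G1 at *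
  generalize bell p (cmul fun p => sat l p * (sat l' p)⁻¹) = G2 at *
  generalize bell p (cmul fun p => (sat l p)⁻¹ * sat l' p) = G3 at *
  generalize bell p (cmul fun p => (sat l p)⁻¹ * (sat l' p)⁻¹) = G4 at *
  generalize bell p sqInd = S at *
  have gV : bell p (toAF fun n => l n * l' n) * (1 - PowerSeries.C (l p * l' p : ℂ) * PowerSeries.X +
      PowerSeries.C ((l p : ℂ) ^ 2 + (l' p : ℂ) ^ 2 - 2) * PowerSeries.X ^ 2 -
      PowerSeries.C (l p * l' p : ℂ) * PowerSeries.X ^ 3 + PowerSeries.X ^ 4) =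
      1 - PowerSeries.X ^ 2 := by
    have hv : ∀ k, (toAF fun n => l n * l' n) (p ^ k) = (l (p ^ k) : ℂ) * l' (p ^ k) := by
      intro k; rw [toAF_apply (pow_ne_zero _ hp.ne_zero)]; push_cast; rfl
    have e1 : ∀ k, (l (p ^ (k + 2)) : ℂ) = l p * l (p ^ (k + 1)) - l (p ^ k) := by
      intro k; rw [h.pow hp]; push_cast; rfl
    have e2 : ∀ k, (l' (p ^ (k + 2)) : ℂ) = l' p * l' (p ^ (k + 1)) - l' (p ^ k) := by
      intro k; rw [h'.pow hp]; push_cast; rfl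
    obtain ⟨κ, hκ⟩ : ∃ κ, κ = (l p : ℂ) ^ 2 + (l' p : ℂ) ^ 2 - 2 := ⟨_, rfl⟩
    obtain ⟨ν, hν⟩ : ∃ ν, ν = (l p * l' p : ℂ) := ⟨_, rfl⟩
    rw [← hκ, ← hν]
    ext n
    simp only [mul_add, mul_sub, mul_one, map_sub, map_add, mul_left_comm _ (PowerSeries.C _),
      PowerSeries.coeff_C_mul, PowerSeries.coeff_mul_X_pow', bell, PowerSeries.coeff_mk, hv,
      PowerSeries.coeff_one, PowerSeries.coeff_X_pow]
    have hX : ∀ (f : ℕ → ℂ) (n : ℕ), PowerSeries.coeff n (PowerSeries.mk f * PowerSeries.X) =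
        if 1 ≤ n then f (n - 1) else 0 := by
      intro f n
      have := PowerSeries.coeff_mul_X_pow' (PowerSeries.mk f) 1 n
      simpa using this
    rw [hX]
    match n with
    | 0 => simp [h.one, h'.one]
    | 1 => simp [h.one, h'.one]; try (rw [hν]; ring)
    | 2 => simp [h.one, h'.one, e1 0, e2 0]; rw [hκ, hν]; ring
    | 3 => simp [h.one, h'.one, e1 0, e2 0, e1 1, e2 1]; rw [hκ, hν]; ring
    | n + 4 =>
      simp [e1, e2]
      rw [hκ, hν]
      ring
  generalize bell p (toAF fun n => l n * l' n) = V at *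
  have gP : (1 - PowerSeries.C (sat l p * sat l' p) * PowerSeries.X) *
      (1 - PowerSeries.C (sat l p * (sat l' p)⁻¹) * PowerSeries.X) *
      ((1 - PowerSeries.C ((sat l p)⁻¹ * sat l' p) * PowerSeries.X) *
      (1 - PowerSeries.C ((sat l p)⁻¹ * (sat l' p)⁻¹) * PowerSeries.X)) =
      1 - PowerSeries.C (l p * l' p : ℂ) * PowerSeries.X +
      PowerSeries.C ((l p : ℂ) ^ 2 + (l' p : ℂ) ^ 2 - 2) * PowerSeries.X ^ 2 -
      PowerSeries.C (l p * l' p : ℂ) * PowerSeries.X ^ 3 + PowerSeries.X ^ 4 := by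
    have i1 : (PowerSeries.C (sat l p) : PowerSeries ℂ) * PowerSeries.C (sat l p)⁻¹ = 1 := by
      rw [← map_mul, mul_inv_cancel₀ (sat_ne_zero l p), map_one]
    have i2 : (PowerSeries.C (sat l' p) : PowerSeries ℂ) * PowerSeries.C (sat l' p)⁻¹ = 1 := by
      rw [← map_mul, mul_inv_cancel₀ (sat_ne_zero l' p), map_one]
    rw [← sat_add_inv l p, ← sat_add_inv l' p]
    simp only [map_mul, map_add, map_sub, map_pow, map_ofNat]
    generalize (PowerSeries.C (sat l p) : PowerSeries ℂ) = a at *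
    generalize (PowerSeries.C (sat l p)⁻¹ : PowerSeries ℂ) = a' at *
    generalize (PowerSeries.C (sat l' p) : PowerSeries ℂ) = b at *
    generalize (PowerSeries.C (sat l' p)⁻¹ : PowerSeries ℂ) = b' at *
    generalize (PowerSeries.X : PowerSeries ℂ) = X at *
    have e1 : (1 - a * b * X) * (1 - a' * b' * X) = 1 - (a * b + a' * b') * X + X ^ 2 := by
      linear_combination (b * b' * X ^ 2) * i1 + X ^ 2 * i2
    have e2 : (1 - a * b' * X) * (1 - a' * b * X) = 1 - (a * b' + a' * b) * X + X ^ 2 := by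
      linear_combination (b * b' * X ^ 2) * i1 + X ^ 2 * i2
    linear_combination (1 - a * b' * X) * (1 - a' * b * X) * e1 +
      (1 - (a * b + a' * b') * X + X ^ 2) * e2 +
      X ^ 2 * ((a ^ 2 + a' ^ 2 - 2) * i2 + (b ^ 2 + b' ^ 2 - 2) * i1)
  rw [← gP] at gV
  generalize 1 - PowerSeries.C (sat l p * sat l' p) * PowerSeries.X = Q1 at *
  generalize 1 - PowerSeries.C (sat l p * (sat l' p)⁻¹) * PowerSeries.X = Q2 at *
  generalize 1 - PowerSeries.C ((sat l p)⁻¹ * sat l' p) * PowerSeries.X = Q3 at *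
  generalize 1 - PowerSeries.C ((sat l p)⁻¹ * (sat l' p)⁻¹) * PowerSeries.X = Q4 at *
  calc V * S = V * S * ((G1 * Q1) * (G2 * Q2) * ((G3 * Q3) * (G4 * Q4))) := by
        rw [g1, g2, g3, g4]; ring
    _ = V * (Q1 * Q2 * (Q3 * Q4)) * S * (G1 * G2 * (G3 * G4)) := by ring
    _ = (S * (1 - PowerSeries.X ^ 2)) * (G1 * G2 * (G3 * G4)) := by rw [gV]; ring
    _ = G1 * G2 * (G3 * G4) := by rw [gs, one_mul]

lemma logDer_rsCoef {l l' : ℕ → ℝ} (h : HeckeRel l) (h' : HeckeRel l') :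
    LogDer (rsCoef l l') (rsLog l l') := by
  rw [rsCoef_eq h h']
  have := ((logDer_cm (cmul_mul fun p => sat l p * sat l' p)).mul
    (logDer_cm (cmul_mul fun p => sat l p * (sat l' p)⁻¹))).mul
    ((logDer_cm (cmul_mul fun p => (sat l p)⁻¹ * sat l' p)).mul
    (logDer_cm (cmul_mul fun p => (sat l p)⁻¹ * (sat l' p)⁻¹)))
  convert this using 1
  simp only [vMul_add, rsLog]
  refine vMul_congr fun p k hp => ?_
  rw [ofReal_mul, ← satA_add_satB_prime_pow l hp, ← satA_add_satB_prime_pow l' hp]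
  simp only [satA, satB, cmul_prime_pow _ hp, mul_pow]
  ring

end CuspPrime

namespace CuspPrime

open ArithmeticFunction
open scoped Topology ComplexOrder

/-- A finite family of Hecke eigenvalue systems whose Rankin–Selberg convolutions continue. -/
structure RSFamily {ι : Type} (l : ι → ℕ → ℝ) (E : ι → ι → ℂ → ℂ) : Prop where
  hecke : ∀ i, HeckeRel (l i)
  summable : ∀ i j (s : ℂ), 1 < s.re → LSeriesSummable (rsCoef (l i) (l j)) s
  diff : ∀ i j, Differentiable ℂ (E i j)
  eq : ∀ i j (s : ℂ), 1 < s.re → (s - 1) * LSeries (rsCoef (l i) (l j)) s = E i j s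
  neg_one : ∀ i, E i i (-1) = 0
  res_diag : ∀ i, ∃ r : ℝ, r ≠ 0 ∧ E i i 1 = r
  res_off : ∀ i j, i ≠ j → E i j 1 = 0

lemma abscissa_le_one {f : ℕ → ℂ} (h : ∀ s : ℂ, 1 < s.re → LSeriesSummable f s) :
    LSeries.abscissaOfAbsConv f ≤ (1 : ℝ) :=
  LSeries.abscissaOfAbsConv_le_of_forall_lt_LSeriesSummable fun y hy => h y (by simpa using hy)

lemma abscissa_lt {f : ℕ → ℂ} (h : ∀ s : ℂ, 1 < s.re → LSeriesSummable f s) {s : ℂ}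
    (hs : 1 < s.re) : LSeries.abscissaOfAbsConv f < s.re :=
  (abscissa_le_one h).trans_lt (by exact_mod_cast hs)

lemma rsCoef_nonneg (l : ℕ → ℝ) (n : ℕ) : 0 ≤ rsCoef l l n := by
  rw [rsCoef, ArithmeticFunction.mul_apply]
  refine Finset.sum_nonneg fun x hx => mul_nonneg ?_ ?_
  · rcases eq_or_ne x.1 0 with h | h
    · simp [h]
    rw [toAF_apply h]
    exact_mod_cast mul_self_nonneg _
  · rw [sqInd_apply]
    split_ifs <;> simp

lemma sq_le_rsCoef (l : ℕ → ℝ) {n : ℕ} (hn : n ≠ 0) : ((l n ^ 2 : ℝ) : ℂ) ≤ rsCoef l l n := by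
  rw [rsCoef, ArithmeticFunction.mul_apply]
  refine le_trans (le_of_eq ?_) (Finset.single_le_sum (f := fun x : ℕ × ℕ =>
    (toAF fun n => l n * l n) x.1 * sqInd x.2) (fun x _ => mul_nonneg ?_ ?_)
    (show (n, 1) ∈ n.divisorsAntidiagonal by simp [hn]))
  · simp [toAF_apply hn, sqInd_apply, sq]
  · rcases eq_or_ne x.1 0 with h | h
    · simp [h]
    rw [toAF_apply h]
    exact_mod_cast mul_self_nonneg _
  · rw [sqInd_apply]
    split_ifs <;> simp

lemma rsCoef_one {l l' : ℕ → ℝ} (h : HeckeRel l) (h' : HeckeRel l') : rsCoef l l' 1 = 1 := by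
  simp [rsCoef, toAF_apply, h.one, h'.one, sqInd_apply]

lemma LogDer.nonneg {A L : ArithmeticFunction ℂ} (h : LogDer A L) (h1 : A 1 = 1)
    (hL : ∀ n, 0 ≤ L n) (hL1 : L 1 = 0) (n : ℕ) : 0 ≤ A n := by
  induction n using Nat.strong_induction_on with
  | _ n ih =>
    rcases Nat.lt_or_ge n 2 with hn | hn
    · interval_cases n
      · simp
      · simp [h1]
    have h2 : (0 : ℝ) < Real.log n := Real.log_pos (by exact_mod_cast hn)
    have h3 : 0 ≤ (Real.log n : ℂ) * A n := by
      rw [← lmul_apply, h, ArithmeticFunction.mul_apply]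
      refine Finset.sum_nonneg fun x hx => ?_
      have hx1 := (Nat.mem_divisorsAntidiagonal.1 hx).1
      rcases Nat.lt_or_ge x.1 2 with hlt | hge
      · have : x.1 = 0 ∨ x.1 = 1 := by omega
        rcases this with h0 | h0 <;> simp [h0, hL1]
      · refine mul_nonneg (hL _) (ih _ ?_)
        have : x.2 ≠ 0 := by rintro h0; simp [h0] at hx1; omega
        nlinarith [Nat.pos_of_ne_zero this]
    have h4 : A n = ((Real.log n)⁻¹ : ℝ) * ((Real.log n : ℂ) * A n) := by
      rw [← mul_assoc, ← ofReal_mul, inv_mul_cancel₀ h2.ne', ofReal_one, one_mul]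
    rw [h4]
    exact mul_nonneg (by exact_mod_cast (inv_pos.2 h2).le) h3

lemma LogDer.le_lmul {A L : ArithmeticFunction ℂ} (h : LogDer A L) (h1 : A 1 = 1)
    (hA : ∀ n, 0 ≤ A n) (hL : ∀ n, 0 ≤ L n) (n : ℕ) : ‖L n‖ ≤ ‖LSeries.logMul A n‖ := by
  rcases eq_or_ne n 0 with rfl | hn
  · simp
  have : L n ≤ lmul A n := by
    rw [h, ArithmeticFunction.mul_apply]
    refine le_trans (le_of_eq ?_) (Finset.single_le_sum (f := fun x : ℕ × ℕ => L x.1 * A x.2)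
      (fun x _ => mul_nonneg (hL _) (hA _)) (show (n, 1) ∈ n.divisorsAntidiagonal by simp [hn]))
    simp [h1]
  exact CStarAlgebra.norm_le_norm_of_nonneg_of_le (hL n) this

lemma rsLog_apply (l l' : ℕ → ℝ) (n : ℕ) :
    rsLog l l' n = ((vonMangoldt n * (tau l n * tau l' n) : ℝ) : ℂ) := by
  rw [rsLog, vMul_apply]; push_cast; rfl

variable {ι : Type} {l : ι → ℕ → ℝ} {E : ι → ι → ℂ → ℂ}

lemma lseriesSummable_of_le {f g : ℕ → ℂ} {s : ℂ} (h : ∀ n, ‖f n‖ ≤ ‖g n‖)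
    (hg : LSeriesSummable g s) : LSeriesSummable f s := by
  refine (Summable.of_norm_bounded (g := fun n => ‖LSeries.term g s n‖) hg.norm fun n => ?_)
  exact LSeries.norm_term_le s (h n)

lemma RSFamily.summable_log_diag (F : RSFamily l E) (i : ι) {s : ℂ} (hs : 1 < s.re) :
    LSeriesSummable (rsLog (l i) (l i)) s := by
  refine lseriesSummable_of_le (g := LSeries.logMul (rsCoef (l i) (l i))) (fun n => ?_)
    (LSeriesSummable_logMul_of_lt_re (abscissa_lt (F.summable i i) hs))
  refine (logDer_rsCoef (F.hecke i) (F.hecke i)).le_lmul (rsCoef_one (F.hecke i) (F.hecke i))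
    (rsCoef_nonneg _) (fun n => ?_) n
  rw [rsLog_apply]
  exact_mod_cast mul_nonneg vonMangoldt_nonneg (mul_self_nonneg _)

lemma RSFamily.summable_log (F : RSFamily l E) (i j : ι) {s : ℂ} (hs : 1 < s.re) :
    LSeriesSummable (rsLog (l i) (l j)) s := by
  refine lseriesSummable_of_le (fun n => ?_)
    ((F.summable_log_diag i hs).add (F.summable_log_diag j hs))
  rw [Pi.add_apply, rsLog_apply, rsLog_apply, rsLog_apply, ← ofReal_add, norm_real, norm_real,
    Real.norm_eq_abs, Real.norm_eq_abs]
  have hv : 0 ≤ vonMangoldt n := vonMangoldt_nonneg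
  refine le_trans ?_ (le_abs_self _)
  rw [abs_mul, abs_of_nonneg hv, ← mul_add]
  refine mul_le_mul_of_nonneg_left ?_ hv
  rw [abs_le]
  constructor <;> nlinarith [sq_nonneg (tau (l i) n + tau (l j) n),
    sq_nonneg (tau (l i) n - tau (l j) n), sq_nonneg (tau (l i) n), sq_nonneg (tau (l j) n)]

/-- The logarithmic derivative identity `-L' = LΛ · L`. -/
lemma RSFamily.hasDerivAt (F : RSFamily l E) (i j : ι) {s : ℂ} (hs : 1 < s.re) :
    HasDerivAt (LSeries (rsCoef (l i) (l j)))
      (-(LSeries (rsLog (l i) (l j)) s * LSeries (rsCoef (l i) (l j)) s)) s := by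
  have h := LSeries_hasDerivAt (abscissa_lt (F.summable i j) hs)
  rw [← LSeries_mul' (F.summable_log i j hs) (F.summable i j s hs),
    ← logDer_rsCoef (F.hecke i) (F.hecke j)]
  exact h

lemma isOpen_re_gt (c : ℝ) : IsOpen {s : ℂ | c < s.re} := isOpen_lt continuous_const continuous_re

lemma RSFamily.log_diag (F : RSFamily l E) (i : ι) {s : ℂ} (hs : 1 < s.re) :
    LSeries (rsLog (l i) (l i)) s * E i i s = 1 / (s - 1) * E i i s - deriv (E i i) s := by
  have h1 : HasDerivAt (fun s : ℂ => (s - 1) * LSeries (rsCoef (l i) (l i)) s)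
      (1 * LSeries (rsCoef (l i) (l i)) s + (s - 1) *
      -(LSeries (rsLog (l i) (l i)) s * LSeries (rsCoef (l i) (l i)) s)) s :=
    ((hasDerivAt_id s).sub_const 1).mul (F.hasDerivAt i i hs)
  have h2 : (fun s : ℂ => (s - 1) * LSeries (rsCoef (l i) (l i)) s) =ᶠ[𝓝 s] E i i := by
    filter_upwards [(isOpen_re_gt 1).mem_nhds hs] with z hz using F.eq i i z hz
  rw [(h1.congr_of_eventuallyEq h2.symm).deriv, ← F.eq i i s hs]
  have : s - 1 ≠ 0 := by
    intro h0
    have := congrArg re h0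
    simp at this
    linarith
  field_simp
  ring

lemma ne_one_of_re {s : ℂ} (hs : 1 < s.re) : s - 1 ≠ 0 := by
  intro h0
  have := congrArg re h0
  simp at this
  linarith

lemma differentiable_dslope {f : ℂ → ℂ} (hf : Differentiable ℂ f) (c : ℂ) :
    Differentiable ℂ (dslope f c) := by
  rw [← differentiableOn_univ] at *
  exact (Complex.differentiableOn_dslope univ_mem).2 hf

lemma RSFamily.off_eq (F : RSFamily l E) {i j : ι} (hij : i ≠ j) {s : ℂ} (hs : 1 < s.re) :
    dslope (E i j) 1 s = LSeries (rsCoef (l i) (l j)) s := by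
  rw [dslope_of_ne _ (sub_ne_zero.1 (ne_one_of_re hs)), slope_def_field, F.res_off i j hij, sub_zero,
    ← F.eq i j s hs, mul_div_cancel_left₀ _ (ne_one_of_re hs)]

lemma RSFamily.log_off (F : RSFamily l E) {i j : ι} (hij : i ≠ j) {s : ℂ} (hs : 1 < s.re) :
    LSeries (rsLog (l i) (l j)) s * dslope (E i j) 1 s = - deriv (dslope (E i j) 1) s := by
  have h2 : LSeries (rsCoef (l i) (l j)) =ᶠ[𝓝 s] dslope (E i j) 1 := by
    filter_upwards [(isOpen_re_gt 1).mem_nhds hs] with z hz using (F.off_eq hij hz).symm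
  rw [((F.hasDerivAt i j hs).congr_of_eventuallyEq h2.symm).deriv, F.off_eq hij hs, neg_neg]

/-- Non-vanishing of the off-diagonal convolutions at the edge. -/
lemma RSFamily.off_ne_zero (F : RSFamily l E) {i j : ι} (hij : i ≠ j) :
    dslope (E i j) 1 1 ≠ 0 := by
  intro h0
  have hi := F.hecke i
  have hj := F.hecke j
  set d := rsCoef (l i) (l i) * rsCoef (l j) (l j) * (rsCoef (l i) (l j) * rsCoef (l i) (l j))
    with hd
  have hlog : LogDer d (rsLog (l i) (l i) + rsLog (l j) (l j) + (rsLog (l i) (l j) + rsLog (l i) (l j))) :=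
    ((logDer_rsCoef hi hi).mul (logDer_rsCoef hj hj)).mul
      ((logDer_rsCoef hi hj).mul (logDer_rsCoef hi hj))
  have hd1 : d 1 = 1 := by simp [hd, rsCoef_one, hi, hj]
  have hnn : ∀ n, 0 ≤ d n := by
    refine hlog.nonneg hd1 (fun n => ?_) ?_
    · simp only [ArithmeticFunction.add_apply, rsLog_apply, ← ofReal_add]
      rw [show vonMangoldt n * (tau (l i) n * tau (l i) n) + vonMangoldt n * (tau (l j) n * tau (l j) n)
        + (vonMangoldt n * (tau (l i) n * tau (l j) n) + vonMangoldt n * (tau (l i) n * tau (l j) n))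
        = vonMangoldt n * (tau (l i) n + tau (l j) n) ^ 2 by ring]
      exact_mod_cast mul_nonneg vonMangoldt_nonneg (sq_nonneg _)
    · simp [rsLog_apply]
  have hsum : ∀ s : ℂ, 1 < s.re → LSeriesSummable d s := fun s hs =>
    LSeriesSummable_mul (LSeriesSummable_mul (F.summable i i s hs) (F.summable j j s hs))
      (LSeriesSummable_mul (F.summable i j s hs) (F.summable i j s hs))
  have hD : Differentiable ℂ fun s => E i i s * E j j s * dslope (dslope (E i j) 1) 1 s ^ 2 :=
    ((F.diff i i).mul (F.diff j j)).mul
      ((differentiable_dslope (differentiable_dslope (F.diff i j) 1) 1).pow 2)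
  have := ArithmeticFunction.LSeries_positive_of_differentiable_of_eqOn (a := d) hnn
    (by rw [hd1]; exact one_pos) hD (abscissa_le_one hsum) (fun s hs => ?_) (-1)
  · push_cast at this
    rw [F.neg_one i, zero_mul, zero_mul] at this
    exact lt_irrefl _ this
  · have hs : 1 < s.re := hs
    simp only [hd]
    rw [LSeries_mul' (LSeriesSummable_mul (F.summable i i s hs) (F.summable j j s hs))
      (LSeriesSummable_mul (F.summable i j s hs) (F.summable i j s hs)),
      LSeries_mul' (F.summable i i s hs) (F.summable j j s hs),
      LSeries_mul' (F.summable i j s hs) (F.summable i j s hs), ← F.eq i i s hs, ← F.eq j j s hs,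
      dslope_of_ne _ (sub_ne_zero.1 (ne_one_of_re hs)), slope_def_field, h0, sub_zero, F.off_eq hij hs]
    have := ne_one_of_re hs
    field_simp

end CuspPrime

namespace CuspPrime

open ArithmeticFunction
open scoped Topology ComplexOrder

variable {ι : Type} {l : ι → ℕ → ℝ} {E : ι → ι → ℂ → ℂ}

/-- A local logarithmic derivative near `s = 1`. -/
lemma RSFamily.exists_local (F : RSFamily l E) (i j : ι) :
    ∃ G : ℂ → ℂ, Differentiable ℂ G ∧ G 1 ≠ 0 ∧ ∀ s : ℂ, 1 < s.re →
      LSeries (rsLog (l i) (l j)) s * G s =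
        (open Classical in if i = j then (1 : ℂ) else 0) / (s - 1) * G s - deriv G s := by
  classical
  by_cases h : i = j
  · subst h
    obtain ⟨r, hr, hE⟩ := F.res_diag i
    refine ⟨E i i, F.diff i i, by rw [hE]; exact_mod_cast hr, fun s hs => ?_⟩
    rw [if_pos rfl, F.log_diag i hs]
  · refine ⟨dslope (E i j) 1, differentiable_dslope (F.diff i j) 1, F.off_ne_zero h, fun s hs => ?_⟩
    rw [if_neg h, F.log_off h hs]
    simp

/-- The prime power mass of a combination of Hecke eigenvalue systems. -/
def primeMass [Fintype ι] (l : ι → ℕ → ℝ) (c : ι → ℂ) (n : ℕ) : ℝ :=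
  vonMangoldt n * ‖∑ i, c i * tau (l i) n‖ ^ 2

lemma primeMass_eq [Fintype ι] (c : ι → ℂ) (n : ℕ) :
    (primeMass l c n : ℂ) =
      ∑ i, ∑ j, c i * (starRingEnd ℂ) (c j) * rsLog (l i) (l j) n := by
  rw [primeMass]
  push_cast
  rw [← Complex.mul_conj', map_sum, Finset.sum_mul_sum, Finset.mul_sum]
  refine Finset.sum_congr rfl fun i _ => ?_
  rw [Finset.mul_sum]
  refine Finset.sum_congr rfl fun j _ => ?_
  rw [rsLog_apply, map_mul, conj_ofReal]
  push_cast
  ring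

lemma RSFamily.hasSum_primeMass [Fintype ι] (F : RSFamily l E) (c : ι → ℂ) {s : ℂ} (hs : 1 < s.re) :
    HasSum (LSeries.term (fun n => (primeMass l c n : ℂ)) s)
      (∑ i, ∑ j, c i * (starRingEnd ℂ) (c j) * LSeries (rsLog (l i) (l j)) s) := by
  have : LSeries.term (fun n => (primeMass l c n : ℂ)) s = fun n =>
      ∑ i, ∑ j, c i * (starRingEnd ℂ) (c j) * LSeries.term (rsLog (l i) (l j)) s n := by
    ext n
    rcases eq_or_ne n 0 with rfl | hn
    · simp
    simp only [LSeries.term_of_ne_zero hn, primeMass_eq]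
    rw [Finset.sum_div]
    refine Finset.sum_congr rfl fun i _ => ?_
    rw [Finset.sum_div]
    refine Finset.sum_congr rfl fun j _ => ?_
    rw [mul_div_assoc]
  rw [this]
  exact hasSum_sum fun i _ => hasSum_sum fun j _ => ((F.summable_log i j hs).hasSum).mul_left _

lemma RSFamily.polar_primeMass [Fintype ι] (F : RSFamily l E) (c : ι → ℂ) :
    ∃ T, 0 < T ∧ PolarData T (primeMass l c) (∑ i, ‖c i‖ ^ 2) := by
  classical
  choose G hG hG1 hGs using F.exists_local
  have hopen : IsOpen {s : ℂ | ∀ i j, G i j s ≠ 0} := by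
    simp only [Set.ofPred_forall]
    exact isOpen_iInter_of_finite fun i => isOpen_iInter_of_finite fun j =>
      isOpen_ne_fun (hG i j).continuous continuous_const
  obtain ⟨r, hr, hball⟩ := Metric.isOpen_iff.1 hopen 1 (fun i j => hG1 i j)
  have hne : ∀ s : ℂ, 1 ≤ s.re → s.re ≤ 1 + r / 3 → |s.im| ≤ r / 3 → ∀ i j, G i j s ≠ 0 := by
    intro s h1 h2 h3
    refine hball ?_
    rw [Metric.mem_ball, dist_eq_norm]
    refine (norm_le_abs_re_add_abs_im _).trans_lt ?_
    simp only [sub_re, one_re, sub_im, one_im, sub_zero]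
    rw [abs_of_nonneg (by linarith)]
    linarith
  refine ⟨r / 3, by positivity, fun n => mul_nonneg vonMangoldt_nonneg (by positivity),
    fun σ hσ => (F.hasSum_primeMass c (by simpa using hσ)).summable,
    fun s => ∑ i, ∑ j, c i * (starRingEnd ℂ) (c j) * -(deriv (G i j) s / G i j s), ?_, ?_⟩
  · refine continuousOn_finsetSum _ fun i _ => continuousOn_finsetSum _ fun j _ => ?_
    refine continuousOn_const.mul (ContinuousOn.neg (ContinuousOn.div ?_ ?_ ?_))
    · exact ((hG i j).contDiff (n := 1)).continuous_deriv le_rfl |>.continuousOn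
    · exact (hG i j).continuous.continuousOn
    · intro s hs
      exact hne s hs.1 hs.2.1 hs.2.2 i j
  · intro s h1 h2 h3
    rw [LSeries, (F.hasSum_primeMass c h1).tsum_eq]
    have key : ∀ i j, LSeries (rsLog (l i) (l j)) s =
        (if i = j then (1 : ℂ) else 0) / (s - 1) - deriv (G i j) s / G i j s := by
      intro i j
      have h0 := hne s h1.le h2 h3 i j
      have := hGs i j s h1
      rw [← mul_left_inj' h0, this, sub_mul, div_mul_cancel₀ _ h0]
    simp only [key, sub_eq_add_neg, mul_add, Finset.sum_add_distrib]
    congr 1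
    simp only [ite_div, zero_div, mul_ite, mul_zero, Finset.sum_ite_eq, Finset.mem_univ, if_true]
    push_cast
    rw [Finset.sum_div]
    refine Finset.sum_congr rfl fun i _ => ?_
    rw [Complex.mul_conj']
    ring

lemma RSFamily.polar_diag (F : RSFamily l E) (i : ι) :
    ∃ c : ℝ, ∀ T, 0 < T → PolarData T (fun n => (rsCoef (l i) (l i) n).re) c := by
  obtain ⟨r, hr, hE⟩ := F.res_diag i
  have hre : ∀ n, (((rsCoef (l i) (l i) n).re : ℝ) : ℂ) = rsCoef (l i) (l i) n := fun n =>
    (Complex.eq_re_of_ofReal_le (r := 0) (by simpa using rsCoef_nonneg (l i) n)).symm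
  have hfun : (fun n => (((rsCoef (l i) (l i) n).re : ℝ) : ℂ)) = rsCoef (l i) (l i) := funext hre
  refine ⟨r, fun T hT => ⟨fun n => (Complex.nonneg_iff.1 (rsCoef_nonneg (l i) n)).1, ?_,
    dslope (E i i) 1, (differentiable_dslope (F.diff i i) 1).continuous.continuousOn, ?_⟩⟩
  · intro σ hσ
    rw [hfun]
    exact F.summable i i σ (by simpa using hσ)
  · intro s hs _ _
    have h1 := ne_one_of_re hs
    rw [hfun, dslope_of_ne _ (sub_ne_zero.1 h1), slope_def_field, ← F.eq i i s hs, hE]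
    field_simp
    ring

end CuspPrime

namespace CuspPrime

open ArithmeticFunction
open scoped Topology

lemma tau_rec (l : ℕ → ℝ) {p : ℕ} (hp : p.Prime) (k : ℕ) :
    tau l (p ^ (k + 2)) = l p * tau l (p ^ (k + 1)) - tau l (p ^ k) := by
  have h : (tau l (p ^ (k + 2)) : ℂ) = l p * tau l (p ^ (k + 1)) - tau l (p ^ k) := by
    simp only [← satA_add_satB_prime_pow l hp, ← sat_add_inv l p, satA, satB, cmul_prime_pow _ hp]
    have h2 := mul_inv_cancel₀ (sat_ne_zero l p)
    linear_combination (-(sat l p) ^ k - (sat l p)⁻¹ ^ k) * h2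
  exact_mod_cast h

lemma HeckeRel.tau_eq {l : ℕ → ℝ} (h : HeckeRel l) {p : ℕ} (hp : p.Prime) (k : ℕ) :
    tau l (p ^ (k + 2)) = l (p ^ (k + 2)) - l (p ^ k) := by
  have h0 : tau l (p ^ 0) = 2 := by
    simp [tau, satA, satB, cmul_one]; norm_num
  induction k using Nat.twoStepInduction with
  | zero => rw [tau_rec l hp, h0, h.pow hp]; simp [tau_prime l hp, h.one]; ring
  | one =>
    rw [tau_rec l hp, tau_rec l hp, h.pow hp, h.pow hp, h0]
    simp [tau_prime l hp, h.one]; ring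
  | more k ih1 ih2 =>
    rw [tau_rec l hp, ih1, ih2, h.pow hp (k + 2), h.pow hp k]
    ring

lemma tau_sq_le (l : ℕ → ℝ) {p : ℕ} (hp : p.Prime) (k : ℕ) :
    tau l (p ^ k) ^ 2 ≤ 4 * (2 * (l p ^ 2 + 1)) ^ k := by
  have h0 := sat_ne_zero l p
  have h1 := sat_add_inv l p
  have h2 : ‖sat l p‖ * ‖(sat l p)⁻¹‖ = 1 := by rw [← norm_mul, mul_inv_cancel₀ h0, norm_one]
  have hA : ‖sat l p‖ ≤ |l p| + 1 ∧ ‖(sat l p)⁻¹‖ ≤ |l p| + 1 := by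
    have e1 : ‖sat l p‖ ≤ |l p| + ‖(sat l p)⁻¹‖ := by
      rw [← Real.norm_eq_abs, ← norm_real, ← h1]
      exact norm_le_add_norm_add _ _
    have e2 : ‖(sat l p)⁻¹‖ ≤ |l p| + ‖sat l p‖ := by
      rw [← Real.norm_eq_abs, ← norm_real, ← h1, add_comm (sat l p)]
      exact norm_le_add_norm_add _ _
    have := abs_nonneg (l p)
    have n1 := norm_nonneg (sat l p)
    have n2 := norm_nonneg (sat l p)⁻¹
    rcases le_total ‖sat l p‖ 1 with h | h
    · exact ⟨by linarith, by linarith⟩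
    · have : ‖(sat l p)⁻¹‖ ≤ 1 := by nlinarith
      exact ⟨by linarith, by linarith⟩
  have hk : |tau l (p ^ k)| ≤ 2 * (|l p| + 1) ^ k := by
    rw [← Real.norm_eq_abs, ← norm_real, ← satA_add_satB_prime_pow l hp, satA, satB,
      cmul_prime_pow _ hp, cmul_prime_pow _ hp, two_mul]
    refine (norm_add_le _ _).trans (add_le_add ?_ ?_) <;> rw [norm_pow] <;>
      gcongr
    exacts [hA.1, hA.2]
  have h3 : (|l p| + 1) ^ 2 ≤ 2 * (l p ^ 2 + 1) := by
    nlinarith [sq_abs (l p), sq_nonneg (|l p| - 1)]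
  calc tau l (p ^ k) ^ 2 = |tau l (p ^ k)| ^ 2 := (sq_abs _).symm
    _ ≤ (2 * (|l p| + 1) ^ k) ^ 2 := by gcongr
    _ = 4 * ((|l p| + 1) ^ 2) ^ k := by rw [mul_pow, ← pow_mul, mul_comm k 2, pow_mul]; norm_num
    _ ≤ _ := by gcongr

lemma HeckeRel.tau_sq_div_tendsto {l : ℕ → ℝ} (h : HeckeRel l)
    (hl : Tendsto (fun n : ℕ => l n ^ 2 / n) atTop (𝓝 0)) {p : ℕ} (hp : p.Prime) :
    Tendsto (fun k : ℕ => tau l (p ^ k) ^ 2 / (p ^ k : ℝ)) atTop (𝓝 0) := by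
  have hpow : Tendsto (fun k : ℕ => p ^ k) atTop atTop := tendsto_pow_atTop_atTop_of_one_lt hp.one_lt
  have h1 := hl.comp hpow
  have h2 := h1.comp (tendsto_add_atTop_nat 2)
  rw [← tendsto_add_atTop_iff_nat 2]
  have h3 : Tendsto (fun k : ℕ => 2 * (l (p ^ (k + 2)) ^ 2 / ((p ^ (k + 2) : ℕ) : ℝ)) +
      2 * (l (p ^ k) ^ 2 / ((p ^ k : ℕ) : ℝ))) atTop (𝓝 0) := by
    simpa using (h2.const_mul 2).add (h1.const_mul 2)
  refine squeeze_zero (fun k => by positivity) (fun k => ?_) h3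
  rw [h.tau_eq hp]
  have hp1 : (1 : ℝ) ≤ p := by exact_mod_cast hp.one_lt.le
  have hpk : (0 : ℝ) < (p : ℝ) ^ k := by positivity
  have hle : (p : ℝ) ^ k ≤ (p : ℝ) ^ (k + 2) := pow_le_pow_right₀ hp1 (by omega)
  push_cast
  calc (l (p ^ (k + 2)) - l (p ^ k)) ^ 2 / (p : ℝ) ^ (k + 2)
      ≤ (2 * l (p ^ (k + 2)) ^ 2 + 2 * l (p ^ k) ^ 2) / (p : ℝ) ^ (k + 2) := by
        gcongr
        nlinarith [sq_nonneg (l (p ^ (k + 2)) + l (p ^ k))]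
    _ = 2 * (l (p ^ (k + 2)) ^ 2 / (p : ℝ) ^ (k + 2)) + 2 * (l (p ^ k) ^ 2 / (p : ℝ) ^ (k + 2)) := by
        ring
    _ ≤ _ := by gcongr

/-- Reindexing a sum over proper prime powers. -/
lemma sum_proper_prime_pow_le (S : Finset ℕ) (g : ℕ → ℝ) (hg : ∀ n, 0 ≤ g n) {X : ℕ}
    (hX : ∀ n ∈ S, n < X) :
    ∑ n ∈ S with ¬ n.Prime, vonMangoldt n * g n ≤
      ∑ p ∈ range X with p.Prime, ∑ m ∈ Ico 2 X with p ^ m ∈ S, Real.log p * g (p ^ m) := by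
  rw [← Finset.sum_filter_add_sum_filter_not _ IsPrimePow, add_comm, Finset.sum_eq_zero, zero_add]
  swap
  · intro n hn
    rw [vonMangoldt_eq_zero_iff.2 (Finset.mem_filter.1 hn).2, zero_mul]
  have key : ∀ n ∈ ((S.filter fun n => ¬ n.Prime).filter IsPrimePow), n.minFac.Prime ∧
      n.minFac < X ∧ 2 ≤ n.factorization n.minFac ∧ n.factorization n.minFac < X ∧
      n.minFac ^ n.factorization n.minFac = n ∧ n ∈ S := by
    intro n hn
    obtain ⟨⟨hS, hnp⟩, hpp⟩ := by simpa [Finset.mem_filter] using hn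
    have h1 := hpp.minFac_pow_factorization_eq
    have hp := Nat.minFac_prime hpp.ne_one
    have hlt := hX n hS
    have h2 : n.factorization n.minFac < n := Nat.factorization_lt _ hpp.ne_zero
    refine ⟨hp, (Nat.minFac_le hpp.pos).trans_lt hlt, ?_, h2.trans hlt, h1, hS⟩
    by_contra! h
    interval_cases h3 : n.factorization n.minFac
    · exact hpp.ne_one (by simpa using h1.symm)
    · rw [pow_one] at h1
      exact hnp (h1 ▸ hp)
  rw [Finset.sum_sigma']
  set φ : ℕ → (_ : ℕ) × ℕ := fun n => ⟨n.minFac, n.factorization n.minFac⟩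
  set f : (_ : ℕ) × ℕ → ℝ := fun x => Real.log x.1 * g (x.1 ^ x.2)
  have hinj : Set.InjOn φ ((S.filter fun n => ¬ n.Prime).filter IsPrimePow) := by
    intro a ha b hb hab
    have h1 := (key a ha).2.2.2.2.1
    have h2 := (key b hb).2.2.2.2.1
    simp only [φ, Sigma.mk.injEq, heq_eq_eq] at hab
    rw [← h1, ← h2, hab.2, hab.1]
  have h1 : ∑ n ∈ S.filter (fun n => ¬ n.Prime) with IsPrimePow n, vonMangoldt n * g n =
      ∑ n ∈ S.filter (fun n => ¬ n.Prime) with IsPrimePow n, f (φ n) := by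
    refine Finset.sum_congr rfl fun n hn => ?_
    obtain ⟨hp, -, h2, -, h3, -⟩ := key n hn
    simp only [f, φ, h3]
    nth_rw 1 [← h3]
    rw [vonMangoldt_apply_pow (by omega), vonMangoldt_apply_prime hp]
  rw [h1, ← Finset.sum_image hinj]
  refine Finset.sum_le_sum_of_subset_of_nonneg ?_ fun x _ _ => ?_
  · intro x hx
    obtain ⟨n, hn, rfl⟩ := Finset.mem_image.1 hx
    obtain ⟨a, b, c, d, e, f⟩ := key n hn
    simp only [φ, Finset.mem_sigma, Finset.mem_filter, Finset.mem_range, Finset.mem_Ico]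
    exact ⟨⟨b, a⟩, ⟨c, d⟩, by rwa [e]⟩
  · exact mul_nonneg (Real.log_natCast_nonneg _) (hg _)

/-- Chebyshev's bound in a logarithmic window. -/
lemma sum_log_div_win_le (M y : ℝ) :
    ∑ p ∈ win M y with p.Prime, Real.log p / p ≤ Real.log 4 * Real.exp (2 * M) := by
  have hp : ∀ p ∈ win M y, Real.exp (y - M) ≤ p ∧ (p : ℝ) ≤ Real.exp (y + M) := by
    intro p hp
    obtain ⟨h1, h2⟩ := mem_win.1 hp
    have hp0 : (0 : ℝ) < p := by exact_mod_cast h1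
    rw [abs_le] at h2
    rw [← Real.le_log_iff_exp_le hp0, ← Real.log_le_iff_le_exp hp0]
    exact ⟨by linarith, by linarith⟩
  have h1 : ∑ p ∈ win M y with p.Prime, Real.log p / p ≤
      ∑ p ∈ win M y with p.Prime, Real.log p * Real.exp (M - y) := by
    refine Finset.sum_le_sum fun p hpm => ?_
    have := (hp p (Finset.mem_filter.1 hpm).1).1
    rw [div_eq_mul_inv]
    refine mul_le_mul_of_nonneg_left ?_ (Real.log_natCast_nonneg _)
    rw [show M - y = -(y - M) by ring, Real.exp_neg]
    exact inv_anti₀ (Real.exp_pos _) this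
  have h2 : ∑ p ∈ win M y with p.Prime, Real.log p ≤ Chebyshev.theta (Real.exp (y + M)) := by
    rw [Chebyshev.theta]
    refine Finset.sum_le_sum_of_subset_of_nonneg ?_ fun p _ _ => Real.log_natCast_nonneg _
    intro p hpm
    obtain ⟨ha, hb⟩ := Finset.mem_filter.1 hpm
    rw [Finset.mem_filter, Finset.mem_Ioc]
    exact ⟨⟨hb.pos, Nat.le_floor (hp p ha).2⟩, hb⟩
  rw [← Finset.sum_mul] at h1
  calc _ ≤ _ := h1
    _ ≤ (Real.log 4 * Real.exp (y + M)) * Real.exp (M - y) := by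
      refine mul_le_mul_of_nonneg_right ?_ (Real.exp_pos _).le
      exact h2.trans (Chebyshev.theta_le_log4_mul_x (Real.exp_pos _).le)
    _ = _ := by rw [mul_assoc, ← Real.exp_add]; ring_nf

end CuspPrime

namespace CuspPrime

open ArithmeticFunction
open scoped Topology

lemma mem_win_pow {M y : ℝ} {p m : ℕ} : p ^ m ∈ win M y → 1 ≤ p ^ m ∧ |m * Real.log p - y| ≤ M := by
  intro h
  have := mem_win.1 h
  push_cast at this
  rwa [Real.log_pow] at this

lemma mem_win_root {M y : ℝ} {p m : ℕ} (hp : p.Prime) (hm : 1 ≤ m) (h : p ^ m ∈ win M y) :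
    p ∈ win M (y / m) := by
  have h2 := (mem_win_pow h).2
  have hm1 : (1 : ℝ) ≤ m := by exact_mod_cast hm
  have hm0 : (0 : ℝ) < m := by linarith
  refine mem_win.2 ⟨hp.one_lt.le, ?_⟩
  have : Real.log p - y / m = (m * Real.log p - y) / m := by field_simp
  rw [this, abs_div, abs_of_pos hm0, div_le_iff₀ hm0]
  nlinarith [abs_nonneg (m * Real.log p - y)]

lemma card_exponents_le {M y : ℝ} {p X : ℕ} (hp : p.Prime) :
    ((Ico 2 X).filter fun m => p ^ m ∈ win M y).card ≤ ⌊2 * M / Real.log 2⌋₊ + 1 := by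
  set S := (Ico 2 X).filter fun m => p ^ m ∈ win M y
  rcases S.eq_empty_or_nonempty with h | h
  · simp [h]
  have hsub : S ⊆ Icc (S.min' h) (S.min' h + ⌊2 * M / Real.log 2⌋₊) := by
    intro m hm
    have h1 := S.min'_le m hm
    have a1 := abs_le.1 (mem_win_pow (Finset.mem_filter.1 hm).2).2
    have a2 := abs_le.1 (mem_win_pow (Finset.mem_filter.1 (S.min'_mem h)).2).2
    have hl2 : 0 < Real.log 2 := Real.log_pos one_lt_two
    have hlp : Real.log 2 ≤ Real.log p := Real.log_le_log two_pos (by exact_mod_cast hp.two_le)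
    rw [Finset.mem_Icc]
    refine ⟨h1, ?_⟩
    have : m - S.min' h ≤ ⌊2 * M / Real.log 2⌋₊ := by
      refine Nat.le_floor ?_
      rw [Nat.cast_sub h1, le_div_iff₀ hl2]
      have h3 : (0 : ℝ) ≤ m - S.min' h := by
        have : ((S.min' h : ℕ) : ℝ) ≤ m := by exact_mod_cast h1
        linarith
      nlinarith
    omega
  refine (Finset.card_le_card hsub).trans ?_
  simp
  omega

/-- Proper prime powers contribute negligibly to a logarithmic window. -/
lemma HeckeRel.proper_small {l : ℕ → ℝ} (h : HeckeRel l)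
    (hl : Tendsto (fun n : ℕ => l n ^ 2 / n) atTop (𝓝 0)) {M C : ℝ}
    (hC : ∀ y, ∑ p ∈ win M y with p.Prime, Real.log p * l p ^ 2 / p ≤ C) {η : ℝ} (hη : 0 < η) :
    ∃ y₀, ∀ y, y₀ ≤ y →
      ∑ n ∈ win M y with ¬ n.Prime, vonMangoldt n * (tau l n ^ 2 / n) ≤ η := by
  have hC0 : 0 ≤ C := (Finset.sum_nonneg fun p hp => div_nonneg (mul_nonneg
    (Real.log_natCast_nonneg _) (sq_nonneg _)) (Nat.cast_nonneg _)).trans (hC 0)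
  set B := C + Real.log 4 * Real.exp (2 * M) with hBdef
  have hB : 0 ≤ B := add_nonneg hC0 (mul_nonneg (Real.log_nonneg (by norm_num)) (Real.exp_pos _).le)
  set ε := min (1 / 2) (η / (32 * (B + 1))) with hε
  have hε0 : 0 < ε := lt_min (by norm_num) (by positivity)
  have hε1 : ε ≤ 1 / 2 := min_le_left _ _
  have hε2 : 16 * B * ε ≤ η / 2 := by
    have : ε ≤ η / (32 * (B + 1)) := min_le_right _ _
    rw [le_div_iff₀ (by positivity)] at this
    nlinarith
  set ρ : ℕ → ℝ := fun p => 2 * (l p ^ 2 + 1) / p with hρ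
  have hρ0 : ∀ p, 0 ≤ ρ p := fun p => by positivity
  have hρt : Tendsto ρ atTop (𝓝 0) := by
    have := (hl.add tendsto_one_div_atTop_nhds_zero_nat).const_mul 2
    simp only [add_zero, mul_zero] at this
    refine this.congr fun n => ?_
    simp only [hρ]; ring
  obtain ⟨P, hP⟩ := eventually_atTop.1 (hρt.eventually_le_const hε0)
  set K := ⌊2 * M / Real.log 2⌋₊ + 1 with hK
  set η₁ := η / (2 * ((P : ℝ) + 1) * K) with hη₁
  have hK0 : (0 : ℝ) < K := by rw [hK]; positivity
  have hη₁0 : 0 < η₁ := by positivity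
  have hm : ∀ p : ℕ, ∃ m₀ : ℕ, p.Prime → ∀ m, m₀ ≤ m →
      Real.log p * (tau l (p ^ m) ^ 2 / ((p ^ m : ℕ) : ℝ)) ≤ η₁ := by
    intro p
    by_cases hp : p.Prime
    · have := (h.tau_sq_div_tendsto hl hp).const_mul (Real.log p)
      rw [mul_zero] at this
      obtain ⟨m, hm⟩ := eventually_atTop.1 (this.eventually_le_const hη₁0)
      exact ⟨m, fun _ k hk => by simpa using hm k hk⟩
    · exact ⟨0, fun hp' => absurd hp' hp⟩
  choose m₀ hm₀ using hm
  refine ⟨M + ∑ p ∈ range P, m₀ p * Real.log p, fun y hy => ?_⟩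
  set X := (win M y).sup id + 1 with hX
  refine (sum_proper_prime_pow_le (win M y) (fun n => tau l n ^ 2 / n) (fun n => by positivity)
    (X := X) fun n hn => Nat.lt_succ_of_le (Finset.le_sup (f := id) hn)).trans ?_
  rw [← Finset.sum_filter_add_sum_filter_not _ (fun p => p < P)]
  have hsmall : ∑ p ∈ (range X).filter Nat.Prime with p < P, ∑ m ∈ Ico 2 X with p ^ m ∈ win M y,
      Real.log p * (tau l (p ^ m) ^ 2 / ((p ^ m : ℕ) : ℝ)) ≤ η / 2 := by
    have h1 : ∀ p ∈ ((range X).filter Nat.Prime).filter (· < P),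
        ∑ m ∈ Ico 2 X with p ^ m ∈ win M y,
          Real.log p * (tau l (p ^ m) ^ 2 / ((p ^ m : ℕ) : ℝ)) ≤ K * η₁ := by
      intro p hp
      obtain ⟨hp1, hpP⟩ := Finset.mem_filter.1 hp
      have hpp := (Finset.mem_filter.1 hp1).2
      refine (Finset.sum_le_card_nsmul _ _ η₁ fun m hm => hm₀ p hpp m ?_).trans ?_
      · have h2 := abs_le.1 (mem_win_pow (Finset.mem_filter.1 hm).2).2
        have h3 : (m₀ p : ℝ) * Real.log p ≤ ∑ p ∈ range P, m₀ p * Real.log p :=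
          Finset.single_le_sum (f := fun p : ℕ => (m₀ p : ℝ) * Real.log p)
            (fun q _ => mul_nonneg (Nat.cast_nonneg _) (Real.log_natCast_nonneg _))
            (Finset.mem_range.2 hpP)
        have h4 : 0 < Real.log p := Real.log_pos (by exact_mod_cast hpp.one_lt)
        have : (m₀ p : ℝ) ≤ m := le_of_mul_le_mul_right (by linarith) h4
        exact_mod_cast this
      · rw [nsmul_eq_mul]
        gcongr
        exact card_exponents_le hpp
    refine (Finset.sum_le_card_nsmul _ _ _ h1).trans ?_
    have hcard : ((((range X).filter Nat.Prime).filter (· < P)).card : ℝ) ≤ P := by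
      have : (((range X).filter Nat.Prime).filter (· < P)) ⊆ range P := by
        intro p hp
        exact Finset.mem_range.2 (Finset.mem_filter.1 hp).2
      exact_mod_cast (Finset.card_le_card this).trans_eq (Finset.card_range P)
    rw [nsmul_eq_mul]
    calc _ ≤ (P : ℝ) * (K * η₁) := by gcongr
      _ ≤ ((P : ℝ) + 1) * (K * η₁) := by gcongr; linarith
      _ = η / 2 := by rw [hη₁]; field_simp
  have hlarge : ∑ p ∈ (range X).filter Nat.Prime with ¬ p < P, ∑ m ∈ Ico 2 X with p ^ m ∈ win M y,
      Real.log p * (tau l (p ^ m) ^ 2 / ((p ^ m : ℕ) : ℝ)) ≤ η / 2 := by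
    have h1 : ∑ p ∈ (range X).filter Nat.Prime with ¬ p < P, ∑ m ∈ Ico 2 X with p ^ m ∈ win M y,
        Real.log p * (tau l (p ^ m) ^ 2 / ((p ^ m : ℕ) : ℝ)) ≤
        ∑ p ∈ (range X).filter Nat.Prime with ¬ p < P, ∑ m ∈ Ico 2 X,
          if p ∈ win M (y / m) then Real.log p * (4 * (ε ^ (m - 1) * ρ p)) else 0 := by
      refine Finset.sum_le_sum fun p hp => ?_
      obtain ⟨hp1, hpP⟩ := Finset.mem_filter.1 hp
      have hpp := (Finset.mem_filter.1 hp1).2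
      rw [Finset.sum_filter]
      refine Finset.sum_le_sum fun m hm => ?_
      have hm2 := (Finset.mem_Ico.1 hm).1
      split_ifs with c1 c2 c2
      · refine mul_le_mul_of_nonneg_left ?_ (Real.log_natCast_nonneg _)
        have hpos : (0 : ℝ) < p := by exact_mod_cast hpp.pos
        calc tau l (p ^ m) ^ 2 / ((p ^ m : ℕ) : ℝ)
            ≤ 4 * (2 * (l p ^ 2 + 1)) ^ m / ((p ^ m : ℕ) : ℝ) := by
              gcongr; exact tau_sq_le l hpp m
          _ = 4 * (ρ p) ^ m := by simp only [hρ, div_pow]; push_cast; ring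
          _ = 4 * ((ρ p) ^ (m - 1) * ρ p) := by rw [← pow_succ]; congr 2; omega
          _ ≤ _ := by
            have := hP p (by omega)
            have := hρ0 p
            gcongr
      · exact absurd (mem_win_root hpp (by omega) c1) c2
      · exact mul_nonneg (Real.log_natCast_nonneg _) (by have := hρ0 p; positivity)
      · rfl
    refine h1.trans ?_
    rw [Finset.sum_comm]
    have h2 : ∀ m ∈ Ico 2 X, ∑ p ∈ (range X).filter Nat.Prime with ¬ p < P,
        (if p ∈ win M (y / m) then Real.log p * (4 * (ε ^ (m - 1) * ρ p)) else 0) ≤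
        8 * B * ε ^ (m - 1) := by
      intro m hm
      rw [← Finset.sum_filter]
      have h3 : ∑ p ∈ (((range X).filter Nat.Prime).filter fun p => ¬ p < P) with p ∈ win M (y / m),
          Real.log p * (4 * (ε ^ (m - 1) * ρ p)) ≤ ∑ p ∈ win M (y / m) with p.Prime,
          Real.log p * (4 * (ε ^ (m - 1) * ρ p)) := by
        refine Finset.sum_le_sum_of_subset_of_nonneg ?_ fun p _ _ => mul_nonneg
          (Real.log_natCast_nonneg _) (by have := hρ0 p; positivity)
        intro p hp
        simp only [Finset.mem_filter] at hp ⊢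
        exact ⟨hp.2, hp.1.1.2⟩
      refine h3.trans ?_
      have h4 : ∑ p ∈ win M (y / m) with p.Prime, Real.log p * (4 * (ε ^ (m - 1) * ρ p)) =
          8 * ε ^ (m - 1) * (∑ p ∈ win M (y / m) with p.Prime, Real.log p * l p ^ 2 / p +
            ∑ p ∈ win M (y / m) with p.Prime, Real.log p / p) := by
        rw [← Finset.sum_add_distrib, Finset.mul_sum]
        refine Finset.sum_congr rfl fun p _ => ?_
        simp only [hρ]; ring
      rw [h4, show 8 * B * ε ^ (m - 1) = 8 * ε ^ (m - 1) * B by ring]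
      gcongr
      exact add_le_add (hC _) (sum_log_div_win_le _ _)
    refine (Finset.sum_le_sum h2).trans ?_
    rw [← Finset.mul_sum]
    have h5 : ∑ m ∈ Ico 2 X, ε ^ (m - 1) ≤ 2 * ε := by
      rw [Finset.sum_Ico_eq_sum_range]
      have : ∀ k, ε ^ (2 + k - 1) = ε * ε ^ k := fun k => by rw [← pow_succ']; congr 1; omega
      simp only [this]
      rw [← Finset.mul_sum, mul_comm]
      gcongr
      refine ((summable_geometric_of_lt_one hε0.le (by linarith)).sum_le_tsum _
        (fun _ _ => by positivity)).trans ?_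
      rw [tsum_geometric_of_lt_one hε0.le (by linarith)]
      rw [inv_le_comm₀ (by linarith) two_pos]
      linarith
    calc _ ≤ 8 * B * (2 * ε) := by gcongr
      _ ≤ η / 2 := by linarith
  linarith

end CuspPrime

namespace CuspPrime

open ArithmeticFunction
open scoped Topology ComplexOrder

variable {ι : Type} {l : ι → ℕ → ℝ} {E : ι → ι → ℂ → ℂ}

lemma RSFamily.sq_div_tendsto (F : RSFamily l E) (i : ι) :
    Tendsto (fun n : ℕ => l i n ^ 2 / n) atTop (𝓝 0) := by
  obtain ⟨c, hc⟩ := F.polar_diag i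
  refine squeeze_zero' (Eventually.of_forall fun n => by positivity) ?_ (tendsto_div_of_polarData hc)
  filter_upwards [eventually_ge_atTop 1] with n hn
  gcongr
  exact (Complex.le_def.1 (sq_le_rsCoef (l i) (by omega : n ≠ 0))).1

lemma primeMass_nonneg [Fintype ι] (c : ι → ℂ) (n : ℕ) : 0 ≤ primeMass l c n :=
  mul_nonneg vonMangoldt_nonneg (by positivity)

lemma RSFamily.win_prime_le [Fintype ι] (F : RSFamily l E) (i : ι) (M : ℝ) :
    ∃ C, ∀ y, ∑ p ∈ win M y with p.Prime, Real.log p * l i p ^ 2 / p ≤ C := by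
  classical
  obtain ⟨T, hT, h⟩ := F.polar_primeMass (Pi.single i 1)
  obtain ⟨C, hC⟩ := h.win_le hT M
  refine ⟨C, fun y => le_trans ?_ (hC y)⟩
  refine le_trans (Finset.sum_le_sum fun p hp => ?_) (Finset.sum_le_sum_of_subset_of_nonneg
    (Finset.filter_subset Nat.Prime _) fun n _ _ => div_nonneg (primeMass_nonneg _ _) (Nat.cast_nonneg _))
  have hp' := (Finset.mem_filter.1 hp).2
  refine le_of_eq ?_
  rw [primeMass, vonMangoldt_apply_prime hp']
  simp [Pi.single_apply, tau_prime _ hp']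

/-- A nonzero combination of Hecke eigenvalue systems has positive mass on the primes. -/
theorem RSFamily.prime_mass [Fintype ι] (F : RSFamily l E) {c : ι → ℂ} (hc : c ≠ 0) :
    ∃ M, 0 < M ∧ ∃ δ, 0 < δ ∧ ∃ y₀, ∀ y, y₀ ≤ y →
      δ ≤ ∑ p ∈ win M y with p.Prime, Real.log p * ‖∑ i, c i * l i p‖ ^ 2 / p := by
  obtain ⟨T, hT, h⟩ := F.polar_primeMass c
  set c₀ := ∑ i, ‖c i‖ ^ 2 with hc₀
  have hc0 : 0 < c₀ := by
    obtain ⟨i, hi⟩ := Function.ne_iff.1 hc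
    exact Finset.sum_pos' (fun _ _ => by positivity)
      ⟨i, Finset.mem_univ i, by have := norm_pos_iff.2 hi; positivity⟩
  obtain ⟨M, hM, δ, hδ, y₀, hy₀⟩ := h.win_ge hT hc0
  set η := δ / (2 * c₀ * (Fintype.card ι + 1)) with hη
  have hη0 : 0 < η := by positivity
  have hev : ∀ᶠ y in (atTop : Filter ℝ), ∀ i, ∑ n ∈ win M y with ¬ n.Prime,
      vonMangoldt n * (tau (l i) n ^ 2 / n) ≤ η := by
    refine eventually_all.2 fun i => ?_
    obtain ⟨C, hC⟩ := F.win_prime_le i M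
    obtain ⟨y₁, hy₁⟩ := (F.hecke i).proper_small (F.sq_div_tendsto i) hC hη0
    exact eventually_atTop.2 ⟨y₁, hy₁⟩
  obtain ⟨y₁, hy₁⟩ := eventually_atTop.1 hev
  refine ⟨M, hM, δ / 2, by positivity, max y₀ y₁, fun y hy => ?_⟩
  have h1 := hy₀ y (le_of_max_le_left hy)
  have h2 := hy₁ y (le_of_max_le_right hy)
  rw [← Finset.sum_filter_add_sum_filter_not _ Nat.Prime] at h1
  have h3 : ∑ n ∈ win M y with n.Prime, primeMass l c n / n =
      ∑ p ∈ win M y with p.Prime, Real.log p * ‖∑ i, c i * l i p‖ ^ 2 / p := by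
    refine Finset.sum_congr rfl fun p hp => ?_
    have hp' := (Finset.mem_filter.1 hp).2
    rw [primeMass, vonMangoldt_apply_prime hp']
    simp only [tau_prime _ hp']
  have h4 : ∑ n ∈ win M y with ¬ n.Prime, primeMass l c n / n ≤ δ / 2 := by
    calc ∑ n ∈ win M y with ¬ n.Prime, primeMass l c n / n
        ≤ ∑ n ∈ win M y with ¬ n.Prime, c₀ * ∑ i, vonMangoldt n * (tau (l i) n ^ 2 / n) := by
          refine Finset.sum_le_sum fun n _ => ?_
          have hcs : ‖∑ i, c i * tau (l i) n‖ ^ 2 ≤ c₀ * ∑ i, tau (l i) n ^ 2 := by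
            calc ‖∑ i, c i * tau (l i) n‖ ^ 2 ≤ (∑ i, ‖c i‖ * |tau (l i) n|) ^ 2 := by
                  gcongr
                  refine (norm_sum_le _ _).trans_eq (Finset.sum_congr rfl fun i _ => ?_)
                  rw [norm_mul, norm_real, Real.norm_eq_abs]
              _ ≤ (∑ i, ‖c i‖ ^ 2) * ∑ i, |tau (l i) n| ^ 2 := Finset.sum_mul_sq_le_sq_mul_sq _ _ _
              _ = _ := by simp only [sq_abs, hc₀]
          rw [primeMass, ← Finset.mul_sum, ← Finset.sum_div]
          calc _ ≤ vonMangoldt n * (c₀ * ∑ i, tau (l i) n ^ 2) / n := by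
                have : 0 ≤ vonMangoldt n := vonMangoldt_nonneg
                gcongr
            _ = _ := by ring
      _ = c₀ * ∑ i, ∑ n ∈ win M y with ¬ n.Prime, vonMangoldt n * (tau (l i) n ^ 2 / n) := by
          rw [← Finset.mul_sum, Finset.sum_comm]
      _ ≤ c₀ * ∑ _i : ι, η := by
          gcongr with i _
          exact h2 i
      _ = c₀ * (Fintype.card ι * η) := by simp
      _ ≤ c₀ * ((Fintype.card ι + 1) * η) := by gcongr; linarith
      _ = δ / 2 := by rw [hη]; field_simp
  linarith

end CuspPrime

namespace CuspPrime
section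
open MeasureTheory ModularGroup
open UpperHalfPlane hiding I
open scoped Topology ENNReal MatrixGroups Modular

lemma measurable_ofComplex : Measurable (UpperHalfPlane.ofComplex : ℂ → ℍ) := by
  have hs : MeasurableSet {z : ℂ | 0 < z.im} := (isOpen_lt continuous_const Complex.continuous_im).measurableSet
  refine measurable_of_restrict_of_restrict_compl hs ?_ ?_
  · have : Continuous ({z : ℂ | 0 < z.im}.domRestrict (UpperHalfPlane.ofComplex : ℂ → ℍ)) := by
      rw [← continuousOn_iff_continuous_domRestrict]
      intro z hz
      exact (UpperHalfPlane.contMDiffAt_ofComplex (n := 0) hz).continuousAt.continuousWithinAt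
    exact this.measurable
  · have : (({z : ℂ | 0 < z.im}ᶜ).domRestrict (UpperHalfPlane.ofComplex : ℂ → ℍ)) = fun _ => UpperHalfPlane.ofComplex 0 := by
      ext ⟨z, hz⟩
      simp only [Set.mem_compl_iff, Set.mem_ofPred_eq, not_lt] at hz
      simp [Set.domRestrict, UpperHalfPlane.ofComplex_apply_of_im_nonpos hz, UpperHalfPlane.ofComplex_apply_of_im_nonpos (w := 0) (by simp)]
    rw [this]
    exact measurable_const

/-- Integration over the upper half plane in Cartesian coordinates. -/
lemma lintegral_uhp {F : ℍ → ℝ≥0∞} (hF : Measurable F) :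
    ∫⁻ z : ℍ, F z = ∫⁻ y in Set.Ioi (0 : ℝ), ∫⁻ x : ℝ,
      F (UpperHalfPlane.ofComplex (x + y * I)) * ENNReal.ofReal (1 / y ^ 2) := by
  have hs : MeasurableSet {z : ℂ | 0 < z.im} := (isOpen_lt continuous_const Complex.continuous_im).measurableSet
  have h1 : ∫⁻ z : ℍ, F z = ∫⁻ z : ℂ in {z : ℂ | 0 < z.im}, F (UpperHalfPlane.ofComplex z) * ENNReal.ofReal (1 / z.im ^ 2) := by
    have mp : MeasurePreserving UpperHalfPlane.coe (volume.comap UpperHalfPlane.coe)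
      (volume.restrict (.range UpperHalfPlane.coe)) :=
      ⟨measurable_coe, by rw [measurableEmbedding_coe.map_comap]⟩
    have hr : Set.range UpperHalfPlane.coe = {z : ℂ | 0 < z.im} := by
      ext z; simp [UpperHalfPlane.range_coe]
    rw [← hr, ← mp.lintegral_comp_emb measurableEmbedding_coe, volume_def,
      lintegral_withDensity_eq_lintegral_mul₀]
    · refine lintegral_congr fun z => ?_
      simp only [Pi.mul_apply, UpperHalfPlane.ofComplex_apply, mul_comm]
      congr 1
      rw [UpperHalfPlane.coe_im, ← ENNReal.ofReal_coe_nnreal]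
      congr 1
      push_cast
      simp
    · refine Measurable.aemeasurable ?_
      refine Measurable.coe_nnreal_ennreal ?_
      refine Measurable.pow_const ?_ 2
      refine Measurable.const_div ?_ _
      exact (UpperHalfPlane.continuous_im.subtype_mk _).measurable
    · exact hF.aemeasurable
  rw [h1, ← lintegral_indicator hs,
    ← (Complex.volume_preserving_equiv_real_prod.symm).lintegral_comp_emb (MeasurableEquiv.measurableEmbedding _)]
  have hm : Measurable (fun z : ℂ => {z : ℂ | 0 < z.im}.indicator (fun z => F (UpperHalfPlane.ofComplex z) * ENNReal.ofReal (1 / z.im ^ 2)) z) := by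
    refine Measurable.indicator ?_ hs
    refine Measurable.mul (hF.comp measurable_ofComplex) ?_
    exact ENNReal.measurable_ofReal.comp (measurable_const.div (Complex.measurable_im.pow_const 2))
  rw [Measure.volume_eq_prod, lintegral_prod_symm _ (by exact (hm.comp (MeasurableEquiv.measurable _)).aemeasurable), ← lintegral_indicator measurableSet_Ioi]
  refine lintegral_congr fun y => ?_
  by_cases hy : 0 < y
  · rw [Set.indicator_of_mem (by exact hy)]
    refine lintegral_congr fun x => ?_
    have : Complex.measurableEquivRealProd.symm (x, y) = x + y * I := by
      apply Complex.ext <;> simp [Complex.measurableEquivRealProd]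
    rw [this, Set.indicator_of_mem (by simpa using hy)]
    simp
  · rw [Set.indicator_of_notMem (by exact hy)]
    rw [lintegral_eq_zero_iff' ]
    · refine .of_forall fun x => ?_
      refine Set.indicator_of_notMem ?_ _
      simpa [Complex.measurableEquivRealProd] using hy
    · exact (hm.comp ((MeasurableEquiv.measurable _).comp (measurable_id.prodMk measurable_const))).aemeasurable

instance : Countable SL(2, ℤ) :=
  inferInstanceAs (Countable {A : Fin 2 → Fin 2 → ℤ // Matrix.det (Matrix.of A) = 1})

lemma measurable_sl_smul (g : SL(2, ℤ)) : Measurable (fun z : ℍ => g • z) := by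
  have : Continuous (fun z : ℍ => g • z) := continuous_const_smul (g : GL (Fin 2) ℝ)
  exact this.measurable

lemma lintegral_gl_smul (g : GL (Fin 2) ℝ) (F : ℍ → ℝ≥0∞) :
    ∫⁻ z : ℍ, F (g • z) = ∫⁻ z, F z :=
  (measurePreserving_smul g (volume : Measure ℍ)).lintegral_comp_emb (measurableEmbedding_const_smul g) F

lemma lintegral_sl_smul (g : SL(2, ℤ)) (F : ℍ → ℝ≥0∞) :
    ∫⁻ z : ℍ, F (g • z) = ∫⁻ z, F z :=
  lintegral_gl_smul (g : GL (Fin 2) ℝ) F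

/-- The number of translates of `z` in the standard fundamental domain. -/
def fdCount (z : ℍ) : ℝ≥0∞ := ∑' γ : SL(2, ℤ), (fd.indicator 1 (γ • z) : ℝ≥0∞)

lemma fdCount_smul (g : SL(2, ℤ)) (z : ℍ) : fdCount (g • z) = fdCount z := by
  unfold fdCount
  rw [← (Equiv.mulRight g).tsum_eq (fun γ : SL(2, ℤ) => (fd.indicator 1 (γ • z) : ℝ≥0∞))]
  simp [mul_smul]

lemma finite_smul_mem_fd (z : ℍ) : {γ : SL(2, ℤ) | γ • z ∈ fd}.Finite := by
  obtain ⟨g, hg⟩ := exists_smul_mem_fd z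
  obtain ⟨s, hs⟩ : ∃ s : List SL(2, ℤ), s = [1, -1, T, -T, T⁻¹, -T⁻¹, S, -S, T * S, -(T * S), T⁻¹ * S * T⁻¹, -(T⁻¹ * S * T⁻¹), S * T⁻¹, -(S * T⁻¹), S * T, -(S * T), T * S * T, -(T * S * T), T⁻¹ * S, -(T⁻¹ * S)] := ⟨_, rfl⟩
  refine ((List.finite_toSet s).image (fun γ => γ * g)).subset ?_
  intro γ hγ
  refine ⟨γ * g⁻¹, ?_, by simp⟩
  have h1 : (γ * g⁻¹) • g • z ∈ fd := by
    rw [← mul_smul, inv_mul_cancel_right]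
    exact hγ
  have := cases_of_mem_fd_smul_mem_fd hg h1
  generalize γ * g⁻¹ = m at this
  rw [hs]
  show m ∈ [_, _, _, _, _, _, _, _, _, _, _, _, _, _, _, _, _, _, _, _]
  simp only [List.mem_cons]
  rcases this with (h | h) | ⟨h | h, -⟩ | ⟨h | h, -⟩ | ⟨h | h, -⟩ | ⟨h | h, -⟩ | ⟨h | h, -⟩ | ⟨h | h, -⟩ | ⟨h | h, -⟩ | ⟨h | h, -⟩ | ⟨h | h, -⟩ <;> simp only [h, true_or, or_true]

lemma fdCount_ne_top (z : ℍ) : fdCount z ≠ ⊤ := by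
  unfold fdCount
  rw [tsum_eq_sum (s := (finite_smul_mem_fd z).toFinset)]
  · exact (ENNReal.sum_lt_top.2 fun γ _ => by
      by_cases h : γ • z ∈ fd
      · rw [Set.indicator_of_mem h]; exact ENNReal.one_lt_top
      · rw [Set.indicator_of_notMem h]; exact ENNReal.zero_lt_top).ne
  · intro γ hγ
    simp only [Set.Finite.mem_toFinset, Set.mem_ofPred_eq] at hγ
    exact Set.indicator_of_notMem hγ _

lemma one_le_fdCount (z : ℍ) : 1 ≤ fdCount z := by
  obtain ⟨g, hg⟩ := exists_smul_mem_fd z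
  have := ENNReal.le_tsum (f := fun γ : SL(2, ℤ) => (fd.indicator 1 (γ • z) : ℝ≥0∞)) g
  rwa [Set.indicator_of_mem hg] at this

lemma measurableSet_fd : MeasurableSet fd := isClosed_fd.measurableSet

lemma measurable_fdCount : Measurable fdCount := by
  unfold fdCount
  refine Measurable.tsum fun γ => ?_
  exact (measurable_one.indicator measurableSet_fd).comp (measurable_sl_smul γ)

/-- A measurable weight, supported on the fundamental domain, whose translates sum to `1`. -/
def eta (z : ℍ) : ℝ≥0∞ := fd.indicator 1 z / fdCount z

lemma measurable_eta : Measurable eta :=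
  (measurable_one.indicator measurableSet_fd).div measurable_fdCount

lemma eta_le (z : ℍ) : eta z ≤ fd.indicator 1 z := by
  unfold eta
  exact ENNReal.div_le_of_le_mul (le_mul_of_one_le_right (by positivity) (one_le_fdCount z))

lemma tsum_eta (z : ℍ) : ∑' γ : SL(2, ℤ), eta (γ • z) = 1 := by
  simp only [eta, fdCount_smul, div_eq_mul_inv]
  rw [ENNReal.tsum_mul_right]
  exact ENNReal.mul_inv_cancel (zero_lt_one.trans_le (one_le_fdCount z)).ne' (fdCount_ne_top z)

/-- Unfolding. -/
lemma lintegral_unfold {F φ : ℍ → ℝ≥0∞} (hF : Measurable F) (hφ : Measurable φ)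
    (hinv : ∀ (γ : SL(2, ℤ)) z, F (γ • z) = F z) :
    ∫⁻ z, F z * (∑' γ : SL(2, ℤ), φ (γ • z)) * eta z = ∫⁻ z, F z * φ z := by
  have h1 : ∀ z, F z * (∑' γ : SL(2, ℤ), φ (γ • z)) * eta z = ∑' γ : SL(2, ℤ), F z * φ (γ • z) * eta z := by
    intro z
    rw [← ENNReal.tsum_mul_left, ← ENNReal.tsum_mul_right]
  simp_rw [h1]
  rw [lintegral_tsum (f := fun (γ : SL(2, ℤ)) z => F z * φ (γ • z) * eta z) fun γ => ((hF.mul (hφ.comp (measurable_sl_smul γ))).mul measurable_eta).aemeasurable]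
  have h2 : ∀ γ : SL(2, ℤ), ∫⁻ z, F z * φ (γ • z) * eta z = ∫⁻ z, F z * φ z * eta (γ⁻¹ • z) := by
    intro γ
    rw [← lintegral_sl_smul γ (fun z => F z * φ z * eta (γ⁻¹ • z))]
    simp only [hinv, inv_smul_smul]
  simp_rw [h2]
  rw [← lintegral_tsum (f := fun (γ : SL(2, ℤ)) z => F z * φ z * eta (γ⁻¹ • z)) fun γ => ((hF.mul hφ).mul (measurable_eta.comp (measurable_sl_smul _))).aemeasurable]
  refine lintegral_congr fun z => ?_
  have h3 := (Equiv.inv SL(2, ℤ)).tsum_eq (fun γ => eta (γ • z))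
  simp only [Equiv.inv_apply] at h3
  rw [ENNReal.tsum_mul_left, h3, tsum_eta, mul_one]

lemma lintegral_eta_lt_top : ∫⁻ z, eta z < ⊤ := by
  refine (lintegral_mono eta_le).trans_lt ?_
  rw [lintegral_uhp (measurable_one.indicator measurableSet_fd)]
  have h : ∀ y ∈ Set.Ioi (0:ℝ), ∫⁻ x : ℝ, (fd.indicator 1 (UpperHalfPlane.ofComplex (x + y * I)) : ℝ≥0∞) * ENNReal.ofReal (1 / y ^ 2)
      ≤ (Set.Ioi (1/2 : ℝ)).indicator (fun y => ENNReal.ofReal (y ^ (-2 : ℝ))) y := by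
    intro y hy
    have hy0 : 0 < y := hy
    have him : 0 < ((0:ℝ) + y * I : ℂ).im := by simpa using hy0
    have key : ∀ x : ℝ, UpperHalfPlane.ofComplex (x + y * I) ∈ fd → 1/2 < y ∧ x ∈ Set.Icc (-(1/2) : ℝ) (1/2) := by
      intro x hx
      have h0 : 0 < ((x:ℂ) + y * I).im := by simpa using hy0
      have h3 := three_le_four_mul_im_sq_of_mem_fd hx
      rw [UpperHalfPlane.ofComplex_apply_of_im_pos h0] at h3 hx
      have h4 := hx.2
      simp only [UpperHalfPlane.re, UpperHalfPlane.im, add_im, ofReal_im, mul_im, ofReal_re, Complex.I_im, Complex.I_re, mul_one, mul_zero, add_zero, zero_add, add_re, mul_re, sub_zero] at h3 h4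
      refine ⟨by nlinarith, ?_⟩
      exact ⟨(abs_le.1 h4).1, (abs_le.1 h4).2⟩
    calc _ ≤ ∫⁻ x : ℝ, (Set.Icc (-(1/2) : ℝ) (1/2)).indicator (fun _ => (Set.Ioi (1/2 : ℝ)).indicator (fun y => ENNReal.ofReal (y ^ (-2 : ℝ))) y) x := by
          refine lintegral_mono fun x => ?_
          by_cases hx : UpperHalfPlane.ofComplex (x + y * I) ∈ fd
          · obtain ⟨h1, h2⟩ := key x hx
            rw [Set.indicator_of_mem hx, Set.indicator_of_mem h2, Set.indicator_of_mem (by exact h1)]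
            simp only [Pi.one_apply, one_mul]
            rw [Real.rpow_neg hy0.le, one_div]
            norm_cast
          · simp [hx]
      _ = _ := by
          rw [lintegral_indicator measurableSet_Icc]
          simp
          norm_num
  refine (setLIntegral_mono' measurableSet_Ioi h).trans_lt ?_
  refine (setLIntegral_le_lintegral _ _).trans_lt ?_
  rw [lintegral_indicator measurableSet_Ioi]
  have := (integrableOn_Ioi_rpow_of_lt (a := -2) (by norm_num) (c := 1/2) (by norm_num))
  exact this.lintegral_lt_top

end
end CuspPrime

namespace CuspPrime
section
open MeasureTheory ModularGroup
open UpperHalfPlane hiding I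
open scoped Topology ENNReal MatrixGroups Modular

/-- Terms of the two-dimensional theta series. -/
def thTerm (t : ℝ) (z : ℍ) (v : Fin 2 → ℤ) : ℝ :=
  Real.exp (-(Real.pi * t * ‖(v 0 : ℂ) * z + v 1‖ ^ 2 / z.im))

lemma thTerm_nonneg (t : ℝ) (z : ℍ) (v : Fin 2 → ℤ) : 0 ≤ thTerm t z v := (Real.exp_pos _).le

lemma exp_neg_le_inv_pow (N : ℕ) {u : ℝ} (hu : 0 < u) :
    Real.exp (-u) ≤ N.factorial * (u ^ N)⁻¹ := by
  have h := Real.pow_div_factorial_le_exp u hu.le N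
  rw [Real.exp_neg, ← div_eq_mul_inv, le_div_iff₀ (by positivity), inv_mul_le_iff₀ (Real.exp_pos _)]
  rwa [div_le_iff₀ (by positivity)] at h

lemma thTerm_le {t : ℝ} (ht : 0 < t) (z : ℍ) (v : Fin 2 → ℤ) (hv : v ≠ 0) {c : ℝ} (hc : 0 < c)
    (h : c * ‖v‖ ≤ ‖(v 0 : ℂ) * z + v 1‖) (N : ℕ) :
    thTerm t z v ≤ (N.factorial * ((Real.pi * c ^ 2) ^ N)⁻¹ * (‖v‖ ^ (2 * N))⁻¹) * (z.im / t) ^ N := by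
  have hv' : 0 < ‖v‖ := norm_pos_iff.2 hv
  have hy := z.im_pos
  have h1 : thTerm t z v ≤ Real.exp (-(Real.pi * t * (c * ‖v‖) ^ 2 / z.im)) := by
    unfold thTerm
    have := Real.pi_pos
    gcongr
  refine (h1.trans (exp_neg_le_inv_pow N (by have := Real.pi_pos; positivity))).trans_eq ?_
  have hne : ‖v‖ ^ N ≠ 0 := by positivity
  have hpi := Real.pi_pos
  have : ((Real.pi * t * (c * ‖v‖) ^ 2 / z.im) ^ N)⁻¹ =
      ((Real.pi * c ^ 2) ^ N)⁻¹ * (‖v‖ ^ (2 * N))⁻¹ * (z.im / t) ^ N := by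
    rw [pow_mul, ← inv_pow, ← inv_pow, ← inv_pow, ← mul_pow, ← mul_pow]
    congr 1
    field_simp
  rw [this]
  ring

lemma summable_inv_norm_pow {N : ℕ} (hN : 2 ≤ N) :
    Summable (fun v : Fin 2 → ℤ => (‖v‖ ^ (2 * N))⁻¹) := by
  have := EisensteinSeries.summable_one_div_norm_rpow (k := (2 * N : ℕ))
    (by have : (2:ℝ) ≤ N := by exact_mod_cast hN
        push_cast; linarith)
  refine this.congr fun v => ?_
  rw [Real.rpow_neg (norm_nonneg _), Real.rpow_natCast]

lemma summable_thTerm {t : ℝ} (ht : 0 < t) (z : ℍ) : Summable (thTerm t z) := by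
  rw [← (Set.finite_singleton (0 : Fin 2 → ℤ)).summable_compl_iff]
  refine Summable.of_nonneg_of_le (fun v => thTerm_nonneg _ _ _)
    (fun v => thTerm_le ht z v.1 v.2 (EisensteinSeries.r_pos z)
      (EisensteinSeries.r_mul_max_le z v.2) 2) ?_
  exact (((summable_inv_norm_pow le_rfl).mul_left _).mul_right _).subtype _

lemma norm_le_of_mem_fd {z : ℍ} (hz : z ∈ fd) (v : Fin 2 → ℤ) :
    (1/2 : ℝ) * ‖v‖ ≤ ‖(v 0 : ℂ) * z + v 1‖ := by
  have hn : ‖(v 0 : ℂ) * z + v 1‖ ^ 2 = (v 0) ^ 2 * normSq (z : ℂ) + 2 * v 0 * v 1 * z.re + (v 1) ^ 2 := by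
    rw [← normSq_eq_norm_sq, normSq_apply, normSq_apply]
    simp
    ring
  have h1 : 1 ≤ normSq (z : ℂ) := hz.1
  have h2 : |z.re| ≤ 1 / 2 := hz.2
  have h2' := abs_le.1 h2
  rw [EisensteinSeries.norm_eq_max_natAbs]
  refine le_of_sq_le_sq ?_ (norm_nonneg _)
  rw [hn]
  set m : ℝ := ((v 0 : ℤ) : ℝ)
  set n : ℝ := ((v 1 : ℤ) : ℝ)
  have hm : ((v 0).natAbs : ℝ) = |m| := by simp [m, Nat.cast_natAbs]
  have hn : ((v 1).natAbs : ℝ) = |n| := by simp [n, Nat.cast_natAbs]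
  have key : (m ^ 2 + n ^ 2) / 2 ≤ m ^ 2 * normSq (z : ℂ) + 2 * m * n * z.re + n ^ 2 := by
    have : |2 * m * n * z.re| ≤ (m ^ 2 + n ^ 2) / 2 := by
      rw [abs_mul]
      calc |2 * m * n| * |z.re| ≤ (m ^ 2 + n ^ 2) * (1 / 2) := by
            gcongr
            rw [abs_le]; constructor <;> nlinarith [sq_nonneg (m + n), sq_nonneg (m - n)]
        _ = _ := by ring
    have := (abs_le.1 this).1
    nlinarith [sq_nonneg m, sq_nonneg n]
  refine le_trans ?_ key
  push_cast
  rw [hm, hn]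
  rcases max_choice |m| |n| with h | h <;> rw [h, mul_pow, sq_abs] <;> nlinarith [sq_nonneg m, sq_nonneg n]

/-- The two-dimensional theta series, with values in `[0, ∞]`. -/
def theta (t : ℝ) (z : ℍ) : ℝ≥0∞ := ∑' v : Fin 2 → ℤ, ENNReal.ofReal (thTerm t z v)

/-- The theta series without its constant term. -/
def theta' (t : ℝ) (z : ℍ) : ℝ≥0∞ :=
  ∑' v : {v : Fin 2 → ℤ // v ≠ 0}, ENNReal.ofReal (thTerm t z v)

lemma theta_eq (t : ℝ) (z : ℍ) : theta t z = 1 + theta' t z := by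
  unfold theta theta'
  have h := ENNReal.summable.tsum_add_tsum_compl (f := fun v : Fin 2 → ℤ => ENNReal.ofReal (thTerm t z v))
    (s := {0}) ENNReal.summable
  rw [← h]
  congr 1
  rw [tsum_singleton (0 : Fin 2 → ℤ) (fun v => ENNReal.ofReal (thTerm t z v))]
  simp [thTerm]

lemma exists_theta'_le {N : ℕ} (hN : 2 ≤ N) : ∃ C : ℝ, 0 ≤ C ∧ ∀ t : ℝ, 0 < t → ∀ z ∈ fd,
    theta' t z ≤ ENNReal.ofReal (C * (z.im / t) ^ N) := by
  have hs := (summable_inv_norm_pow hN).mul_left (N.factorial * ((Real.pi * (1/2) ^ 2) ^ N)⁻¹ : ℝ)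
  have h0 : ∀ v : Fin 2 → ℤ, 0 ≤ (N.factorial * ((Real.pi * (1/2) ^ 2) ^ N)⁻¹ : ℝ) * (‖v‖ ^ (2 * N))⁻¹ := by
    intro v; have := Real.pi_pos; positivity
  refine ⟨∑' v : Fin 2 → ℤ, (N.factorial * ((Real.pi * (1/2) ^ 2) ^ N)⁻¹ : ℝ) * (‖v‖ ^ (2 * N))⁻¹,
    tsum_nonneg h0, fun t ht z hz => ?_⟩
  rw [← tsum_mul_right, ENNReal.ofReal_tsum_of_nonneg
    (fun v => mul_nonneg (h0 v) (by have := z.im_pos; positivity)) (hs.mul_right _)]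
  refine le_trans (ENNReal.tsum_le_tsum fun v => ENNReal.ofReal_le_ofReal ?_) (ENNReal.tsum_comp_le_tsum_of_injective Subtype.val_injective _)
  exact thTerm_le ht z v.1 v.2 (by norm_num) (norm_le_of_mem_fd hz v.1) N

/-- The terms after Poisson summation in the second variable. -/
def psTerm (t : ℝ) (z : ℍ) (p : ℤ × ℤ) : ℂ :=
  cexp (-(Real.pi * t * z.im * p.1 ^ 2) - Real.pi * (z.im / t) * p.2 ^ 2 + 2 * Real.pi * I * p.1 * p.2 * z.re)

lemma summable_exp_neg_mul_sq {a : ℝ} (ha : 0 < a) : Summable (fun n : ℤ => Real.exp (-(Real.pi * a * n ^ 2))) := by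
  have := (summable_pow_mul_jacobiTheta₂_term_bound (S := 0) ha (0:ℕ))
  refine this.congr fun n => ?_
  simp [mul_assoc]

lemma summable_psTerm {t : ℝ} (ht : 0 < t) (z : ℍ) : Summable (psTerm t z) := by
  have hy := z.im_pos
  have h := (summable_exp_neg_mul_sq (mul_pos ht hy)).mul_of_nonneg
    (summable_exp_neg_mul_sq (div_pos hy ht)) (fun _ => (Real.exp_pos _).le) (fun _ => (Real.exp_pos _).le)
  refine Summable.of_norm (h.congr fun p => ?_)
  unfold psTerm
  rw [Complex.norm_exp, ← Real.exp_add]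
  congr 1
  have e : (-(Real.pi * t * z.im * p.1 ^ 2) - Real.pi * (z.im / t) * p.2 ^ 2 + 2 * Real.pi * I * p.1 * p.2 * z.re : ℂ)
    = ((-(Real.pi * t * z.im * p.1 ^ 2) - Real.pi * (z.im / t) * p.2 ^ 2 : ℝ) : ℂ) + ((2 * Real.pi * p.1 * p.2 * z.re : ℝ) : ℂ) * I := by
    push_cast; ring
  rw [e, add_re, ofReal_re, mul_re, ofReal_re, ofReal_im]
  simp
  ring

lemma tsum_psTerm_inv {t : ℝ} (z : ℍ) : ∑' p, psTerm t⁻¹ z p = ∑' p, psTerm t z p := by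
  rw [← (Equiv.prodComm ℤ ℤ).tsum_eq]
  refine tsum_congr fun p => ?_
  simp only [psTerm, Equiv.prodComm_apply, Prod.fst_swap, Prod.snd_swap]
  congr 1
  simp only [ofReal_inv, inv_inv, div_eq_mul_inv]
  ring

lemma tsum_thTerm_row {t : ℝ} (ht : 0 < t) (z : ℍ) (m : ℤ) :
    ((∑' n : ℤ, thTerm t z ![m, n] : ℝ) : ℂ) = (Real.sqrt (z.im / t) : ℂ) * ∑' n : ℤ, psTerm t z (m, n) := by
  have hy := z.im_pos
  have ha : 0 < ((z.im / t : ℝ) : ℂ).re := by rw [ofReal_re]; positivity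
  have h := Complex.tsum_exp_neg_quadratic ha (I * m * z.re)
  have hsq : ((z.im / t : ℝ) : ℂ) ^ (1 / 2 : ℂ) = (Real.sqrt (z.im / t) : ℂ) := by
    rw [Real.sqrt_eq_rpow, ofReal_cpow (by positivity)]
    norm_num
  have e1 : ∑' n : ℤ, psTerm t z (m, n) = cexp (-(Real.pi * t * z.im * m ^ 2)) *
      ∑' n : ℤ, cexp (-Real.pi * ((z.im / t : ℝ) : ℂ) * n ^ 2 + 2 * Real.pi * (I * m * z.re) * n) := by
    rw [← tsum_mul_left]
    refine tsum_congr fun n => ?_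
    rw [← Complex.exp_add, psTerm]
    congr 1
    push_cast
    ring
  have hs0 : (Real.sqrt (z.im / t) : ℂ) ≠ 0 := by
    rw [Ne, ofReal_eq_zero]
    exact (Real.sqrt_pos.2 (by positivity)).ne'
  rw [e1, h, hsq, mul_left_comm, ← mul_assoc _ (1 / _), mul_one_div_cancel hs0, one_mul, ofReal_tsum, ← tsum_mul_left,
    ← (Equiv.neg ℤ).tsum_eq (fun n : ℤ => cexp (-(Real.pi * t * z.im * m ^ 2)) * _)]
  refine tsum_congr fun n => ?_
  rw [← Complex.exp_add, thTerm, ofReal_exp]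
  congr 1
  have hn : ‖(m : ℂ) * z + n‖ ^ 2 = m ^ 2 * z.im ^ 2 + (m * z.re + n) ^ 2 := by
    rw [← normSq_eq_norm_sq, normSq_apply]
    simp
    ring
  have hy' : (z.im : ℂ) ≠ 0 := by exact_mod_cast hy.ne'
  have ht' : (t : ℂ) ≠ 0 := by exact_mod_cast ht.ne'
  simp only [Matrix.cons_val_zero, Matrix.cons_val_one]
  rw [hn]
  simp only [Equiv.neg_apply]
  push_cast
  field_simp
  ring_nf
  simp only [I_sq, I_pow_four]
  ring

lemma theta_eq_ofReal {t : ℝ} (ht : 0 < t) (z : ℍ) :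
    ∃ T : ℝ, 0 ≤ T ∧ theta t z = ENNReal.ofReal T ∧
      (T : ℂ) = (Real.sqrt (z.im / t) : ℂ) * ∑' p, psTerm t z p := by
  refine ⟨∑' v, thTerm t z v, tsum_nonneg fun v => thTerm_nonneg _ _ _, ?_, ?_⟩
  · rw [ENNReal.ofReal_tsum_of_nonneg (fun v => thTerm_nonneg _ _ _) (summable_thTerm ht z)]
    rfl
  · have hs := summable_thTerm ht z
    rw [← (finTwoArrowEquiv ℤ).symm.summable_iff] at hs
    rw [← (finTwoArrowEquiv ℤ).symm.tsum_eq]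
    erw [hs.tsum_prod]
    rw [ ofReal_tsum, (summable_psTerm ht z).tsum_prod, ← tsum_mul_left]
    refine tsum_congr fun m => ?_
    exact tsum_thTerm_row ht z m

/-- The functional equation of the theta series. -/
lemma theta_inv {t : ℝ} (ht : 0 < t) (z : ℍ) : theta t⁻¹ z = ENNReal.ofReal t * theta t z := by
  obtain ⟨T, hT, h1, h2⟩ := theta_eq_ofReal ht z
  obtain ⟨T', hT', h1', h2'⟩ := theta_eq_ofReal (inv_pos.2 ht) z
  rw [h1, h1', ← ENNReal.ofReal_mul ht.le]
  congr 1
  have : (T' : ℂ) = ((t * T : ℝ) : ℂ) := by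
    rw [ofReal_mul, h2, h2', tsum_psTerm_inv, ← mul_assoc]
    congr 1
    rw [← ofReal_mul]
    congr 1
    rw [Real.sqrt_eq_iff_mul_self_eq (by have := z.im_pos; positivity) (by positivity)]
    rw [mul_mul_mul_comm, Real.mul_self_sqrt (by have := z.im_pos; positivity)]
    field_simp
  exact_mod_cast this

end
end CuspPrime

namespace CuspPrime
section
open MeasureTheory ModularGroup EisensteinSeries
open UpperHalfPlane hiding I
open scoped Topology ENNReal MatrixGroups Modular

/-- The function on the strip `0 ≤ x < 1` whose Poincaré series is the theta series. -/
def seed (u : ℝ) (w : ℍ) : ℝ≥0∞ :=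
  ({w : ℍ | 0 ≤ w.re ∧ w.re < 1}.indicator (fun w => ENNReal.ofReal (Real.exp (-(Real.pi * u / w.im)))) w)

lemma measurable_seed : Measurable (fun p : ℝ × ℍ => seed p.1 p.2) := by
  have h1 : Measurable (fun p : ℝ × ℍ => p.2.re) := UpperHalfPlane.continuous_re.measurable.comp measurable_snd
  have h2 : Measurable (fun p : ℝ × ℍ => p.2.im) := UpperHalfPlane.continuous_im.measurable.comp measurable_snd
  have h3 : (fun p : ℝ × ℍ => seed p.1 p.2) = {p : ℝ × ℍ | 0 ≤ p.2.re ∧ p.2.re < 1}.indicator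
      (fun p => ENNReal.ofReal (Real.exp (-(Real.pi * p.1 / p.2.im)))) := by
    ext p
    rfl
  rw [h3]
  refine Measurable.indicator (by fun_prop) ?_
  exact (measurableSet_le measurable_const h1).inter (measurableSet_lt h1 measurable_const)

/-- The bottom row of a matrix, as a coprime pair. -/
def botRow (γ : SL(2, ℤ)) : gammaSet 1 1 0 :=
  ⟨γ.1 1, (mem_gammaSet_one _).2 (bottom_row_coprime γ)⟩

lemma exists_botRow (w : gammaSet 1 1 0) : ∃ γ, botRow γ = w := by
  obtain ⟨γ, -, h⟩ := bottom_row_surj (R := ℤ) ((mem_gammaSet_one _).1 w.2)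
  exact ⟨γ, Subtype.ext h⟩

lemma botRow_T_zpow_mul (n : ℤ) (γ : SL(2, ℤ)) : botRow (T ^ n * γ) = botRow γ := by
  apply Subtype.ext
  ext i
  simp [botRow]

lemma exists_eq_T_zpow_mul {γ γ₀ : SL(2, ℤ)} (h : botRow γ = botRow γ₀) : ∃ n : ℤ, T ^ n * γ₀ = γ := by
  have h' := congrArg Subtype.val h
  have h0 : γ 1 0 = γ₀ 1 0 := congrFun h' 0
  have h1 : γ 1 1 = γ₀ 1 1 := congrFun h' 1
  have d1 := γ.det_coe
  have d2 := γ₀.det_coe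
  rw [Matrix.det_fin_two] at d1 d2
  refine ⟨-(γ 0 0 * γ₀ 0 1) + γ 0 1 * γ₀ 0 0, ?_⟩
  ext i j
  fin_cases i <;> fin_cases j <;> simp [coe_T_zpow, Matrix.mul_apply, Fin.sum_univ_two]
  · rw [h0, h1] at d1; linear_combination γ 0 0 * d2 - γ₀ 0 0 * d1
  · rw [h0, h1] at d1; linear_combination γ 0 1 * d2 - γ₀ 0 1 * d1
  · exact h0.symm
  · exact h1.symm

/-- The fibers of `botRow` are the cosets of the translation subgroup. -/
def fiberEquiv (γ₀ : SL(2, ℤ)) : ℤ ≃ {γ // botRow γ = botRow γ₀} :=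
  Equiv.ofBijective (fun n => ⟨T ^ n * γ₀, botRow_T_zpow_mul n γ₀⟩) (by
    constructor
    · intro m n h
      have h1 : T ^ m = T ^ n := mul_right_cancel (congrArg Subtype.val h)
      have h2 := congrArg (fun g : SL(2, ℤ) => g.1 0 1) h1
      simpa [coe_T_zpow] using h2
    · rintro ⟨γ, hγ⟩
      obtain ⟨n, hn⟩ := exists_eq_T_zpow_mul hγ
      exact ⟨n, Subtype.ext hn⟩)

lemma tsum_seed_T_zpow (u : ℝ) (w : ℍ) :
    ∑' n : ℤ, seed u (T ^ n • w) = ENNReal.ofReal (Real.exp (-(Real.pi * u / w.im))) := by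
  rw [tsum_eq_single (-⌊w.re⌋)]
  · unfold seed
    rw [Set.indicator_of_mem, im_T_zpow_smul]
    simp only [Set.mem_ofPred_eq, re_T_zpow_smul]
    push_cast
    exact ⟨by linarith [Int.floor_le w.re], by linarith [Int.lt_floor_add_one w.re]⟩
  · intro n hn
    unfold seed
    rw [Set.indicator_of_notMem]
    simp only [Set.mem_ofPred_eq, re_T_zpow_smul]
    rintro ⟨h1, h2⟩
    apply hn
    have : ⌊w.re⌋ = -n := by
      rw [Int.floor_eq_iff]
      push_cast
      constructor <;> linarith
    omega

lemma thTerm_botRow (u : ℝ) (z : ℍ) (γ : SL(2, ℤ)) :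
    thTerm u z (botRow γ) = Real.exp (-(Real.pi * u / (γ • z).im)) := by
  unfold thTerm
  rw [ModularGroup.im_smul_eq_div_normSq, denom_apply, normSq_eq_norm_sq]
  congr 2
  rw [div_div_eq_mul_div]
  rfl

lemma tsum_coprime (u : ℝ) (z : ℍ) :
    ∑' w : gammaSet 1 1 0, ENNReal.ofReal (thTerm u z w) = ∑' γ : SL(2, ℤ), seed u (γ • z) := by
  rw [← (Equiv.sigmaFiberEquiv botRow).tsum_eq, ENNReal.tsum_sigma']
  refine tsum_congr fun w => ?_
  obtain ⟨γ₀, rfl⟩ := exists_botRow w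
  rw [← (fiberEquiv γ₀).tsum_eq]
  have : ∀ n : ℤ, seed u ((Equiv.sigmaFiberEquiv botRow ⟨botRow γ₀, fiberEquiv γ₀ n⟩) • z) = seed u (T ^ n • (γ₀ • z)) := by
    intro n
    rw [← mul_smul]
    rfl
  rw [tsum_congr this, tsum_seed_T_zpow, thTerm_botRow]

lemma thTerm_nsmul (t : ℝ) (z : ℍ) {v : Fin 2 → ℤ} (r : ℕ) : 
    thTerm t z (r • v) = thTerm (r ^ 2 * t) z v := by
  unfold thTerm
  simp only [Pi.smul_apply, nsmul_eq_mul]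
  push_cast
  rw [mul_assoc (r : ℂ), ← mul_add, norm_mul, norm_natCast]
  congr 2
  ring

lemma theta'_eq_tsum (t : ℝ) (z : ℍ) :
    theta' t z = ∑' d : ℕ, ∑' γ : SL(2, ℤ), seed ((d + 1 : ℕ) ^ 2 * t) (γ • z) := by
  have h1 : theta' t z = ∑' v : Fin 2 → ℤ, ({0}ᶜ : Set (Fin 2 → ℤ)).indicator (fun v => ENNReal.ofReal (thTerm t z v)) v := by
    rw [← _root_.tsum_subtype]
    rfl
  rw [h1, ← gammaSetDivGcdSigmaEquiv.symm.tsum_eq, ENNReal.tsum_sigma', tsum_eq_zero_add' ENNReal.summable]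
  have h0 : ∑' v : gammaSet 1 0 0, ({0}ᶜ : Set (Fin 2 → ℤ)).indicator (fun v => ENNReal.ofReal (thTerm t z v)) (gammaSetDivGcdSigmaEquiv.symm ⟨0, v⟩) = 0 := by
    rw [ENNReal.tsum_eq_zero]
    intro v
    apply Set.indicator_of_notMem
    rw [gammaSetDivGcdSigmaEquiv_symm_eq]
    have := gammaSet_eq_gcd_mul_divIntMap v.2
    simp only [Set.mem_compl_iff, Set.mem_singleton_iff, not_not]
    rw [this, zero_smul]
  rw [h0, zero_add]
  refine tsum_congr fun d => ?_
  rw [← tsum_coprime, ← (gammaSetDivGcdEquiv (d + 1)).tsum_eq]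
  refine tsum_congr fun v => ?_
  have hv := gammaSet_eq_gcd_mul_divIntMap v.2
  rw [gammaSetDivGcdSigmaEquiv_symm_eq, gammaSetDivGcdEquiv_eq, ← thTerm_nsmul, ← hv]
  apply Set.indicator_of_mem
  simp only [Set.mem_compl_iff, Set.mem_singleton_iff]
  intro h
  have := ((gammaSet_one_mem_iff _ _).1 v.2)
  rw [h] at this
  simp at this

end
end CuspPrime

namespace CuspPrime
section
open MeasureTheory ModularGroup
open UpperHalfPlane hiding I
open scoped Topology ENNReal MatrixGroups Modular

/-- An invariant function on the upper half plane with rapid decay and prescribed horizontal means. -/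
structure RSData (k : ℝ) (l : ℕ → ℝ) (F : ℍ → ℝ≥0∞) : Prop where
  kpos : 0 < k
  meas : Measurable F
  inv : ∀ (γ : SL(2, ℤ)) z, F (γ • z) = F z
  decay : ∀ N : ℕ, ∃ C : ℝ, 0 ≤ C ∧ ∀ z ∈ fd, F z * ENNReal.ofReal (z.im ^ N) ≤ ENNReal.ofReal C
  zero : l 0 = 0
  mean : ∀ y : ℝ, 0 < y → ∫⁻ x in Set.Ico (0 : ℝ) 1, F (UpperHalfPlane.ofComplex (x + y * I)) =
    ∑' n : ℕ, ENNReal.ofReal (l n ^ 2 * (n : ℝ) ^ (k - 1) * (y ^ k * Real.exp (-(4 * Real.pi * n * y))))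

variable {k : ℝ} {l : ℕ → ℝ} {F : ℍ → ℝ≥0∞}

/-- The integral of `F` over the modular surface. -/
def mass (F : ℍ → ℝ≥0∞) : ℝ≥0∞ := ∫⁻ z, F z * eta z

/-- The integral of `F` against the theta series without constant term. -/
def tail (F : ℍ → ℝ≥0∞) (t : ℝ) : ℝ≥0∞ := ∫⁻ z, F z * theta' t z * eta z

lemma eta_mul_le {a b : ℍ → ℝ≥0∞} (h : ∀ z ∈ fd, a z ≤ b z) (z : ℍ) : a z * eta z ≤ b z * eta z := by
  by_cases hz : z ∈ fd
  · gcongr; exact h z hz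
  · have : eta z = 0 := by
      have := eta_le z
      rw [Set.indicator_of_notMem hz] at this
      exact le_antisymm this bot_le
    simp [this]

lemma RSData.mass_lt_top (D : RSData k l F) : mass F < ⊤ := by
  obtain ⟨C, hC, h⟩ := D.decay 0
  calc mass F ≤ ∫⁻ z, ENNReal.ofReal C * eta z :=
        lintegral_mono (eta_mul_le fun z hz => by simpa using h z hz)
    _ < ⊤ := by
        rw [lintegral_const_mul _ measurable_eta]
        exact ENNReal.mul_lt_top ENNReal.ofReal_lt_top lintegral_eta_lt_top

lemma RSData.tail_le (D : RSData k l F) {N : ℕ} (hN : 2 ≤ N) : ∃ C : ℝ, 0 ≤ C ∧ ∀ t : ℝ, 0 < t →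
    tail F t ≤ ENNReal.ofReal (C * (t ^ N)⁻¹) := by
  obtain ⟨C, hC, h⟩ := D.decay N
  obtain ⟨C', hC', h'⟩ := exists_theta'_le hN
  refine ⟨C * C' * (∫⁻ z, eta z).toReal, by positivity, fun t ht => ?_⟩
  calc tail F t ≤ ∫⁻ z, ENNReal.ofReal (C * C' * (t ^ N)⁻¹) * eta z := by
        refine lintegral_mono (eta_mul_le fun z hz => ?_)
        have hy := z.im_pos
        calc F z * theta' t z ≤ F z * ENNReal.ofReal (C' * (z.im / t) ^ N) := by gcongr; exact h' t ht z hz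
          _ = (F z * ENNReal.ofReal (z.im ^ N)) * ENNReal.ofReal (C' * (t ^ N)⁻¹) := by
              rw [mul_assoc, ← ENNReal.ofReal_mul (by positivity), div_pow]
              congr 2; ring
          _ ≤ ENNReal.ofReal C * ENNReal.ofReal (C' * (t ^ N)⁻¹) := by gcongr; exact h z hz
          _ = _ := by rw [← ENNReal.ofReal_mul hC]; congr 1; ring
    _ = ENNReal.ofReal (C * C' * (t ^ N)⁻¹) * ENNReal.ofReal (∫⁻ z, eta z).toReal := by
        rw [lintegral_const_mul _ measurable_eta, ENNReal.ofReal_toReal lintegral_eta_lt_top.ne]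
    _ = _ := by
        rw [← ENNReal.ofReal_mul (by positivity)]; congr 1; ring

lemma RSData.tail_lt_top (D : RSData k l F) {t : ℝ} (ht : 0 < t) : tail F t < ⊤ := by
  obtain ⟨C, -, h⟩ := D.tail_le le_rfl
  exact (h t ht).trans_lt ENNReal.ofReal_lt_top

lemma measurable_seed_right (t : ℝ) : Measurable (seed t) :=
  measurable_seed.comp (measurable_const.prodMk measurable_id)

lemma RSData.lintegral_theta (D : RSData k l F) (t : ℝ) :
    ∫⁻ z, F z * theta t z * eta z = mass F + tail F t := by
  unfold mass tail
  have hm : Measurable fun z => F z * eta z := D.meas.mul measurable_eta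
  rw [← lintegral_add_left hm]
  refine lintegral_congr fun z => ?_
  rw [theta_eq]
  ring

lemma RSData.feq (D : RSData k l F) {t : ℝ} (ht : 0 < t) :
    mass F + tail F t⁻¹ = ENNReal.ofReal t * (mass F + tail F t) := by
  rw [← D.lintegral_theta, ← D.lintegral_theta, ← lintegral_const_mul' _ _ ENNReal.ofReal_ne_top]
  refine lintegral_congr fun z => ?_
  rw [theta_inv ht]
  ring

lemma theta'_anti (z : ℍ) {s t : ℝ} (hst : s ≤ t) : theta' t z ≤ theta' s z := by
  unfold theta'
  refine ENNReal.tsum_le_tsum fun v => ENNReal.ofReal_le_ofReal ?_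
  unfold thTerm
  have := z.im_pos
  have := Real.pi_pos
  gcongr

lemma tail_anti {s t : ℝ} (hst : s ≤ t) : tail F t ≤ tail F s := by
  unfold tail
  refine lintegral_mono fun z => ?_
  gcongr
  exact theta'_anti z hst

lemma RSData.locallyIntegrableOn (D : RSData k l F) :
    LocallyIntegrableOn (fun t => ((mass F + tail F t).toReal : ℂ)) (Set.Ioi 0) := by
  have hanti : AntitoneOn (fun t => (mass F + tail F t).toReal) (Set.Ioi 0) := by
    intro s hs t ht hst
    refine ENNReal.toReal_mono (ENNReal.add_lt_top.2 ⟨D.mass_lt_top, D.tail_lt_top hs⟩).ne ?_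
    gcongr
    exact tail_anti hst
  rw [locallyIntegrableOn_iff isOpen_Ioi.isLocallyClosed]
  intro K hK hKc
  exact ((hanti.mono hK).integrableOn_isCompact hKc).ofReal

lemma RSData.sub_mass (D : RSData k l F) {t : ℝ} (ht : 0 < t) :
    ((mass F + tail F t).toReal : ℂ) - (mass F).toReal = (tail F t).toReal := by
  rw [ENNReal.toReal_add D.mass_lt_top.ne (D.tail_lt_top ht).ne]
  push_cast
  ring

lemma RSData.isBigO (D : RSData k l F) (r : ℝ) :
    (fun t => ((mass F + tail F t).toReal : ℂ) - (mass F).toReal) =O[atTop] (fun t : ℝ => t ^ r) := by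
  obtain ⟨N, hN⟩ := exists_nat_ge (max 2 (-r))
  have hN2 : 2 ≤ N := by exact_mod_cast (le_max_left _ _).trans hN
  obtain ⟨C, hC, h⟩ := D.tail_le hN2
  refine Asymptotics.IsBigO.of_bound C ?_
  filter_upwards [eventually_ge_atTop 1] with t ht
  have ht0 : 0 < t := by linarith
  rw [D.sub_mass ht0, norm_real, Real.norm_of_nonneg ENNReal.toReal_nonneg,
    Real.norm_of_nonneg (Real.rpow_nonneg ht0.le _)]
  calc (tail F t).toReal ≤ C * (t ^ N)⁻¹ := by
        refine ENNReal.toReal_le_of_le_ofReal (by positivity) (h t ht0)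
    _ ≤ C * t ^ r := by
        gcongr
        rw [← Real.rpow_natCast, ← Real.rpow_neg ht0.le]
        exact Real.rpow_le_rpow_of_exponent_le ht (by linarith [(le_max_right _ _).trans hN])

/-- The functional-equation pair attached to `F`. -/
def RSData.pair (D : RSData k l F) : WeakFEPair ℂ where
  f t := ((mass F + tail F t).toReal : ℂ)
  g t := ((mass F + tail F t).toReal : ℂ)
  k := 1
  ε := 1
  f₀ := ((mass F).toReal : ℂ)
  g₀ := ((mass F).toReal : ℂ)
  hf_int := D.locallyIntegrableOn
  hg_int := D.locallyIntegrableOn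
  hk := one_pos
  hε := one_ne_zero
  h_feq := by
    intro x hx
    rw [one_div, D.feq hx, ENNReal.toReal_mul, ENNReal.toReal_ofReal (le_of_lt hx)]
    simp
  hf_top := D.isBigO
  hg_top := D.isBigO
end
end CuspPrime

namespace CuspPrime
section
open MeasureTheory ModularGroup
open UpperHalfPlane hiding I
open scoped Topology ENNReal MatrixGroups Modular

variable {k : ℝ} {l : ℕ → ℝ} {F : ℍ → ℝ≥0∞}

lemma lintegral_rpow_mul_exp {a r : ℝ} (ha : 0 < a) (hr : 0 < r) :
    ∫⁻ t in Set.Ioi (0 : ℝ), ENNReal.ofReal (t ^ (a - 1) * Real.exp (-(r * t))) =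
      ENNReal.ofReal ((1 / r) ^ a * Real.Gamma a) := by
  have key := Real.integral_rpow_mul_exp_neg_mul_Ioi ha hr
  have hpos : 0 < (1 / r) ^ a * Real.Gamma a := mul_pos (by positivity) (Real.Gamma_pos_of_pos ha)
  have hintg : IntegrableOn (fun t : ℝ => t ^ (a - 1) * Real.exp (-(r * t))) (Set.Ioi 0) :=
    .of_integral_ne_zero (by rw [key]; exact hpos.ne')
  rw [← key, ofReal_integral_eq_lintegral_ofReal hintg]
  rw [EventuallyLE, ae_restrict_iff' measurableSet_Ioi]
  refine ae_of_all _ fun t (ht : 0 < t) => ?_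
  simp only [Pi.zero_apply]
  positivity

lemma RSData.lintegral_seed (D : RSData k l F) (u : ℝ) :
    ∫⁻ z, F z * seed u z = ∫⁻ y in Set.Ioi (0 : ℝ),
      ∑' n : ℕ, ENNReal.ofReal ((l n ^ 2 * (n : ℝ) ^ (k - 1)) * (y ^ (k - 2) * Real.exp (-(4 * Real.pi * n * y))) *
        Real.exp (-(Real.pi * u / y))) := by
  have hm : Measurable fun z => F z * seed u z := D.meas.mul (measurable_seed_right u)
  rw [lintegral_uhp hm]
  refine setLIntegral_congr_fun measurableSet_Ioi fun y (hy : 0 < y) => ?_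
  have hco : ∀ x : ℝ, ((UpperHalfPlane.ofComplex (x + y * I) : ℍ) : ℂ) = x + y * I := fun x => by
    rw [UpperHalfPlane.ofComplex_apply_of_im_pos (show 0 < ((x : ℂ) + y * I).im by simpa using hy)]
  have hs : ∀ x : ℝ, F (UpperHalfPlane.ofComplex (x + y * I)) * seed u (UpperHalfPlane.ofComplex (x + y * I)) *
      ENNReal.ofReal (1 / y ^ 2) = (Set.Ico (0 : ℝ) 1).indicator (fun x : ℝ =>
        F (UpperHalfPlane.ofComplex (x + y * I))) x * ENNReal.ofReal (Real.exp (-(Real.pi * u / y)) / y ^ 2) := by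
    intro x
    have hre : (UpperHalfPlane.ofComplex (x + y * I) : ℍ).re = x := by
      rw [← UpperHalfPlane.coe_re, hco]; simp
    have him : (UpperHalfPlane.ofComplex (x + y * I) : ℍ).im = y := by
      rw [← UpperHalfPlane.coe_im, hco]; simp
    unfold seed
    by_cases hx : 0 ≤ x ∧ x < 1
    · rw [Set.indicator_of_mem (by simpa [hre] using hx), Set.indicator_of_mem (by simpa using hx), him,
        mul_assoc, ← ENNReal.ofReal_mul (by positivity)]
      congr 2; ring
    · rw [Set.indicator_of_notMem (by simpa [hre] using hx), Set.indicator_of_notMem (by simpa using hx)]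
      simp
  simp_rw [hs]
  rw [lintegral_mul_const' _ _ ENNReal.ofReal_ne_top, lintegral_indicator measurableSet_Ico, D.mean y hy,
    ← ENNReal.tsum_mul_right]
  refine tsum_congr fun n => ?_
  rw [← ENNReal.ofReal_mul (by positivity)]
  congr 1
  rw [Real.rpow_sub hy, Real.rpow_two]
  ring

lemma RSData.tail_eq (D : RSData k l F) (t : ℝ) :
    tail F t = ∑' d : ℕ, ∫⁻ y in Set.Ioi (0 : ℝ),
      ∑' n : ℕ, ENNReal.ofReal ((l n ^ 2 * (n : ℝ) ^ (k - 1)) * (y ^ (k - 2) * Real.exp (-(4 * Real.pi * n * y))) *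
        Real.exp (-(Real.pi * ((d + 1 : ℕ) ^ 2 * t) / y))) := by
  unfold tail
  simp_rw [theta'_eq_tsum, ← D.lintegral_seed]
  have h : ∀ d : ℕ, ∫⁻ z, F z * seed ((d + 1 : ℕ) ^ 2 * t) z =
      ∫⁻ z, F z * (∑' γ : SL(2, ℤ), seed ((d + 1 : ℕ) ^ 2 * t) (γ • z)) * eta z := fun d =>
    (lintegral_unfold D.meas (measurable_seed_right _) D.inv).symm
  simp_rw [h]
  rw [← lintegral_tsum]
  · refine lintegral_congr fun z => ?_
    rw [← ENNReal.tsum_mul_left, ← ENNReal.tsum_mul_right]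
  · intro d
    refine Measurable.aemeasurable ?_
    refine (D.meas.mul (Measurable.tsum fun γ => ?_)).mul measurable_eta
    exact (measurable_seed_right _).comp (measurable_sl_smul γ)

lemma lintegral_double {a b q r : ℝ} (ha : 0 < a) (hb : 0 < b) (hq : 0 < q) (hr : 0 < r) :
    ∫⁻ t in Set.Ioi (0 : ℝ), ∫⁻ y in Set.Ioi (0 : ℝ),
      ENNReal.ofReal (t ^ (a - 1) * (y ^ (b - a - 1) * Real.exp (-(q * y)) * Real.exp (-(r * t / y)))) =
    ENNReal.ofReal ((1 / r) ^ a * Real.Gamma a * ((1 / q) ^ b * Real.Gamma b)) := by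
  have hm : Measurable fun p : ℝ × ℝ => ENNReal.ofReal (p.1 ^ (a - 1) * (p.2 ^ (b - a - 1) * Real.exp (-(q * p.2)) *
      Real.exp (-(r * p.1 / p.2)))) := by fun_prop
  rw [lintegral_lintegral_swap hm.aemeasurable]
  have h : ∀ y ∈ Set.Ioi (0 : ℝ), ∫⁻ t in Set.Ioi (0 : ℝ), ENNReal.ofReal (t ^ (a - 1) * (y ^ (b - a - 1) * Real.exp (-(q * y)) *
      Real.exp (-(r * t / y)))) = ENNReal.ofReal ((1 / r) ^ a * Real.Gamma a) * ENNReal.ofReal (y ^ (b - 1) * Real.exp (-(q * y))) := by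
    intro y hy
    have hy' : 0 < y := hy
    have hG := Real.Gamma_pos_of_pos ha
    have : ∀ t : ℝ, ENNReal.ofReal (t ^ (a - 1) * (y ^ (b - a - 1) * Real.exp (-(q * y)) *
      Real.exp (-(r * t / y)))) = ENNReal.ofReal (y ^ (b - a - 1) * Real.exp (-(q * y))) *
        ENNReal.ofReal (t ^ (a - 1) * Real.exp (-((r / y) * t))) := by
      intro t
      rw [← ENNReal.ofReal_mul (by positivity)]
      congr 1
      rw [show r * t / y = r / y * t by ring]
      ring
    simp_rw [this]
    rw [lintegral_const_mul' _ _ ENNReal.ofReal_ne_top, lintegral_rpow_mul_exp ha (by positivity),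
      ← ENNReal.ofReal_mul (by positivity), ← ENNReal.ofReal_mul (by positivity)]
    congr 1
    have e : y ^ (b - 1) = y ^ (b - a - 1) * y ^ a := by
      rw [← Real.rpow_add hy']; congr 1; ring
    rw [e, show 1 / (r / y) = 1 / r * y by field_simp, Real.mul_rpow (by positivity) hy'.le]
    ring
  rw [setLIntegral_congr_fun measurableSet_Ioi h, lintegral_const_mul' _ _ ENNReal.ofReal_ne_top, lintegral_rpow_mul_exp hb hq,
    ← ENNReal.ofReal_mul (mul_nonneg (by positivity) (Real.Gamma_pos_of_pos ha).le)]

/-- The archimedean factor at a real point. -/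
def archR (k σ : ℝ) : ℝ :=
  (1 / Real.pi) ^ σ * Real.Gamma σ * ((1 / (4 * Real.pi)) ^ (σ + k - 1) * Real.Gamma (σ + k - 1))

lemma RSData.lintegral_tail (D : RSData k l F) {σ : ℝ} (hσ : 1 < σ) :
    ∫⁻ t in Set.Ioi (0 : ℝ), ENNReal.ofReal (t ^ (σ - 1)) * tail F t =
      ENNReal.ofReal (archR k σ) * ((∑' n : ℕ, ENNReal.ofReal (l n ^ 2 * (n : ℝ) ^ (-σ))) *
        ∑' d : ℕ, ENNReal.ofReal (((d + 1 : ℕ) ^ 2 : ℝ) ^ (-σ))) := by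
  have hk := D.kpos
  have hpi := Real.pi_pos
  have h0 : ∀ t ∈ Set.Ioi (0 : ℝ), ENNReal.ofReal (t ^ (σ - 1)) * tail F t =
      ∑' d : ℕ, ∑' n : ℕ, ENNReal.ofReal (l n ^ 2 * (n : ℝ) ^ (k - 1)) * ∫⁻ y in Set.Ioi (0 : ℝ),
        ENNReal.ofReal (t ^ (σ - 1) * (y ^ ((σ + k - 1) - σ - 1) * Real.exp (-((4 * Real.pi * n) * y)) *
          Real.exp (-((Real.pi * (d + 1 : ℕ) ^ 2) * t / y)))) := by
    intro t ht
    have ht' : 0 < t := ht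
    rw [D.tail_eq, ← ENNReal.tsum_mul_left]
    refine tsum_congr fun d => ?_
    rw [lintegral_tsum (fun n => by fun_prop), ← ENNReal.tsum_mul_left]
    refine tsum_congr fun n => ?_
    rw [← lintegral_const_mul' _ _ ENNReal.ofReal_ne_top, ← lintegral_const_mul' _ _ ENNReal.ofReal_ne_top]
    refine setLIntegral_congr_fun measurableSet_Ioi fun y (hy : 0 < y) => ?_
    rw [← ENNReal.ofReal_mul (by positivity), ← ENNReal.ofReal_mul (by positivity)]
    congr 1
    rw [show σ + k - 1 - σ - 1 = k - 2 by ring, ← mul_assoc Real.pi]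
    ring
  rw [setLIntegral_congr_fun measurableSet_Ioi h0]
  have hmeas : ∀ d n : ℕ, Measurable fun t : ℝ => ENNReal.ofReal (l n ^ 2 * (n : ℝ) ^ (k - 1)) * ∫⁻ y in Set.Ioi (0 : ℝ),
        ENNReal.ofReal (t ^ (σ - 1) * (y ^ ((σ + k - 1) - σ - 1) * Real.exp (-((4 * Real.pi * n) * y)) *
          Real.exp (-((Real.pi * (d + 1 : ℕ) ^ 2) * t / y)))) := by
    intro d n
    refine Measurable.const_mul ?_ _
    refine Measurable.lintegral_prod_right' (f := fun p : ℝ × ℝ => ENNReal.ofReal (p.1 ^ (σ - 1) *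
      (p.2 ^ ((σ + k - 1) - σ - 1) * Real.exp (-((4 * Real.pi * n) * p.2)) *
          Real.exp (-((Real.pi * (d + 1 : ℕ) ^ 2) * p.1 / p.2))))) ?_
    fun_prop
  rw [lintegral_tsum (fun d => (Measurable.tsum fun n => hmeas d n).aemeasurable),
    ← ENNReal.tsum_mul_left, ← ENNReal.tsum_mul_left]
  refine tsum_congr fun d => ?_
  rw [lintegral_tsum (fun n => (hmeas d n).aemeasurable), mul_comm (∑' n : ℕ, _), ← ENNReal.tsum_mul_left,
    ← ENNReal.tsum_mul_left]
  refine tsum_congr fun n => ?_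
  rw [lintegral_const_mul' _ _ ENNReal.ofReal_ne_top]
  rcases Nat.eq_zero_or_pos n with rfl | hn
  · simp [D.zero]
  have hn' : (0 : ℝ) < n := by exact_mod_cast hn
  rw [lintegral_double (by linarith) (by linarith) (by positivity) (by positivity), ← ENNReal.ofReal_mul (by positivity),
    ← ENNReal.ofReal_mul (by positivity), ← ENNReal.ofReal_mul]
  · congr 1
    unfold archR
    have e1 : (1 / (Real.pi * ((d + 1 : ℕ) : ℝ) ^ 2)) ^ σ = (1 / Real.pi) ^ σ * (((d + 1 : ℕ) : ℝ) ^ 2) ^ (-σ) := by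
      rw [← div_div, Real.div_rpow (by positivity) (by positivity), Real.rpow_neg (by positivity)]
      rfl
    have e2 : (1 / (4 * Real.pi * n)) ^ (σ + k - 1) = (1 / (4 * Real.pi)) ^ (σ + k - 1) * ((n : ℝ) ^ (-σ) * ((n : ℝ) ^ (k - 1))⁻¹) := by
      rw [← div_div, Real.div_rpow (by positivity) (by positivity), ← Real.rpow_neg (by positivity),
        ← Real.rpow_add hn', div_eq_mul_inv, ← Real.rpow_neg (by positivity)]
      congr 2; ring
    rw [e1, e2]
    have : (n : ℝ) ^ (k - 1) ≠ 0 := (Real.rpow_pos_of_pos hn' _).ne'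
    field_simp
  · have := Real.Gamma_pos_of_pos (show 0 < σ by linarith)
    have := Real.Gamma_pos_of_pos (show 0 < σ + k - 1 by linarith)
    unfold archR
    positivity
end
end CuspPrime

namespace CuspPrime
section
open MeasureTheory ModularGroup ArithmeticFunction
open UpperHalfPlane hiding I
open scoped Topology ENNReal MatrixGroups Modular

variable {k : ℝ} {l : ℕ → ℝ} {F : ℍ → ℝ≥0∞}

lemma archR_pos (hk : 0 < k) {σ : ℝ} (hσ : 1 < σ) : 0 < archR k σ := by
  have := Real.pi_pos
  have := Real.Gamma_pos_of_pos (show 0 < σ by linarith)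
  have := Real.Gamma_pos_of_pos (show 0 < σ + k - 1 by linarith)
  unfold archR
  positivity

lemma RSData.mellin_tail (D : RSData k l F) {σ : ℝ} (hσ : 1 < σ) :
    ∫⁻ t in Set.Ioi (0 : ℝ), ENNReal.ofReal (t ^ (σ - 1)) * tail F t < ⊤ ∧
    D.pair.Λ σ = ((∫⁻ t in Set.Ioi (0 : ℝ), ENNReal.ofReal (t ^ (σ - 1)) * tail F t).toReal : ℂ) := by
  obtain ⟨h1, h2⟩ := D.pair.hasMellin (s := (σ : ℂ)) (by simpa [RSData.pair] using hσ)
  have he : ∀ t ∈ Set.Ioi (0 : ℝ), (t : ℂ) ^ ((σ : ℂ) - 1) • (D.pair.f t - D.pair.f₀) =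
      ((t ^ (σ - 1) * (tail F t).toReal : ℝ) : ℂ) := by
    intro t ht
    have ht' : 0 < t := ht
    simp only [RSData.pair]
    rw [D.sub_mass ht', smul_eq_mul, ofReal_mul, ofReal_cpow ht'.le]
    push_cast
    rfl
  have h3 : IntegrableOn (fun t => t ^ (σ - 1) * (tail F t).toReal) (Set.Ioi 0) := by
    have := (integrableOn_congr_fun he measurableSet_Ioi).1 h1
    exact_mod_cast this.re
  have hnn : 0 ≤ᵐ[volume.restrict (Set.Ioi 0)] fun t => t ^ (σ - 1) * (tail F t).toReal := by
    rw [EventuallyLE, ae_restrict_iff' measurableSet_Ioi]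
    refine ae_of_all _ fun t (ht : 0 < t) => ?_
    simp only [Pi.zero_apply]
    positivity
  have h4 : ∫⁻ t in Set.Ioi (0 : ℝ), ENNReal.ofReal (t ^ (σ - 1) * (tail F t).toReal) =
      ∫⁻ t in Set.Ioi (0 : ℝ), ENNReal.ofReal (t ^ (σ - 1)) * tail F t := by
    refine setLIntegral_congr_fun measurableSet_Ioi fun t (ht : 0 < t) => ?_
    rw [ENNReal.ofReal_mul (by positivity), ENNReal.ofReal_toReal (D.tail_lt_top ht).ne]
  constructor
  · rw [← h4]
    exact ((hasFiniteIntegral_iff_ofReal hnn).1 h3.2)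
  · rw [← h2, mellin, setIntegral_congr_fun measurableSet_Ioi he, integral_complex_ofReal,
      integral_eq_lintegral_of_nonneg_ae hnn h3.1, h4]

lemma term_toAF_sq {σ : ℝ} (n : ℕ) (h0 : l 0 = 0) :
    LSeries.term (toAF fun n => l n * l n) σ n = ((l n ^ 2 * (n : ℝ) ^ (-σ) : ℝ) : ℂ) := by
  rcases eq_or_ne n 0 with rfl | hn
  · simp [h0]
  have hn' : (0 : ℝ) < n := by exact_mod_cast Nat.pos_of_ne_zero hn
  rw [LSeries.term_of_ne_zero hn, toAF_apply hn, Real.rpow_neg hn'.le]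
  push_cast [ofReal_cpow hn'.le]
  rw [div_eq_mul_inv]
  ring

lemma lseriesSummable_sqInd {s : ℂ} (hs : 1 < s.re) : LSeriesSummable sqInd s := by
  refine LSeriesSummable_of_bounded_of_one_lt_re (m := 1) (fun n _ => ?_) hs
  rw [sqInd_apply]
  split_ifs <;> simp

lemma summable_sq_rpow {σ : ℝ} (hσ : 1 < σ) : Summable fun d : ℕ => (((d + 1 : ℕ) : ℝ) ^ 2) ^ (-σ) := by
  have h := (summable_nat_add_iff 1).2 (Real.summable_nat_rpow.2 (show -(2 * σ) < -1 by linarith))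
  refine h.congr fun d => ?_
  rw [← Real.rpow_two, ← Real.rpow_mul (by positivity)]
  congr 1; ring

lemma lseries_sqInd {σ : ℝ} :
    LSeries sqInd σ = ((∑' d : ℕ, (((d + 1 : ℕ) : ℝ) ^ 2) ^ (-σ) : ℝ) : ℂ) := by
  have hinj : Function.Injective fun d : ℕ => (d + 1) ^ 2 := by
    intro a b h
    have := Nat.pow_left_injective (n := 2) (by norm_num) h
    omega
  have hsupp : Function.support (LSeries.term sqInd (σ : ℂ)) ⊆ Set.range fun d : ℕ => (d + 1) ^ 2 := by
    intro n hn
    rcases eq_or_ne n 0 with rfl | hn0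
    · simp at hn
    rw [Function.mem_support, LSeries.term_of_ne_zero hn0, sqInd_apply] at hn
    have : IsSquare n := by
      by_contra h
      simp [h] at hn
    obtain ⟨r, rfl⟩ := this
    have : r ≠ 0 := by rintro rfl; simp at hn0
    exact ⟨r - 1, by simp only; rw [Nat.sub_add_cancel (by omega)]; ring⟩
  rw [LSeries, ← hinj.tsum_eq hsupp, ofReal_tsum]
  refine tsum_congr fun d => ?_
  have hd : (d + 1) ^ 2 ≠ 0 := by positivity
  have hsq : IsSquare ((d + 1) ^ 2) := ⟨d + 1, by ring⟩
  rw [LSeries.term_of_ne_zero hd, sqInd_apply, if_pos ⟨hd, hsq⟩, Real.rpow_neg (by positivity), ofReal_inv,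
    ofReal_cpow (by positivity)]
  push_cast
  rw [one_div]

lemma RSData.summable_sq (D : RSData k l F) {σ : ℝ} (hσ : 1 < σ) :
    Summable (fun n : ℕ => l n ^ 2 * (n : ℝ) ^ (-σ)) ∧
    (archR k σ : ℂ) * (((∑' n : ℕ, l n ^ 2 * (n : ℝ) ^ (-σ) : ℝ) : ℂ) * LSeries sqInd σ) = D.pair.Λ σ := by
  obtain ⟨h1, h2⟩ := D.mellin_tail hσ
  have ha := archR_pos D.kpos hσ
  rw [D.lintegral_tail hσ] at h1 h2
  have hS := summable_sq_rpow hσ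
  have hS0 : 0 < ∑' d : ℕ, (((d + 1 : ℕ) : ℝ) ^ 2) ^ (-σ) :=
    hS.tsum_pos (fun d => by positivity) 0 (by simp)
  rw [← ENNReal.ofReal_tsum_of_nonneg (fun d => by positivity) hS] at h1 h2
  have hfin : ∑' n : ℕ, ENNReal.ofReal (l n ^ 2 * (n : ℝ) ^ (-σ)) ≠ ⊤ := by
    intro h
    rw [h, ENNReal.top_mul (by simpa using hS0), ENNReal.mul_top (by simpa using ha)] at h1
    exact lt_irrefl _ h1
  have hsum : Summable (fun n : ℕ => l n ^ 2 * (n : ℝ) ^ (-σ)) := by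
    have := ENNReal.summable_toReal hfin
    refine this.congr fun n => ENNReal.toReal_ofReal (by positivity)
  refine ⟨hsum, ?_⟩
  rw [h2, ← ENNReal.ofReal_tsum_of_nonneg (fun d => by positivity) hsum, ← ENNReal.ofReal_mul (tsum_nonneg fun n => by positivity),
    ← ENNReal.ofReal_mul ha.le, ENNReal.toReal_ofReal (mul_nonneg ha.le (mul_nonneg (tsum_nonneg fun n => by positivity) hS0.le)),
    lseries_sqInd]
  push_cast
  rfl

lemma RSData.lseriesSummable_toAF (D : RSData k l F) {s : ℂ} (hs : 1 < s.re) :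
    LSeriesSummable (toAF fun n => l n * l n) s := by
  refine LSeriesSummable.of_re_le_re (s := (s.re : ℂ)) (by simp) ?_
  rw [LSeriesSummable]
  refine (summable_ofReal.2 (D.summable_sq hs).1).congr fun n => ?_
  exact (term_toAF_sq n D.zero).symm

lemma RSData.lseriesSummable (D : RSData k l F) {s : ℂ} (hs : 1 < s.re) : LSeriesSummable (rsCoef l l) s :=
  LSeriesSummable_mul (D.lseriesSummable_toAF hs) (lseriesSummable_sqInd hs)

lemma RSData.lseries_real (D : RSData k l F) {σ : ℝ} (hσ : 1 < σ) :
    (archR k σ : ℂ) * LSeries (rsCoef l l) σ = D.pair.Λ σ := by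
  have hs : 1 < (σ : ℂ).re := by simpa using hσ
  rw [← (D.summable_sq hσ).2, rsCoef, LSeries_mul' (D.lseriesSummable_toAF hs) (lseriesSummable_sqInd hs)]
  congr 2
  rw [LSeries, ofReal_tsum]
  exact tsum_congr fun n => term_toAF_sq n D.zero

/-- The inverse of the archimedean factor without the first Gamma function. -/
def archI (k : ℝ) (s : ℂ) : ℂ :=
  (Gamma (s + k - 1))⁻¹ * ((Real.pi : ℂ) ^ s * (4 * Real.pi : ℂ) ^ (s + k - 1))

lemma differentiable_archI (k : ℝ) : Differentiable ℂ (archI k) := by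
  have hpi : (Real.pi : ℂ) ≠ 0 := by exact_mod_cast Real.pi_ne_zero
  unfold archI
  refine (differentiable_one_div_Gamma.comp (by fun_prop : Differentiable ℂ fun s : ℂ => s + k - 1)).mul
    (Differentiable.mul ?_ ?_)
  · exact fun s => (differentiableAt_id).const_cpow (Or.inl hpi)
  · exact fun s => (by fun_prop : DifferentiableAt ℂ (fun s : ℂ => s + k - 1) s).const_cpow (Or.inl (by simp [hpi]))

lemma archR_inv (k σ : ℝ) :
    (archR k σ : ℂ)⁻¹ = (Gamma (σ : ℂ))⁻¹ * archI k σ := by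
  have hpi := Real.pi_pos
  have e : archI k σ = (((Real.Gamma (σ + k - 1))⁻¹ * (Real.pi ^ σ * (4 * Real.pi) ^ (σ + k - 1)) : ℝ) : ℂ) := by
    unfold archI
    rw [ofReal_mul, ofReal_inv, ← Gamma_ofReal, ofReal_mul, ofReal_cpow hpi.le, ofReal_cpow (by positivity)]
    push_cast
    rfl
  rw [e, Gamma_ofReal]
  norm_cast
  unfold archR
  rw [one_div, one_div, Real.inv_rpow hpi.le, Real.inv_rpow (by positivity)]
  simp only [mul_inv, inv_inv]
  ring

/-- The continuation of `(s - 1) L(s)`. -/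
def RSData.cont (D : RSData k l F) (s : ℂ) : ℂ :=
  ((s - 1) * D.pair.Λ₀ s + (mass F).toReal) * ((Gamma s)⁻¹ * archI k s) -
    (s - 1) * (mass F).toReal * ((Gamma (s + 1))⁻¹ * archI k s)

lemma RSData.differentiable_cont (D : RSData k l F) : Differentiable ℂ D.cont := by
  have h1 := D.pair.differentiable_Λ₀
  have h2 := differentiable_archI k
  have h3 := differentiable_one_div_Gamma
  have h4 : Differentiable ℂ fun s : ℂ => (Gamma (s + 1))⁻¹ :=
    h3.comp (by fun_prop : Differentiable ℂ fun s : ℂ => s + 1)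
  unfold RSData.cont
  fun_prop

lemma RSData.cont_neg_one (D : RSData k l F) : D.cont (-1) = 0 := by
  have h1 : Gamma (-1) = 0 := by simpa using Gamma_neg_nat_eq_zero 1
  simp [RSData.cont, h1, Gamma_zero]

/-- The proportionality constant in the residue. -/
def resConst (k : ℝ) : ℝ := (Real.Gamma k)⁻¹ * (Real.pi * (4 * Real.pi) ^ k)

lemma resConst_pos (hk : 0 < k) : 0 < resConst k := by
  have := Real.pi_pos
  have := Real.Gamma_pos_of_pos hk
  unfold resConst
  positivity

lemma RSData.cont_one (D : RSData k l F) : D.cont 1 = ((resConst k * (mass F).toReal : ℝ) : ℂ) := by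
  have hpi := Real.pi_pos
  have : archI k 1 = (resConst k : ℂ) := by
    unfold archI resConst
    rw [show (1 : ℂ) + k - 1 = k by ring, ofReal_mul, ofReal_inv, ← Gamma_ofReal, ofReal_mul, ofReal_cpow (by positivity)]
    simp
  simp only [RSData.cont, sub_self, zero_mul, zero_add, sub_zero, Gamma_one, inv_one, one_mul, this]
  push_cast
  ring

lemma RSData.cont_real (D : RSData k l F) {σ : ℝ} (hσ : 1 < σ) :
    ((σ : ℂ) - 1) * LSeries (rsCoef l l) σ = D.cont σ := by
  have ha : (archR k σ : ℂ) ≠ 0 := by exact_mod_cast (archR_pos D.kpos hσ).ne'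
  have h := D.lseries_real hσ
  have h1 : (σ : ℂ) ≠ 0 := by exact_mod_cast (by linarith : σ ≠ 0)
  have h2 : (1 : ℂ) - σ ≠ 0 := by exact_mod_cast (by linarith : 1 - σ ≠ 0)
  have hL : LSeries (rsCoef l l) σ = D.pair.Λ σ * ((Gamma (σ : ℂ))⁻¹ * archI k σ) := by
    rw [← h, ← archR_inv]
    field_simp
  rw [hL, RSData.cont, WeakFEPair.Λ, Gamma_add_one _ h1]
  simp only [RSData.pair, smul_eq_mul, ofReal_one]
  field_simp
  ring

lemma RSData.cont_eq (D : RSData k l F) {s : ℂ} (hs : 1 < s.re) :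
    (s - 1) * LSeries (rsCoef l l) s = D.cont s := by
  have hU : IsOpen {s : ℂ | 1 < s.re} := isOpen_lt continuous_const continuous_re
  have hd : DifferentiableOn ℂ (LSeries (rsCoef l l)) {s : ℂ | 1 < s.re} := by
    refine (LSeries_differentiableOn _).mono fun s (hs : 1 < s.re) => ?_
    exact abscissa_lt (fun _ h => D.lseriesSummable h) hs
  refine AnalyticOnNhd.eqOn_of_preconnected_of_frequently_eq (𝕜 := ℂ) (U := {s : ℂ | 1 < s.re})
    (f := fun s => (s - 1) * LSeries (rsCoef l l) s) (g := D.cont) (z₀ := 2) ?_ ?_ ?_ ?_ ?_ hs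
  · exact ((by fun_prop : Differentiable ℂ fun s : ℂ => s - 1).differentiableOn.mul hd).analyticOnNhd hU
  · exact D.differentiable_cont.differentiableOn.analyticOnNhd hU
  · exact (convex_halfSpace_re_gt 1).isPreconnected
  · simp
  · have ht : Tendsto (fun n : ℕ => ((2 + 1 / ((n : ℝ) + 1) : ℝ) : ℂ)) atTop (𝓝[≠] 2) := by
      rw [tendsto_nhdsWithin_iff]
      constructor
      · have := (tendsto_one_div_add_atTop_nhds_zero_nat (𝕜 := ℝ)).const_add 2
        have := (continuous_ofReal.tendsto _).comp this
        rw [add_zero] at this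
        exact_mod_cast this
      · refine Eventually.of_forall fun n => ?_
        have : (0 : ℝ) < 1 / ((n : ℝ) + 1) := by positivity
        simp only [Set.mem_compl_iff, Set.mem_singleton_iff]
        intro h
        have h' : (2 + 1 / ((n : ℝ) + 1) : ℝ) = 2 := by exact_mod_cast h
        linarith
    refine ht.frequently (Eventually.frequently (Eventually.of_forall fun n => ?_))
    have : (0 : ℝ) < 1 / ((n : ℝ) + 1) := by positivity
    exact D.cont_real (by linarith)
end
end CuspPrime

namespace CuspPrime
section
open MeasureTheory ModularGroup ArithmeticFunction
open UpperHalfPlane hiding I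
open scoped Topology ENNReal MatrixGroups Modular

variable {k : ℝ}

lemma rsCoef_polarize (l l' : ℕ → ℝ) (n : ℕ) : rsCoef l l' n =
    (1 / 4 : ℂ) * rsCoef (l + l') (l + l') n - (1 / 4 : ℂ) * rsCoef (l - l') (l - l') n := by
  unfold rsCoef
  simp only [ArithmeticFunction.mul_apply, Finset.mul_sum, ← Finset.sum_sub_distrib]
  refine Finset.sum_congr rfl fun x _ => ?_
  rcases eq_or_ne x.1 0 with h | h
  · simp [h]
  · simp only [toAF_apply h, Pi.add_apply, Pi.sub_apply]
    push_cast
    ring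

/-- Rankin–Selberg data for sums and differences assemble into a Rankin–Selberg family. -/
theorem RSFamily.of_data {ι : Type} {l : ι → ℕ → ℝ} (hl : ∀ i, HeckeRel (l i)) {P Q : ι → ι → ℍ → ℝ≥0∞}
    (hP : ∀ i j, RSData k (l i + l j) (P i j)) (hQ : ∀ i j, RSData k (l i - l j) (Q i j))
    (hd : ∀ i, (mass (P i i)).toReal ≠ (mass (Q i i)).toReal)
    (ho : ∀ i j, i ≠ j → (mass (P i j)).toReal = (mass (Q i j)).toReal) :
    RSFamily l (fun i j s => (1 / 4 : ℂ) * (hP i j).cont s - (1 / 4 : ℂ) * (hQ i j).cont s) := by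
  have hfun : ∀ i j, (rsCoef (l i) (l j) : ℕ → ℂ) = (1 / 4 : ℂ) • (rsCoef (l i + l j) (l i + l j) : ℕ → ℂ) -
      (1 / 4 : ℂ) • (rsCoef (l i - l j) (l i - l j) : ℕ → ℂ) := fun i j => by
    ext n; exact rsCoef_polarize _ _ n
  have h1 : ∀ i j (s : ℂ), 1 < s.re → LSeriesSummable ((1 / 4 : ℂ) • (rsCoef (l i + l j) (l i + l j) : ℕ → ℂ)) s :=
    fun i j s hs => ((hP i j).lseriesSummable hs).smul _
  have h2 : ∀ i j (s : ℂ), 1 < s.re → LSeriesSummable ((1 / 4 : ℂ) • (rsCoef (l i - l j) (l i - l j) : ℕ → ℂ)) s :=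
    fun i j s hs => ((hQ i j).lseriesSummable hs).smul _
  refine ⟨hl, fun i j s hs => ?_, fun i j => ?_, fun i j s hs => ?_, fun i => ?_, fun i => ?_, fun i j hij => ?_⟩
  · rw [hfun]
    exact (h1 i j s hs).sub (h2 i j s hs)
  · exact ((hP i j).differentiable_cont.const_mul _).sub ((hQ i j).differentiable_cont.const_mul _)
  · rw [hfun, LSeries_sub (h1 i j s hs) (h2 i j s hs), LSeries_smul, LSeries_smul, ← (hP i j).cont_eq hs, ← (hQ i j).cont_eq hs]
    ring
  · simp [RSData.cont_neg_one]
  · have hk := (hP i i).kpos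
    refine ⟨resConst k * ((mass (P i i)).toReal - (mass (Q i i)).toReal) / 4, ?_, ?_⟩
    · exact div_ne_zero (mul_ne_zero (resConst_pos hk).ne' (sub_ne_zero.2 (hd i))) (by norm_num)
    · simp only [RSData.cont_one]
      push_cast
      ring
  · simp [RSData.cont_one, ho i j hij]
end
end CuspPrime

namespace CuspPrime
section
open MeasureTheory ModularGroup
open UpperHalfPlane hiding I
open scoped Topology ENNReal MatrixGroups Modular ComplexConjugate

variable {k : ℤ}

/-- The Fourier coefficients of a level one cusp form. -/
def coef (h : CuspForm 𝒮ℒ k) (n : ℕ) : ℂ := (qExpansion 1 h).coeff n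

lemma qParam_one (z : ℂ) : Function.Periodic.qParam 1 z = Complex.exp (2 * Real.pi * I * z) := by
  simp [Function.Periodic.qParam]

lemma hasSum_coef (h : CuspForm 𝒮ℒ k) (τ : ℍ) :
    HasSum (fun n => coef h n * Complex.exp (2 * Real.pi * I * τ) ^ n) (h τ) := by
  have := ModularForm.hasSum_qExpansion (f := h) (Γ := 𝒮ℒ) one_pos one_mem_strictPeriods_SL τ
  simp only [qParam_one] at this
  exact this

lemma coef_unique {h : CuspForm 𝒮ℒ k} {c : ℕ → ℂ}
    (hc : ∀ τ : ℍ, HasSum (fun n => c n * Complex.exp (2 * Real.pi * I * τ) ^ n) (h τ)) (n : ℕ) :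
    coef h n = c n := by
  refine (ModularFormClass.qExpansion_coeff_unique (f := h) (Γ := 𝒮ℒ) one_pos
    one_mem_strictPeriods_SL (c := c) (fun τ => ?_) n).symm
  simpa only [qParam_one, smul_eq_mul] using hc τ

lemma coef_zero (h : CuspForm 𝒮ℒ k) : coef h 0 = 0 :=
  CuspFormClass.qExpansion_coeff_zero h one_pos one_mem_strictPeriods_SL

lemma coef_add (g h : CuspForm 𝒮ℒ k) (n : ℕ) : coef (g + h) n = coef g n + coef h n := by
  refine coef_unique (c := fun n => coef g n + coef h n) (fun τ => ?_) n
  simpa [add_mul] using (hasSum_coef g τ).add (hasSum_coef h τ)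

lemma coef_smul (c : ℂ) (h : CuspForm 𝒮ℒ k) (n : ℕ) : coef (c • h) n = c * coef h n := by
  refine coef_unique (c := fun n => c * coef h n) (fun τ => ?_) n
  simpa [mul_assoc] using (hasSum_coef h τ).mul_left c

lemma coef_sub (g h : CuspForm 𝒮ℒ k) (n : ℕ) : coef (g - h) n = coef g n - coef h n := by
  refine coef_unique (c := fun n => coef g n - coef h n) (fun τ => ?_) n
  simpa [sub_mul] using (hasSum_coef g τ).sub (hasSum_coef h τ)

lemma eq_of_coef {g h : CuspForm 𝒮ℒ k} (e : ∀ n, coef g n = coef h n) : g = h := by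
  ext τ
  refine (hasSum_coef g τ).unique ?_
  simpa only [e] using hasSum_coef h τ

/-- The invariant squared absolute value of a cusp form. -/
def density (h : CuspForm 𝒮ℒ k) (z : ℍ) : ℝ≥0∞ := ENNReal.ofReal (‖h z‖ ^ 2 * z.im ^ k)

lemma continuous_cusp (h : CuspForm 𝒮ℒ k) : Continuous h := (ModularFormClass.holo h).continuous

lemma petersson_self (h : CuspForm 𝒮ℒ k) (z : ℍ) :
    petersson k h h z = ((‖h z‖ ^ 2 * z.im ^ k : ℝ) : ℂ) := by
  rw [petersson, Complex.conj_mul']; push_cast; rfl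

lemma norm_petersson_self (h : CuspForm 𝒮ℒ k) (z : ℍ) :
    ‖petersson k h h z‖ = ‖h z‖ ^ 2 * z.im ^ k := by
  rw [petersson_self, Complex.norm_real, Real.norm_of_nonneg]
  have := z.im_pos
  positivity

lemma density_eq (h : CuspForm 𝒮ℒ k) (z : ℍ) :
    density h z = ENNReal.ofReal ‖petersson k h h z‖ := by
  rw [norm_petersson_self, density]

lemma continuous_petersson (g h : CuspForm 𝒮ℒ k) : Continuous (petersson k g h) :=
  petersson_continuous k (continuous_cusp g) (continuous_cusp h)

lemma petersson_inv (g h : CuspForm 𝒮ℒ k) (γ : SL(2, ℤ)) (z : ℍ) :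
    petersson k g h (γ • z) = petersson k g h z :=
  SlashInvariantFormClass.petersson_smul (Γ := 𝒮ℒ) (f := g) (f' := h)
    (g := Matrix.SpecialLinearGroup.mapGL ℝ γ) ⟨γ, rfl⟩

lemma density_inv (h : CuspForm 𝒮ℒ k) (γ : SL(2, ℤ)) (z : ℍ) :
    density h (γ • z) = density h z := by
  rw [density_eq, density_eq, petersson_inv]

lemma measurable_density (h : CuspForm 𝒮ℒ k) : Measurable (density h) := by
  have : density h = fun z => ENNReal.ofReal ‖petersson k h h z‖ := funext (density_eq h)
  rw [this]
  exact ((continuous_petersson h h).norm.measurable).ennreal_ofReal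

lemma density_decay (h : CuspForm 𝒮ℒ k) (N : ℕ) : ∃ C : ℝ, 0 ≤ C ∧ ∀ z ∈ fd,
    density h z * ENNReal.ofReal (z.im ^ N) ≤ ENNReal.ofReal C := by
  obtain ⟨a, ha, hO⟩ := UpperHalfPlane.IsZeroAtImInfty.petersson_exp_decay_left k 𝒮ℒ (f := h)
    (CuspFormClass.zero_at_infty h) h
  have h2 : (fun τ : ℍ => Real.exp (-a * τ.im)) =O[atImInfty] fun z : ℍ => z.im ^ (-(N : ℝ)) :=
    Asymptotics.IsBigO.comp_tendsto (f := fun t : ℝ ↦ Real.exp (-a * t))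
     (g := fun t : ℝ ↦ t ^ (-(N : ℝ))) (isLittleO_exp_neg_mul_rpow_atTop ha _).isBigO tendsto_comap
  obtain ⟨C, hC⟩ := ModularGroup.exists_bound_fundamental_domain_of_isBigO
    (continuous_petersson h h) (hO.trans h2)
  refine ⟨max C 0, le_max_right _ _, fun z hz => ?_⟩
  have hy := z.im_pos
  rw [density_eq, ← ENNReal.ofReal_mul (norm_nonneg _)]
  refine ENNReal.ofReal_le_ofReal (le_max_of_le_left ?_)
  have := hC z hz
  rw [Real.rpow_neg hy.le, Real.rpow_natCast, ← div_eq_mul_inv, le_div_iff₀ (by positivity)] at this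
  exact this

lemma coef_eq_integral (h : CuspForm 𝒮ℒ k) (n : ℕ) {t : ℝ} (ht : 0 < t) :
    coef h n = ∫ u in (0 : ℝ)..1, (Complex.exp (2 * Real.pi * I * (u + t * I)) ^ n)⁻¹ *
      h (UpperHalfPlane.ofComplex (u + t * I)) := by
  have := ModularFormClass.qExpansion_coeff_eq_intervalIntegral (f := h) (Γ := 𝒮ℒ) one_pos
    one_mem_strictPeriods_SL n ht
  rw [coef, this]
  simp only [ne_eq, one_ne_zero, not_false_eq_true, div_self, one_mul, Complex.ofReal_one]
  refine intervalIntegral.integral_congr fun u _ => ?_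
  simp only [qParam_one, one_div]
  rw [UpperHalfPlane.ofComplex_apply_of_im_pos (show 0 < ((u : ℂ) + t * I).im by simpa)]

lemma integral_normSq (h : CuspForm 𝒮ℒ k) {t : ℝ} (ht : 0 < t) :
    HasSum (fun n => ‖coef h n‖ ^ 2 * Real.exp (-(4 * Real.pi * n * t)))
      (∫ u in (0 : ℝ)..1, ‖h (UpperHalfPlane.ofComplex (u + t * I))‖ ^ 2) := by
  set H : ℝ → ℂ := fun u => h (UpperHalfPlane.ofComplex (u + t * I)) with hH
  have hp : ∀ u : ℝ, 0 < ((u : ℂ) + t * I).im := fun u => by simpa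
  have hHc : Continuous H := by
    have h1 : Continuous fun u : ℝ => (⟨(u : ℂ) + t * I, hp u⟩ : ℍ) := by
      rw [UpperHalfPlane.isEmbedding_coe.continuous_iff]
      change Continuous fun u : ℝ => (u : ℂ) + t * I
      fun_prop
    have h2 : H = fun u : ℝ => h ⟨(u : ℂ) + t * I, hp u⟩ := by
      funext u; rw [hH]; simp only []; rw [UpperHalfPlane.ofComplex_apply_of_im_pos (hp u)]
    rw [h2]
    exact (continuous_cusp h).comp h1
  set q : ℝ → ℂ := fun u => Complex.exp (2 * Real.pi * I * (u + t * I)) with hq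
  have hqc : Continuous q := by fun_prop
  have hqn : ∀ u, ‖q u‖ = Real.exp (-(2 * Real.pi * t)) := fun u => by
    simp [hq, Complex.norm_exp]
  have hs : ∀ u : ℝ, HasSum (fun n => coef h n * q u ^ n) (H u) := fun u => by
    have := hasSum_coef h ⟨u + t * I, hp u⟩
    rw [hH, hq]; simp only []
    rwa [UpperHalfPlane.ofComplex_apply_of_im_pos (hp u)]
  have key := intervalIntegral.hasSum_integral_of_dominated_convergence (μ := volume) (a := 0) (b := 1)
    (F := fun n u => coef h n * q u ^ n * conj (H u)) (f := fun u => H u * conj (H u))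
    (fun n u => ‖coef h n‖ * Real.exp (-(2 * Real.pi * t)) ^ n * ‖H u‖)
    (fun n => by
      have : Continuous fun u => coef h n * q u ^ n * conj (H u) := by fun_prop
      exact this.aestronglyMeasurable)
    (fun n => .of_forall fun u _ => by simp [hqn])
    (.of_forall fun u _ => by
      refine Summable.mul_right _ ?_
      simpa [hqn] using (hs 0).summable.norm)
    (by
      have : Continuous fun u => (∑' n, ‖coef h n‖ * Real.exp (-(2 * Real.pi * t)) ^ n) * ‖H u‖ := by fun_prop
      simp only [tsum_mul_right]
      exact this.intervalIntegrable _ _)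
    (.of_forall fun u _ => (hs u).mul_right _)
  have e1 : ∀ n, ∫ u in (0 : ℝ)..1, coef h n * q u ^ n * conj (H u) =
      ((‖coef h n‖ ^ 2 * Real.exp (-(4 * Real.pi * n * t)) : ℝ) : ℂ) := by
    intro n
    have e2 : ∀ u, coef h n * q u ^ n * conj (H u) =
        (coef h n * Real.exp (-(4 * Real.pi * n * t))) * conj ((q u ^ n)⁻¹ * H u) := by
      intro u
      have e3 : q u ^ n = Real.exp (-(4 * Real.pi * n * t)) * conj (q u ^ n)⁻¹ := by
        have hne : q u ^ n ≠ 0 := pow_ne_zero _ (Complex.exp_ne_zero _)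
        rw [map_inv₀, eq_mul_inv_iff_mul_eq₀ (by simpa using hne), Complex.mul_conj', norm_pow, hqn,
          ← Complex.ofReal_pow, ← pow_mul, ← Real.exp_nat_mul]
        congr 2; push_cast; ring
      rw [map_mul]
      nth_rw 1 [e3]
      ring
    simp only [e2]
    rw [intervalIntegral.integral_const_mul, intervalIntegral.integral_of_le zero_le_one, integral_conj,
      ← intervalIntegral.integral_of_le zero_le_one, ← coef_eq_integral h n ht]
    push_cast
    rw [← Complex.mul_conj']; ring
  simp only [e1] at key
  have e4 : ∫ u in (0 : ℝ)..1, H u * conj (H u) = ((∫ u in (0 : ℝ)..1, ‖H u‖ ^ 2 : ℝ) : ℂ) := by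
    rw [← intervalIntegral.integral_ofReal]
    refine intervalIntegral.integral_congr fun u _ => ?_
    simp [Complex.mul_conj']
  rw [e4] at key
  exact_mod_cast key

lemma density_mean (h : CuspForm 𝒮ℒ k) {t : ℝ} (ht : 0 < t) :
    ∫⁻ x in Set.Ico (0 : ℝ) 1, density h (UpperHalfPlane.ofComplex (x + t * I)) =
      ∑' n : ℕ, ENNReal.ofReal (‖coef h n‖ ^ 2 * (t ^ (k : ℝ) * Real.exp (-(4 * Real.pi * n * t)))) := by
  have hs := (integral_normSq h ht).mul_left (t ^ k)
  rw [← ENNReal.ofReal_tsum_of_nonneg (fun n => by positivity) (by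
      refine hs.summable.congr fun n => ?_
      rw [Real.rpow_intCast]; ring)]
  have e0 : ∑' n : ℕ, ‖coef h n‖ ^ 2 * (t ^ (k : ℝ) * Real.exp (-(4 * Real.pi * n * t))) =
      ∫ u in (0 : ℝ)..1, t ^ k * ‖h (UpperHalfPlane.ofComplex (u + t * I))‖ ^ 2 := by
    rw [intervalIntegral.integral_const_mul, ← hs.tsum_eq]
    refine tsum_congr fun n => ?_
    rw [Real.rpow_intCast]; ring
  have hp : ∀ u : ℝ, 0 < ((u : ℂ) + t * I).im := fun u => by simpa
  have hc : Continuous fun u : ℝ => t ^ k * ‖h (UpperHalfPlane.ofComplex (u + t * I))‖ ^ 2 := by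
    have h1 : Continuous fun u : ℝ => (⟨(u : ℂ) + t * I, hp u⟩ : ℍ) := by
      rw [UpperHalfPlane.isEmbedding_coe.continuous_iff]
      change Continuous fun u : ℝ => (u : ℂ) + t * I
      fun_prop
    have h2 : (fun u : ℝ => h (UpperHalfPlane.ofComplex (u + t * I))) = fun u : ℝ => h ⟨(u : ℂ) + t * I, hp u⟩ := by
      funext u; rw [UpperHalfPlane.ofComplex_apply_of_im_pos (hp u)]
    have h3 : Continuous (fun u : ℝ => h (UpperHalfPlane.ofComplex (u + t * I))) := by
      rw [h2]; exact (continuous_cusp h).comp h1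
    exact continuous_const.mul (h3.norm.pow 2)
  rw [e0, intervalIntegral.integral_of_le zero_le_one, ofReal_integral_eq_lintegral_ofReal
    (hc.integrableOn_Icc.mono_set Set.Ioc_subset_Icc_self) (.of_forall fun u => by positivity),
    Measure.restrict_congr_set Ico_ae_eq_Ioc]
  refine lintegral_congr fun u => ?_
  rw [density, UpperHalfPlane.ofComplex_apply_of_im_pos (hp u)]
  congr 1
  rw [mul_comm]
  simp [UpperHalfPlane.im]

/-- A cusp form with real normalized coefficients yields Rankin–Selberg data. -/
theorem rsData_of_cusp (hk : 0 < k) (h : CuspForm 𝒮ℒ k) {l : ℕ → ℝ} (h0 : l 0 = 0)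
    (hl : ∀ n, coef h n = ((l n * (n : ℝ) ^ (((k : ℝ) - 1) / 2) : ℝ) : ℂ)) :
    RSData (k : ℝ) l (density h) where
  kpos := by exact_mod_cast hk
  meas := measurable_density h
  inv := density_inv h
  decay := density_decay h
  zero := h0
  mean y hy := by
    rw [density_mean h hy]
    refine tsum_congr fun n => ?_
    congr 2
    rw [hl, Complex.norm_real, Real.norm_eq_abs, sq_abs, mul_pow]
    congr 1
    rw [← Real.rpow_natCast, ← Real.rpow_mul (by positivity)]
    congr 1; push_cast; ring

end
end CuspPrime

namespace CuspPrime
section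
open MeasureTheory ModularGroup
open UpperHalfPlane hiding I
open scoped Topology ENNReal MatrixGroups Modular ComplexConjugate

variable {k : ℤ}

instance : (volume : Measure ℍ).IsOpenPosMeasure where
  open_pos U hU hne h0 := by
    rw [UpperHalfPlane.volume_eq_lintegral, lintegral_eq_zero_iff (by fun_prop),
      Filter.EventuallyEq, ae_restrict_iff' (measurableEmbedding_coe.measurableSet_image.mpr hU.measurableSet)] at h0
    have hU' : IsOpen (UpperHalfPlane.coe '' U) := UpperHalfPlane.isOpenEmbedding_coe.isOpenMap U hU
    have h1 : volume (UpperHalfPlane.coe '' U) = 0 := by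
      rw [← compl_compl (UpperHalfPlane.coe '' U)]
      change ∀ᵐ z : ℂ, z ∈ (UpperHalfPlane.coe '' U)ᶜ
      filter_upwards [h0] with z hz hz'
      have h2 := hz hz'
      obtain ⟨τ, -, rfl⟩ := hz'
      have := τ.im_ne_zero
      simp at h2
      exact this h2
    rw [hU'.measure_eq_zero_iff volume, Set.image_eq_empty] at h1
    exact hne.ne_empty h1

/-- The finite measure on the upper half plane representing the modular surface. -/
def surface : Measure ℍ := volume.withDensity eta

instance : IsFiniteMeasure surface :=
  ⟨by rw [surface, withDensity_apply _ MeasurableSet.univ, setLIntegral_univ]; exact lintegral_eta_lt_top⟩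

lemma lintegral_surface {F : ℍ → ℝ≥0∞} (hF : Measurable F) : ∫⁻ z, F z ∂surface = ∫⁻ z, F z * eta z := by
  rw [surface, lintegral_withDensity_eq_lintegral_mul _ measurable_eta hF]
  simp only [Pi.mul_apply, mul_comm]

lemma ae_zero_of_surface {F : ℍ → ℝ≥0∞} (hF : Measurable F) (hinv : ∀ (γ : SL(2, ℤ)) z, F (γ • z) = F z)
    (h : ∫⁻ z, F z ∂surface = 0) : F =ᵐ[volume] 0 := by
  rw [lintegral_surface hF] at h
  have hm : Measurable fun z => F z * eta z := hF.mul measurable_eta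
  have h1 : ∫⁻ z, F z = 0 := by
    calc ∫⁻ z, F z = ∫⁻ z, ∑' γ : SL(2, ℤ), F (γ • z) * eta (γ • z) := by
          refine lintegral_congr fun z => ?_
          simp only [hinv]
          rw [ENNReal.tsum_mul_left, tsum_eta, mul_one]
      _ = ∑' γ : SL(2, ℤ), ∫⁻ z, F (γ • z) * eta (γ • z) :=
          lintegral_tsum fun γ => (hm.comp (measurable_sl_smul γ)).aemeasurable
      _ = 0 := by
          refine ENNReal.tsum_eq_zero.mpr fun γ => ?_
          rw [← h]
          exact lintegral_sl_smul γ (fun z => F z * eta z)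
  exact (lintegral_eq_zero_iff hF).mp h1

/-- The Petersson inner product. -/
def pet (g h : CuspForm 𝒮ℒ k) : ℂ := ∫ z, petersson k g h z ∂surface

lemma integrable_petersson (g h : CuspForm 𝒮ℒ k) : Integrable (petersson k g h) surface := by
  obtain ⟨C, hC⟩ := CuspFormClass.petersson_bounded_left k 𝒮ℒ g h
  exact .of_bound (continuous_petersson g h).aestronglyMeasurable C (.of_forall hC)

lemma pet_self (h : CuspForm 𝒮ℒ k) : pet h h = (((mass (density h)).toReal : ℝ) : ℂ) := by
  rw [pet, mass, ← lintegral_surface (measurable_density h)]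
  simp only [petersson_self]
  rw [integral_complex_ofReal, integral_eq_lintegral_of_nonneg_ae]
  · rfl
  · exact .of_forall fun z => by have := z.im_pos; simp only [Pi.zero_apply]; positivity
  · have : Continuous fun z : ℍ => ‖h z‖ ^ 2 * z.im ^ k := by
      simp only [← norm_petersson_self]
      exact (continuous_petersson h h).norm
    exact this.aestronglyMeasurable

lemma pet_symm (g h : CuspForm 𝒮ℒ k) : conj (pet h g) = pet g h := by
  rw [pet, ← integral_conj]
  refine integral_congr_ae (.of_forall fun z => ?_)
  exact (petersson_symm k h g z).symm

lemma eq_zero_of_mass (h : CuspForm 𝒮ℒ k) (h0 : mass (density h) = 0) : h = 0 := by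
  rw [mass, ← lintegral_surface (measurable_density h)] at h0
  have h1 := ae_zero_of_surface (measurable_density h) (density_inv h) h0
  have h2 : (fun z : ℍ => ‖petersson k h h z‖) =ᵐ[volume] fun _ => (0 : ℝ) := by
    filter_upwards [h1] with z hz
    rw [density_eq] at hz
    exact le_antisymm (by simpa using hz) (norm_nonneg _)
  have h3 := (Continuous.ae_eq_iff_eq volume (continuous_petersson h h).norm continuous_const).mp h2
  ext z
  have h4 := congrFun h3 z
  rw [norm_petersson_self] at h4
  have := zpow_pos z.im_pos k
  simpa [this.ne'] using h4

/-- The Petersson inner product as an inner product space structure. -/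
@[reducible]
def cuspCore (k : ℤ) : InnerProductSpace.Core ℂ (CuspForm 𝒮ℒ k) where
  inner := pet
  conj_inner_symm g h := pet_symm g h
  re_inner_nonneg h := by
    change 0 ≤ (pet h h).re
    rw [pet_self, Complex.ofReal_re]; exact ENNReal.toReal_nonneg
  add_left f g h := by
    change pet (f + g) h = pet f h + pet g h
    rw [pet, pet, pet, ← integral_add (integrable_petersson f h) (integrable_petersson g h)]
    refine integral_congr_ae (.of_forall fun z => ?_)
    simp [petersson]; ring
  smul_left g h c := by
    change pet (c • g) h = conj c * pet g h
    rw [pet, pet, ← integral_const_mul]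
    refine integral_congr_ae (.of_forall fun z => ?_)
    simp [petersson]; ring
  definite h h0 := by
    change pet h h = 0 at h0
    rw [pet_self, Complex.ofReal_eq_zero, ENNReal.toReal_eq_zero_iff] at h0
    refine eq_zero_of_mass h (h0.resolve_right ?_)
    obtain ⟨C, hC⟩ := CuspFormClass.petersson_bounded_left k 𝒮ℒ h h
    refine ne_of_lt ?_
    calc mass (density h) ≤ ∫⁻ z, ENNReal.ofReal C * eta z := by
          refine lintegral_mono fun z => ?_
          gcongr
          rw [density_eq]
          exact ENNReal.ofReal_le_ofReal (hC z)
      _ < ⊤ := by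
          rw [lintegral_const_mul _ measurable_eta]
          exact ENNReal.mul_lt_top ENNReal.ofReal_lt_top lintegral_eta_lt_top

instance : NormedAddCommGroup (CuspForm 𝒮ℒ k) := (cuspCore k).toNormedAddCommGroup

instance : InnerProductSpace ℂ (CuspForm 𝒮ℒ k) := InnerProductSpace.ofCore (cuspCore k).toCore

lemma inner_eq_pet (g h : CuspForm 𝒮ℒ k) : inner ℂ g h = pet g h := rfl

lemma mass_density (h : CuspForm 𝒮ℒ k) : (mass (density h)).toReal = ‖h‖ ^ 2 := by
  have h1 := inner_self_eq_norm_sq (𝕜 := ℂ) h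
  rw [inner_eq_pet, pet_self] at h1
  simpa using h1

instance : FiniteDimensional ℂ (CuspForm 𝒮ℒ k) :=
  FiniteDimensional.of_injective (CuspForm.toModularFormₗ (Γ := 𝒮ℒ) (k := k))
    CuspForm.toModularFormₗ_injective

end
end CuspPrime

namespace CuspPrime
section
open MeasureTheory ModularGroup FixedDetMatrices
open UpperHalfPlane hiding I
open scoped Topology ENNReal MatrixGroups Modular ComplexConjugate

variable {m : ℤ}

lemma smul_reps_injective (hm : 0 < m) :
    Function.Injective (fun x : SL(2, ℤ) × reps m => x.1 • x.2.1) := by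
  suffices H : ∀ (γ : SL(2, ℤ)) (A B : reps m), γ • A.1 = B.1 → γ = 1 by
    rintro ⟨γ, A⟩ ⟨δ, B⟩ h
    have h' : γ • A.1 = δ • B.1 := h
    have h1 : (δ⁻¹ * γ) • A.1 = B.1 := by rw [mul_smul, h', inv_smul_smul]
    have h2 := H _ _ _ h1
    rw [h2, one_smul] at h1
    have h3 : γ = δ := by rwa [inv_mul_eq_one, eq_comm] at h2
    rw [h3, Subtype.ext h1]
  rintro γ ⟨A, a1, a2, a3, a4⟩ ⟨B, b1, b2, b3, b4⟩ h
  have hdet := A.2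
  have hdet' := B.2
  have hg := γ.2
  have h' := congrArg (fun M : FixedDetMatrix (Fin 2) ℤ m => M.1) h
  simp only [smul_coe] at h'
  have e (i j) : (γ.1 * A.1) i j = B.1 i j := by rw [h']
  simp only [Matrix.mul_apply, Fin.sum_univ_two] at e
  have e00 := e 0 0
  have e01 := e 0 1
  have e10 := e 1 0
  have e11 := e 1 1
  rw [Matrix.det_fin_two] at hdet hdet' hg
  simp only [a1, b1, mul_zero, add_zero, sub_zero] at *
  have g10 : γ.1 1 0 = 0 := by
    rcases mul_eq_zero.mp e10 with h | h
    · exact h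
    · omega
  rw [g10] at e11 hg
  simp only [mul_zero, zero_mul, sub_zero, zero_add] at e11 hg
  have hd : 0 < A.1 1 1 := by
    by_contra hcon; nlinarith
  have hd' : 0 < B.1 1 1 := by
    by_contra hcon; nlinarith
  have p0 : 0 < γ.1 0 0 := by
    by_contra hcon; nlinarith
  have p00 : γ.1 0 0 = 1 := by
    rcases Int.mul_eq_one_iff_eq_one_or_neg_one.mp hg with h | h <;> omega
  have p11 : γ.1 1 1 = 1 := by rw [p00] at hg; omega
  rw [p11, one_mul] at e11
  rw [p00, one_mul] at e01
  rw [abs_of_nonneg a3, abs_of_pos hd] at a4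
  rw [abs_of_nonneg b3, abs_of_pos hd'] at b4
  have p01 : γ.1 0 1 = 0 := by
    rcases lt_trichotomy (γ.1 0 1) 0 with h | h | h
    · nlinarith
    · exact h
    · nlinarith
  ext i j
  fin_cases i <;> fin_cases j <;> simp [p00, p01, g10, p11]

lemma smul_reps_surjective (hm : 0 < m) :
    Function.Surjective (fun x : SL(2, ℤ) × reps m => x.1 • x.2.1) := by
  intro A
  induction A using induction_on hm.ne' with
  | h0 A h1 h2 h3 h4 => exact ⟨(1, ⟨A, h1, h2, h3, h4⟩), one_smul _ _⟩
  | hS B hB =>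
    obtain ⟨x, rfl⟩ := hB
    exact ⟨(S * x.1, x.2), mul_smul _ _ _⟩
  | hT B hB =>
    obtain ⟨x, rfl⟩ := hB
    exact ⟨(T * x.1, x.2), mul_smul _ _ _⟩

/-- Every integral matrix of determinant `m` is uniquely an element of `SL(2, ℤ)` times a
reduced matrix. -/
def repsEquiv (hm : 0 < m) : SL(2, ℤ) × reps m ≃ FixedDetMatrix (Fin 2) ℤ m :=
  Equiv.ofBijective _ ⟨smul_reps_injective hm, smul_reps_surjective hm⟩

lemma repsEquiv_apply (hm : 0 < m) (x) : repsEquiv hm x = x.1 • x.2.1 := rfl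

/-- Right translation by an element of `SL(2, ℤ)`. -/
def rightMul (δ : SL(2, ℤ)) (A : FixedDetMatrix (Fin 2) ℤ m) : FixedDetMatrix (Fin 2) ℤ m :=
  ⟨A.1 * δ.1, by rw [Matrix.det_mul, A.2, δ.2, mul_one]⟩

lemma smul_rightMul (γ δ : SL(2, ℤ)) (A : FixedDetMatrix (Fin 2) ℤ m) :
    rightMul δ (γ • A) = γ • rightMul δ A := by
  apply FixedDetMatrices.ext'
  rw [smul_coe]
  simp only [rightMul, smul_coe, mul_assoc]

lemma rightMul_injective (δ : SL(2, ℤ)) : Function.Injective (rightMul δ (m := m)) := by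
  intro A B h
  have h1 : A.1 * δ.1 = B.1 * δ.1 := congrArg (fun M : FixedDetMatrix (Fin 2) ℤ m => M.1) h
  apply FixedDetMatrices.ext'
  have h2 := congrArg (fun M => M * (δ⁻¹ : SL(2, ℤ)).1) h1
  simpa only [mul_assoc, ← Matrix.SpecialLinearGroup.coe_mul, mul_inv_cancel,
    Matrix.SpecialLinearGroup.coe_one, mul_one] using h2

/-- A function of integral matrices that is left invariant under `SL(2, ℤ)` has a well defined sum
over cosets, which may be translated on the right. -/
lemma sum_rightMul {M : Type*} [AddCommMonoid M] (hm : 0 < m) (F : FixedDetMatrix (Fin 2) ℤ m → M)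
    (hF : ∀ (γ : SL(2, ℤ)) A, F (γ • A) = F A) (δ : SL(2, ℤ)) :
    ∑ r : reps m, F (rightMul δ r.1) = ∑ r : reps m, F r.1 := by
  set σ : reps m → reps m := fun r => ((repsEquiv hm).symm (rightMul δ r.1)).2 with hσ
  have key (r : reps m) : rightMul δ r.1 = ((repsEquiv hm).symm (rightMul δ r.1)).1 • (σ r).1 := by
    rw [hσ, ← repsEquiv_apply hm, Equiv.apply_symm_apply]
  have hinj : Function.Injective σ := by
    intro r s h
    have hr := key r
    have hs := key s
    rw [← h] at hs
    set γ := ((repsEquiv hm).symm (rightMul δ r.1)).1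
    set γ' := ((repsEquiv hm).symm (rightMul δ s.1)).1
    have h1 : rightMul δ ((γ' * γ⁻¹) • r.1) = rightMul δ s.1 := by
      rw [smul_rightMul, hr, hs, mul_smul, inv_smul_smul]
    have h2 := rightMul_injective δ h1
    have h3 := smul_reps_injective hm (a₁ := (γ' * γ⁻¹, r)) (a₂ := (1, s)) (by simpa using h2)
    exact (Prod.ext_iff.mp h3).2
  have hbij : Function.Bijective σ := Finite.injective_iff_bijective.mp hinj
  rw [← hbij.sum_comp (fun r => F r.1)]
  refine Finset.sum_congr rfl fun r _ => ?_
  rw [key r, hF]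

end
end CuspPrime

namespace CuspPrime
section
open MeasureTheory ModularGroup FixedDetMatrices
open UpperHalfPlane hiding I
open scoped Topology ENNReal MatrixGroups Modular ComplexConjugate ModularForm Manifold

variable {m k : ℤ}

/-- The real matrix underlying an integral matrix of positive determinant. -/
def gl (hm : 0 < m) (A : FixedDetMatrix (Fin 2) ℤ m) : GL (Fin 2) ℝ :=
  Matrix.GeneralLinearGroup.mkOfDetNeZero (A.1.map (Int.castRingHom ℝ)) (by
    rw [← RingHom.mapMatrix_apply, ← RingHom.map_det, A.2]
    simpa using hm.ne')

lemma gl_coe (hm : 0 < m) (A : FixedDetMatrix (Fin 2) ℤ m) :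
    (gl hm A : Matrix (Fin 2) (Fin 2) ℝ) = A.1.map (Int.castRingHom ℝ) := rfl

lemma gl_apply (hm : 0 < m) (A : FixedDetMatrix (Fin 2) ℤ m) (i j : Fin 2) :
    (gl hm A) i j = (A.1 i j : ℝ) := rfl

lemma gl_det (hm : 0 < m) (A : FixedDetMatrix (Fin 2) ℤ m) : (gl hm A).det.val = m := by
  rw [Matrix.GeneralLinearGroup.val_det_apply, gl_coe, ← RingHom.mapMatrix_apply, ← RingHom.map_det, A.2]
  simp

lemma gl_det_pos (hm : 0 < m) (A : FixedDetMatrix (Fin 2) ℤ m) : 0 < (gl hm A).det.val := by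
  rw [gl_det]; exact_mod_cast hm

lemma gl_smul (hm : 0 < m) (γ : SL(2, ℤ)) (A : FixedDetMatrix (Fin 2) ℤ m) :
    gl hm (γ • A) = Matrix.SpecialLinearGroup.mapGL ℝ γ * gl hm A := by
  apply Units.ext
  rw [Units.val_mul, gl_coe, gl_coe, smul_coe, Matrix.map_mul]
  rfl

lemma gl_rightMul (hm : 0 < m) (γ : SL(2, ℤ)) (A : FixedDetMatrix (Fin 2) ℤ m) :
    gl hm (rightMul γ A) = gl hm A * Matrix.SpecialLinearGroup.mapGL ℝ γ := by
  apply Units.ext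
  rw [Units.val_mul, gl_coe, gl_coe, rightMul, Matrix.map_mul]
  rfl

lemma slash_gl_smul (hm : 0 < m) (h : CuspForm 𝒮ℒ k) (γ : SL(2, ℤ)) (A : FixedDetMatrix (Fin 2) ℤ m) :
    (⇑h) ∣[k] gl hm (γ • A) = (⇑h) ∣[k] gl hm A := by
  rw [gl_smul, SlashAction.slash_mul]
  congr 1
  exact SlashInvariantFormClass.slash_action_eq h _ ⟨γ, rfl⟩

/-- The Hecke operator on functions. -/
def heckeFun (hm : 0 < m) (h : CuspForm 𝒮ℒ k) : ℍ → ℂ := ∑ r : reps m, (⇑h) ∣[k] gl hm r.1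

lemma heckeFun_slash (hm : 0 < m) (h : CuspForm 𝒮ℒ k) (δ : SL(2, ℤ)) :
    heckeFun hm h ∣[k] Matrix.SpecialLinearGroup.mapGL ℝ δ = heckeFun hm h := by
  rw [heckeFun, SlashAction.sum_slash, ← sum_rightMul hm (fun A => (⇑h) ∣[k] gl hm A) (slash_gl_smul hm h) δ]
  refine Finset.sum_congr rfl fun r _ => ?_
  rw [gl_rightMul, SlashAction.slash_mul]

lemma slash_gl_apply (hm : 0 < m) (h : ℍ → ℂ) (A : FixedDetMatrix (Fin 2) ℤ m) (τ : ℍ) :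
    (h ∣[k] gl hm A) τ = h (gl hm A • τ) * (m : ℂ) ^ (k - 1) * denom (gl hm A) τ ^ (-k) := by
  rw [ModularForm.slash_apply, σ, if_pos (gl_det_pos hm A), gl_det, abs_of_pos (by exact_mod_cast hm)]
  simp

lemma mdifferentiable_heckeFun (hm : 0 < m) (h : CuspForm 𝒮ℒ k) : MDiff (heckeFun hm h) := by
  classical
  unfold heckeFun
  induction (Finset.univ : Finset (reps m)) using Finset.induction_on with
  | empty => exact mdifferentiable_const (c := (0 : ℂ))
  | insert a s ha ih =>
    rw [Finset.sum_insert ha]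
    exact (h.holo'.slash _ _).add ih

lemma hasSum_of_eq {f g : ℕ → ℂ} {a : ℂ} (hf : HasSum f a) (e : ∀ n, g n = f n) : HasSum g a := by
  rwa [funext e]

variable {p : ℕ}

/-- The reduced matrix `(1 b; 0 p)`, and `(p 0; 0 1)` for the point at infinity. -/
def primeRep (hp : p.Prime) : Option (Fin p) → reps (p : ℤ)
  | some b => ⟨⟨!![1, ((b : ℕ) : ℤ); 0, p], by simp [Matrix.det_fin_two]⟩, by
      refine ⟨rfl, by simp, by simp, ?_⟩
      simp⟩
  | none => ⟨⟨!![(p : ℤ), 0; 0, 1], by simp [Matrix.det_fin_two]⟩, by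
      refine ⟨rfl, ?_, by simp, by simp⟩
      simpa using hp.pos⟩

lemma primeRep_none_coe (hp : p.Prime) : (primeRep hp none).1.1 = !![(p : ℤ), 0; 0, 1] := rfl

lemma primeRep_some_coe (hp : p.Prime) (b : Fin p) :
    (primeRep hp (some b)).1.1 = !![1, ((b : ℕ) : ℤ); 0, p] := rfl

lemma primeRep_bijective (hp : p.Prime) : Function.Bijective (primeRep hp) := by
  constructor
  · have H (r s) (h : primeRep hp r = primeRep hp s) (i j) : (primeRep hp r).1.1 i j = (primeRep hp s).1.1 i j := by
      rw [h]
    have h1 : (1 : ℤ) ≠ p := by exact_mod_cast hp.one_lt.ne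
    rintro (_ | b) (_ | c) h
    · rfl
    · exact absurd (H _ _ h 1 1) (by simpa [primeRep] using h1)
    · exact absurd (H _ _ h 0 0) (by simpa [primeRep] using h1)
    · have := H _ _ h 0 1
      simp [primeRep] at this
      rw [Fin.ext this]
  · rintro ⟨A, a1, a2, a3, a4⟩
    have hdet := A.2
    rw [Matrix.det_fin_two, a1, mul_zero, sub_zero] at hdet
    have hd : 0 < A.1 1 1 := by
      have : (0 : ℤ) < p := by exact_mod_cast hp.pos
      by_contra hcon; nlinarith
    rw [abs_of_nonneg a3, abs_of_pos hd] at a4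
    obtain ⟨a, ha⟩ := Int.eq_ofNat_of_zero_le a2.le
    obtain ⟨b, hb⟩ := Int.eq_ofNat_of_zero_le a3
    obtain ⟨d, hd'⟩ := Int.eq_ofNat_of_zero_le hd.le
    rw [hb, hd'] at a4
    rw [ha, hd'] at hdet
    have h2 : a * d = p := by exact_mod_cast hdet
    have hbd : b < d := by exact_mod_cast a4
    rcases (Nat.dvd_prime hp).mp ⟨d, h2.symm⟩ with h | h
    · have hdp : d = p := by rw [← h2, h, one_mul]
      refine ⟨some ⟨b, hdp ▸ hbd⟩, ?_⟩
      apply Subtype.ext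
      apply FixedDetMatrices.ext
      intro i j
      fin_cases i <;> fin_cases j <;> simp [primeRep, ha, hb, hd', a1, h, hdp]
    · have hd1 : d = 1 := by
        rw [h] at h2
        exact (Nat.mul_eq_left hp.ne_zero).mp h2
      have hb0 : b = 0 := by omega
      refine ⟨none, ?_⟩
      apply Subtype.ext
      apply FixedDetMatrices.ext
      intro i j
      fin_cases i <;> fin_cases j <;> simp [primeRep, ha, hb, hd', a1, h, hd1, hb0]

lemma heckeFun_prime (hp : p.Prime) (hm : 0 < (p : ℤ)) (h : CuspForm 𝒮ℒ k) :
    heckeFun hm h = (⇑h) ∣[k] gl hm (primeRep hp none).1 + ∑ b, (⇑h) ∣[k] gl hm (primeRep hp (some b)).1 := by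
  rw [heckeFun, ← (primeRep_bijective hp).sum_comp (fun r => (⇑h) ∣[k] gl hm r.1), Fintype.sum_option]

lemma hasSum_slash_none (hp : p.Prime) (hm : 0 < (p : ℤ)) (h : CuspForm 𝒮ℒ k) (τ : ℍ) :
    HasSum (fun n => (if p ∣ n then (p : ℂ) ^ (k - 1) * coef h (n / p) else 0) * cexp (2 * Real.pi * I * τ) ^ n)
      (((⇑h) ∣[k] gl hm (primeRep hp none).1) τ) := by
  rw [slash_gl_apply]
  have h1 := hasSum_coef h (gl hm (primeRep hp none).1 • τ)
  have h2 : ((gl hm (primeRep hp none).1 • τ : ℍ) : ℂ) = p * τ := by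
    rw [UpperHalfPlane.coe_smul_of_det_pos (gl_det_pos hm _)]
    simp [num, denom, gl_apply, primeRep_none_coe]
  have h3 : denom (gl hm (primeRep hp none).1) τ = 1 := by
    simp [denom, gl_apply, primeRep_none_coe]
  rw [h2] at h1
  rw [h3, one_zpow, mul_one, mul_comm (h _), Int.cast_natCast]
  have hinj : Function.Injective (fun n : ℕ => p * n) := fun a b hab => Nat.eq_of_mul_eq_mul_left hp.pos hab
  rw [← hinj.hasSum_iff]
  · refine hasSum_of_eq (h1.mul_left ((p : ℂ) ^ (k - 1))) fun n => ?_
    have e : cexp (2 * Real.pi * I * τ) ^ (p * n) = cexp (2 * Real.pi * I * (p * τ)) ^ n := by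
      rw [pow_mul, ← Complex.exp_nat_mul]
      congr 2
      ring
    simp only [Function.comp_apply, dvd_mul_right, if_true, Nat.mul_div_cancel_left _ hp.pos, e]
    rw [mul_assoc]
  · intro n hn
    rw [if_neg, zero_mul]
    rintro ⟨c, rfl⟩
    exact hn ⟨c, rfl⟩

lemma sum_exp_fin (hp : p.Prime) (n : ℕ) :
    ∑ b : Fin p, cexp (2 * Real.pi * I * (b : ℕ) / p) ^ n = if p ∣ n then (p : ℂ) else 0 := by
  have hζ := Complex.isPrimitiveRoot_exp p hp.ne_zero
  have e (b : ℕ) : cexp (2 * Real.pi * I * b / p) ^ n = (cexp (2 * Real.pi * I / p) ^ n) ^ b := by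
    rw [← pow_mul, ← Complex.exp_nat_mul, ← Complex.exp_nat_mul]
    congr 1
    push_cast
    ring
  simp only [e]
  rw [Fin.sum_univ_eq_sum_range (fun b => (cexp (2 * Real.pi * I / p) ^ n) ^ b)]
  split_ifs with hd
  · rw [(hζ.pow_eq_one_iff_dvd n).mpr hd]
    simp
  · have hco : n.Coprime p := ((Nat.Prime.coprime_iff_not_dvd hp).mpr hd).symm
    exact (hζ.pow_of_coprime n hco).geom_sum_eq_zero hp.one_lt

lemma hasSum_slash_some (hp : p.Prime) (hm : 0 < (p : ℤ)) (h : CuspForm 𝒮ℒ k) (τ : ℍ) :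
    HasSum (fun n => coef h (p * n) * cexp (2 * Real.pi * I * τ) ^ n)
      ((∑ b, (⇑h) ∣[k] gl hm (primeRep hp (some b)).1) τ) := by
  have hp0 : (p : ℂ) ≠ 0 := by exact_mod_cast hp.ne_zero
  have hval (b : Fin p) : HasSum (fun n => (p : ℂ)⁻¹ * (coef h n * (cexp (2 * Real.pi * I * (b : ℕ) / p) ^ n *
      cexp (2 * Real.pi * I * τ / p) ^ n))) (((⇑h) ∣[k] gl hm (primeRep hp (some b)).1) τ) := by
    rw [slash_gl_apply]
    have h1 := hasSum_coef h (gl hm (primeRep hp (some b)).1 • τ)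
    have h2 : ((gl hm (primeRep hp (some b)).1 • τ : ℍ) : ℂ) = (τ + (b : ℕ)) / p := by
      rw [UpperHalfPlane.coe_smul_of_det_pos (gl_det_pos hm _)]
      simp [num, denom, gl_apply, primeRep_some_coe]
    have h3 : denom (gl hm (primeRep hp (some b)).1) τ = p := by
      simp [denom, gl_apply, primeRep_some_coe]
    rw [h2] at h1
    rw [h3, Int.cast_natCast, mul_assoc (h _), ← zpow_add₀ hp0, mul_comm (h _)]
    rw [show k - 1 + -k = -1 by ring, zpow_neg_one]
    refine hasSum_of_eq (h1.mul_left ((p : ℂ)⁻¹)) fun n => ?_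
    rw [← mul_pow, ← Complex.exp_add]
    congr 4
    ring
  have hsum := hasSum_sum (s := Finset.univ) fun b _ => hval b
  rw [Finset.sum_apply]
  have hinj : Function.Injective (fun n : ℕ => p * n) := fun a b hab => Nat.eq_of_mul_eq_mul_left hp.pos hab
  have e (n : ℕ) : ∑ b : Fin p, (p : ℂ)⁻¹ * (coef h n * (cexp (2 * Real.pi * I * (b : ℕ) / p) ^ n *
      cexp (2 * Real.pi * I * τ / p) ^ n)) =
      if p ∣ n then coef h n * cexp (2 * Real.pi * I * τ / p) ^ n else 0 := by
    rw [← Finset.mul_sum, ← Finset.mul_sum, ← Finset.sum_mul, sum_exp_fin hp]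
    split_ifs
    · field_simp
    · simp
  simp only [e] at hsum
  rw [← hinj.hasSum_iff] at hsum
  · convert hsum using 2 with n
    have e' : cexp (2 * Real.pi * I * τ / p) ^ (p * n) = cexp (2 * Real.pi * I * τ) ^ n := by
      rw [pow_mul, ← Complex.exp_nat_mul]
      congr 2
      field_simp
    simp only [Function.comp_apply, dvd_mul_right, if_true, e']
  · intro n hn
    rw [if_neg]
    rintro ⟨c, rfl⟩
    exact hn ⟨c, rfl⟩

/-- The Fourier coefficients of the Hecke operator at a prime. -/
def heckeCoef (p : ℕ) (h : CuspForm 𝒮ℒ k) (n : ℕ) : ℂ :=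
  coef h (p * n) + if p ∣ n then (p : ℂ) ^ (k - 1) * coef h (n / p) else 0

lemma hasSum_heckeFun (hp : p.Prime) (hm : 0 < (p : ℤ)) (h : CuspForm 𝒮ℒ k) (τ : ℍ) :
    HasSum (fun n => heckeCoef p h n * cexp (2 * Real.pi * I * τ) ^ n) (heckeFun hm h τ) := by
  rw [heckeFun_prime hp, Pi.add_apply, add_comm (((⇑h) ∣[k] _) τ)]
  convert (hasSum_slash_some hp hm h τ).add (hasSum_slash_none hp hm h τ) using 2 with n
  rw [heckeCoef, add_mul]

/-- The image of a cusp form under a Hecke operator, as a modular form. -/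
def heckeModular (hp : p.Prime) (hm : 0 < (p : ℤ)) (h : CuspForm 𝒮ℒ k) : ModularForm 𝒮ℒ k where
  toFun := heckeFun hm h
  slash_action_eq' := by
    rintro _ ⟨γ, rfl⟩
    exact heckeFun_slash hm h γ
  holo' := mdifferentiable_heckeFun hm h
  bdd_at_cusps' {c} hc := by
    rw [Subgroup.IsArithmetic.isCusp_iff_isCusp_SL2Z] at hc
    rw [OnePoint.isBoundedAt_iff_forall_SL2Z hc]
    intro γ _
    rw [show heckeFun hm h ∣[k] γ = heckeFun hm h from heckeFun_slash hm h γ]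
    refine UpperHalfPlane.isBoundedAtImInfty_of_hasSum_qExpansion (c := heckeCoef p h) one_pos fun τ => ?_
    simpa only [qParam_one, smul_eq_mul] using hasSum_heckeFun hp hm h τ

/-- The image of a cusp form under a Hecke operator. -/
def heckeCusp (hp : p.Prime) (hm : 0 < (p : ℤ)) (h : CuspForm 𝒮ℒ k) : CuspForm 𝒮ℒ k :=
  ModularForm.toCuspForm (heckeModular hp hm h) (by
    rw [← ModularFormClass.qExpansion_coeff_unique (f := heckeModular hp hm h) (Γ := 𝒮ℒ) one_pos
      one_mem_strictPeriods_SL (c := heckeCoef p h) (fun τ => by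
        simp only [qParam_one, smul_eq_mul]
        exact hasSum_heckeFun hp hm h τ) 0]
    simp [heckeCoef, coef_zero])

lemma coef_heckeCusp (hp : p.Prime) (hm : 0 < (p : ℤ)) (h : CuspForm 𝒮ℒ k) (n : ℕ) :
    coef (heckeCusp hp hm h) n = heckeCoef p h n :=
  coef_unique (c := heckeCoef p h) (fun τ => hasSum_heckeFun hp hm h τ) n

/-- The Hecke operator at a prime, acting on cusp forms. -/
def hecke (k : ℤ) (p : Nat.Primes) : CuspForm 𝒮ℒ k →ₗ[ℂ] CuspForm 𝒮ℒ k where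
  toFun := heckeCusp p.2 (by exact_mod_cast p.2.pos)
  map_add' g h := by
    refine eq_of_coef fun n => ?_
    simp only [coef_heckeCusp, coef_add, heckeCoef]
    split_ifs <;> ring
  map_smul' c h := by
    refine eq_of_coef fun n => ?_
    simp only [coef_heckeCusp, coef_smul, heckeCoef, RingHom.id_apply]
    split_ifs <;> ring

lemma hecke_apply (p : Nat.Primes) (h : CuspForm 𝒮ℒ k) (τ : ℍ) :
    hecke k p h τ = heckeFun (m := (p : ℕ)) (by exact_mod_cast p.2.pos) h τ := rfl

lemma coef_hecke (p : Nat.Primes) (h : CuspForm 𝒮ℒ k) (n : ℕ) :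
    coef (hecke k p h) n = coef h (p * n) + if (p : ℕ) ∣ n then (p : ℂ) ^ (k - 1) * coef h (n / p) else 0 :=
  coef_heckeCusp p.2 _ h n

lemma hecke_commute {p q : Nat.Primes} (hpq : p ≠ q) : Commute (hecke k p) (hecke k q) := by
  refine LinearMap.ext fun h => eq_of_coef fun n => ?_
  have hne : (p : ℕ) ≠ q := fun e => hpq (Subtype.ext e)
  have hco : Nat.Coprime p q := (Nat.coprime_primes p.2 q.2).mpr hne
  have hp := p.2.pos
  have hq := q.2.pos
  have d1 (n : ℕ) : (p : ℕ) ∣ q * n ↔ (p : ℕ) ∣ n := hco.dvd_mul_left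
  have d2 (n : ℕ) : (q : ℕ) ∣ p * n ↔ (q : ℕ) ∣ n := hco.symm.dvd_mul_left
  have e1 {n : ℕ} (h : (q : ℕ) ∣ n) : (p : ℕ) * n / q = p * (n / q) := Nat.mul_div_assoc _ h
  have e2 {n : ℕ} (h : (p : ℕ) ∣ n) : (q : ℕ) * n / p = q * (n / p) := Nat.mul_div_assoc _ h
  have e3 {n : ℕ} (h : (q : ℕ) ∣ n) : (p : ℕ) ∣ n / q ↔ (p : ℕ) ∣ n := by
    obtain ⟨b, rfl⟩ := h
    rw [Nat.mul_div_cancel_left _ hq, d1]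
  have e4 {n : ℕ} (h : (p : ℕ) ∣ n) : (q : ℕ) ∣ n / p ↔ (q : ℕ) ∣ n := by
    obtain ⟨b, rfl⟩ := h
    rw [Nat.mul_div_cancel_left _ hp, d2]
  have e5 : n / p / q = n / q / p := by rw [Nat.div_div_eq_div_mul, Nat.div_div_eq_div_mul, mul_comm]
  simp only [Module.End.mul_apply, coef_hecke, d1, d2, mul_left_comm (p : ℕ) q]
  by_cases h1 : (p : ℕ) ∣ n <;> by_cases h2 : (q : ℕ) ∣ n
  · simp only [h1, h2, if_true, e1, e2, e3, e4, e5]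
    ring
  · simp only [h1, h2, if_true, if_false, e2, e4]
    ring
  · simp only [h1, h2, if_true, if_false, e1, e3]
    ring
  · simp only [h1, h2, if_false]

end
end CuspPrime

namespace CuspPrime
section
open MeasureTheory ModularGroup FixedDetMatrices
open UpperHalfPlane hiding I
open scoped Topology ENNReal MatrixGroups Modular ComplexConjugate ModularForm Manifold

variable {m k : ℤ}

/-- The adjugate of an integral matrix. -/
def adj (A : FixedDetMatrix (Fin 2) ℤ m) : FixedDetMatrix (Fin 2) ℤ m :=
  ⟨A.1.adjugate, by rw [Matrix.det_adjugate, A.2]; simp⟩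

/-- The adjugate as an involution. -/
def adjEquiv (m : ℤ) : FixedDetMatrix (Fin 2) ℤ m ≃ FixedDetMatrix (Fin 2) ℤ m :=
  (show Function.Involutive (adj (m := m)) from fun A => by
    apply FixedDetMatrices.ext'
    simp only [adj]
    rw [Matrix.adjugate_adjugate _ (by simp)]
    simp).toPerm

lemma adjEquiv_apply (A : FixedDetMatrix (Fin 2) ℤ m) : adjEquiv m A = adj A := rfl

lemma gl_mul_adj (hm : 0 < m) (A : FixedDetMatrix (Fin 2) ℤ m) :
    (gl hm A * gl hm (adj A) : GL (Fin 2) ℝ).1 = !![(m : ℝ), 0; 0, m] := by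
  rw [Units.val_mul, gl_coe, gl_coe, ← Matrix.map_mul, adj, Matrix.mul_adjugate, A.2]
  ext i j
  rw [Matrix.map_apply, Matrix.smul_apply]
  fin_cases i <;> fin_cases j <;> simp

lemma gl_mul_adj_det (hm : 0 < m) (A : FixedDetMatrix (Fin 2) ℤ m) :
    (gl hm A * gl hm (adj A) : GL (Fin 2) ℝ).det.val = (m : ℝ) ^ 2 := by
  rw [Matrix.GeneralLinearGroup.val_det_apply, gl_mul_adj, Matrix.det_fin_two]
  simp [sq]

lemma gl_mul_adj_smul (hm : 0 < m) (A : FixedDetMatrix (Fin 2) ℤ m) (z : ℍ) :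
    gl hm A • gl hm (adj A) • z = z := by
  have hm' : (m : ℝ) ≠ 0 := by exact_mod_cast hm.ne'
  rw [← mul_smul]
  apply UpperHalfPlane.coe_injective
  rw [UpperHalfPlane.coe_smul_of_det_pos (by rw [gl_mul_adj_det]; positivity), num, denom, gl_mul_adj]
  have : (m : ℂ) ≠ 0 := by exact_mod_cast hm.ne'
  simp
  field_simp

lemma slash_mul_adj (hm : 0 < m) (A : FixedDetMatrix (Fin 2) ℤ m) (h : ℍ → ℂ) :
    (h ∣[k] gl hm A) ∣[k] gl hm (adj A) = fun z => (m : ℂ) ^ (k - 2) * h z := by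
  have hm' : (m : ℝ) ≠ 0 := by exact_mod_cast hm.ne'
  have hmc : (m : ℂ) ≠ 0 := by exact_mod_cast hm.ne'
  rw [← SlashAction.slash_mul]
  funext z
  have hden : denom (gl hm A * gl hm (adj A)) z = m := by
    rw [denom, gl_mul_adj]
    simp
  rw [ModularForm.slash_apply, σ, if_pos (by rw [gl_mul_adj_det]; positivity), gl_mul_adj_det,
    hden, mul_smul, gl_mul_adj_smul, abs_of_pos (by positivity)]
  have e : ((m : ℂ) ^ 2) ^ (k - 1) * (m : ℂ) ^ (-k) = (m : ℂ) ^ (k - 2) := by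
    rw [← zpow_natCast, ← zpow_mul, ← zpow_add₀ hmc]
    congr 1
    push_cast
    ring
  push_cast
  rw [mul_assoc, e, mul_comm]
  simp

/-- The correlation of a cusp form with its translate by an integral matrix. -/
def corr (hm : 0 < m) (h : CuspForm 𝒮ℒ k) (A : FixedDetMatrix (Fin 2) ℤ m) (z : ℍ) : ℂ :=
  petersson k ((⇑h) ∣[k] gl hm A) h z

lemma corr_smul (hm : 0 < m) (h : CuspForm 𝒮ℒ k) (γ : SL(2, ℤ)) (A : FixedDetMatrix (Fin 2) ℤ m) (z : ℍ) :
    corr hm h (γ • A) z = corr hm h A z := by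
  rw [corr, slash_gl_smul]
  rfl

lemma corr_adj (hm : 0 < m) (h : CuspForm 𝒮ℒ k) (A : FixedDetMatrix (Fin 2) ℤ m) (z : ℍ) :
    corr hm h A (gl hm (adj A) • z) = conj (corr hm h (adj A) z) := by
  have hmc : (m : ℂ) ≠ 0 := by exact_mod_cast hm.ne'
  have h1 := petersson_slash k ((⇑h) ∣[k] gl hm A) h (gl hm (adj A)) z
  rw [slash_mul_adj, σ, if_pos (gl_det_pos hm _), gl_det, abs_of_pos (by exact_mod_cast hm)] at h1
  have h2 : petersson k (fun z => (m : ℂ) ^ (k - 2) * h z) ((⇑h) ∣[k] gl hm (adj A)) z =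
      (m : ℂ) ^ (k - 2) * petersson k h ((⇑h) ∣[k] gl hm (adj A)) z := by
    simp only [petersson, map_mul, map_zpow₀, map_intCast]
    ring
  rw [h2, petersson_symm] at h1
  rw [corr, corr]
  have h3 : (m : ℂ) ^ (k - 2) ≠ 0 := zpow_ne_zero _ hmc
  refine (mul_left_cancel₀ h3 ?_).symm
  simpa using h1

lemma continuous_corr (hm : 0 < m) (h : CuspForm 𝒮ℒ k) (A : FixedDetMatrix (Fin 2) ℤ m) :
    Continuous (corr hm h A) :=
  petersson_continuous k (h.holo'.slash k (gl hm A)).continuous (continuous_cusp h)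

lemma norm_corr_le (hm : 0 < m) (h : CuspForm 𝒮ℒ k) (A : FixedDetMatrix (Fin 2) ℤ m) :
    ∃ C, ∀ z, ‖corr hm h A z‖ ≤ C := by
  obtain ⟨C, hC⟩ := CuspFormClass.petersson_bounded_left k 𝒮ℒ h h
  refine ⟨Real.sqrt (|(m : ℝ)| ^ (k - 2) * C * C), fun z => Real.le_sqrt_of_sq_le ?_⟩
  have h1 := petersson_slash k h h (gl hm A) z
  rw [σ, if_pos (gl_det_pos hm _), gl_det] at h1
  have e : ‖corr hm h A z‖ ^ 2 = ‖petersson k ((⇑h) ∣[k] gl hm A) ((⇑h) ∣[k] gl hm A) z‖ * ‖petersson k h h z‖ := by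
    rw [corr, petersson, petersson, petersson]
    simp only [norm_mul, RCLike.norm_conj]
    ring
  have e2 : ‖petersson k ((⇑h) ∣[k] gl hm A) ((⇑h) ∣[k] gl hm A) z‖ ≤ |(m : ℝ)| ^ (k - 2) * C := by
    rw [h1, norm_mul]
    have := hC (gl hm A • z)
    simp only [norm_zpow, Complex.norm_real, Real.norm_eq_abs, abs_abs]
    gcongr
    simpa using this
  rw [e]
  have := (norm_nonneg _).trans e2
  gcongr
  exact hC z

lemma integrable_corr (hm : 0 < m) (h : CuspForm 𝒮ℒ k) (A : FixedDetMatrix (Fin 2) ℤ m) :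
    Integrable (corr hm h A) surface := by
  obtain ⟨C, hC⟩ := norm_corr_le hm h A
  exact .of_bound (continuous_corr hm h A).aestronglyMeasurable C (.of_forall hC)

/-- The positive part of the imaginary part of the correlation, up to the sign `s`. -/
def corrPart (hm : 0 < m) (h : CuspForm 𝒮ℒ k) (s : ℝ) (A : FixedDetMatrix (Fin 2) ℤ m) (z : ℍ) : ℝ≥0∞ :=
  ENNReal.ofReal (s * (corr hm h A z).im)

lemma measurable_corrPart (hm : 0 < m) (h : CuspForm 𝒮ℒ k) (s : ℝ) (A : FixedDetMatrix (Fin 2) ℤ m) :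
    Measurable (corrPart hm h s A) := by
  have := continuous_corr hm h A
  exact (continuous_const.mul (Complex.continuous_im.comp this)).measurable.ennreal_ofReal

lemma measurable_gl_smul (g : GL (Fin 2) ℝ) : Measurable fun z : ℍ => g • z :=
  (continuous_const_smul g).measurable

lemma sum_corrPart (hm : 0 < m) (h : CuspForm 𝒮ℒ k) (s : ℝ) :
    ∑ r : reps m, ∫⁻ z, corrPart hm h s r.1 z ∂surface =
      ∑' A : FixedDetMatrix (Fin 2) ℤ m, ∫⁻ z, corrPart hm h s A z * eta z * eta (gl hm A • z) := by
  rw [← (repsEquiv hm).tsum_eq, ENNReal.tsum_prod', ENNReal.tsum_comm, tsum_fintype]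
  refine Finset.sum_congr rfl fun r _ => ?_
  have hmeas (A : FixedDetMatrix (Fin 2) ℤ m) :
      Measurable fun z => corrPart hm h s A z * eta z * eta (gl hm A • z) :=
    ((measurable_corrPart hm h s A).mul measurable_eta).mul (measurable_eta.comp (measurable_gl_smul _))
  rw [← lintegral_tsum fun γ => (hmeas _).aemeasurable, lintegral_surface (measurable_corrPart hm h s r.1)]
  refine lintegral_congr fun z => ?_
  have e (γ : SL(2, ℤ)) : corrPart hm h s (repsEquiv hm (γ, r)) z * eta z * eta (gl hm (repsEquiv hm (γ, r)) • z)
      = corrPart hm h s r.1 z * eta z * eta (γ • (gl hm r.1 • z)) := by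
    rw [repsEquiv_apply, corrPart, corr_smul, gl_smul, mul_smul]
    rfl
  simp only [e]
  rw [ENNReal.tsum_mul_left, tsum_eta, mul_one]

lemma sum_corrPart_neg (hm : 0 < m) (h : CuspForm 𝒮ℒ k) (s : ℝ) :
    ∑ r : reps m, ∫⁻ z, corrPart hm h s r.1 z ∂surface =
      ∑ r : reps m, ∫⁻ z, corrPart hm h (-s) r.1 z ∂surface := by
  rw [sum_corrPart, sum_corrPart, ← (adjEquiv m).tsum_eq
    (fun A => ∫⁻ z, corrPart hm h (-s) A z * eta z * eta (gl hm A • z))]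
  refine tsum_congr fun A => ?_
  rw [adjEquiv_apply, ← lintegral_gl_smul (gl hm (adj A))
    (fun z => corrPart hm h s A z * eta z * eta (gl hm A • z))]
  refine lintegral_congr fun z => ?_
  rw [gl_mul_adj_smul, corrPart, corrPart, corr_adj, Complex.conj_im, mul_neg, neg_mul]
  ring

lemma im_pet_hecke (p : Nat.Primes) (h : CuspForm 𝒮ℒ k) : (pet (hecke k p h) h).im = 0 := by
  have hm : 0 < ((p : ℕ) : ℤ) := by exact_mod_cast p.2.pos
  have e (z : ℍ) : petersson k (hecke k p h) h z = ∑ r : reps ((p : ℕ) : ℤ), corr hm h r.1 z := by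
    simp only [petersson, hecke_apply, corr, heckeFun, Finset.sum_apply, map_sum, Finset.sum_mul]
  have hintg (r : reps ((p : ℕ) : ℤ)) := integrable_corr hm h r.1
  rw [pet]
  simp only [e]
  rw [integral_finsetSum _ fun r _ => hintg r, Complex.im_sum]
  have e2 (r : reps ((p : ℕ) : ℤ)) : (∫ z, corr hm h r.1 z ∂surface).im =
      (∫⁻ z, corrPart hm h 1 r.1 z ∂surface).toReal - (∫⁻ z, corrPart hm h (-1) r.1 z ∂surface).toReal := by
    have h1 := integral_eq_lintegral_pos_part_sub_lintegral_neg_part (hintg r).im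
    have h2 := integral_im (hintg r)
    simp only [corrPart, one_mul, neg_mul]
    exact h2.symm.trans h1
  have hfin (s : ℝ) (r : reps ((p : ℕ) : ℤ)) : ∫⁻ z, corrPart hm h s r.1 z ∂surface ≠ ⊤ := by
    have h1 : Integrable (fun z => s * (corr hm h r.1 z).im) surface := (hintg r).im.const_mul s
    exact h1.lintegral_lt_top.ne
  simp only [e2, Finset.sum_sub_distrib]
  rw [← ENNReal.toReal_sum fun r _ => hfin 1 r, ← ENNReal.toReal_sum fun r _ => hfin (-1) r,
    sum_corrPart_neg, sub_self]

lemma hecke_symmetric (p : Nat.Primes) : (hecke k p).IsSymmetric := by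
  rw [LinearMap.isSymmetric_iff_inner_map_self_real]
  intro h
  rw [Complex.conj_eq_iff_im]
  exact im_pet_hecke p h

end
end CuspPrime

namespace CuspPrime
section
open MeasureTheory ModularGroup
open UpperHalfPlane hiding I
open scoped Topology ENNReal MatrixGroups Modular ComplexConjugate

variable {k : ℤ}

/-- A simultaneous eigenform of all Hecke operators at primes. -/
def IsEigen (χ : Nat.Primes → ℂ) (h : CuspForm 𝒮ℒ k) : Prop := ∀ p, hecke k p h = χ p • h

lemma IsEigen.smul {χ : Nat.Primes → ℂ} {h : CuspForm 𝒮ℒ k} (H : IsEigen χ h) (c : ℂ) : IsEigen χ (c • h) := by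
  intro p
  rw [map_smul, H p, smul_comm]

lemma IsEigen.coef_mul {χ : Nat.Primes → ℂ} {h : CuspForm 𝒮ℒ k} (H : IsEigen χ h) (p : Nat.Primes) (n : ℕ) :
    coef h (p * n) = χ p * coef h n - if (p : ℕ) ∣ n then (p : ℂ) ^ (k - 1) * coef h (n / p) else 0 := by
  have := coef_hecke p h n
  rw [H p, coef_smul] at this
  rw [this]; ring

lemma IsEigen.coef_mem {χ : Nat.Primes → ℂ} {h : CuspForm 𝒮ℒ k} (H : IsEigen χ h) (S : AddSubgroup ℂ)
    (hS : ∀ p, ∀ x ∈ S, χ p * x ∈ S) (hp : ∀ p : ℕ, p.Prime → ∀ x ∈ S, (p : ℂ) ^ (k - 1) * x ∈ S) (h1 : coef h 1 ∈ S) (n : ℕ) :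
    coef h n ∈ S := by
  induction n using Nat.strong_induction_on with
  | _ n ih =>
  rcases Nat.eq_zero_or_pos n with rfl | hn
  · rw [coef_zero]; exact S.zero_mem
  by_cases hn1 : n = 1
  · rwa [hn1]
  obtain ⟨p, hpp, m, rfl⟩ := Nat.exists_prime_and_dvd hn1
  have hm : 0 < m := Nat.pos_of_mul_pos_left hn
  have hlt : m < p * m := lt_mul_of_one_lt_left hm hpp.one_lt
  have e := H.coef_mul ⟨p, hpp⟩ m
  dsimp only at e
  rw [e]
  refine S.sub_mem (hS _ _ (ih m hlt)) ?_
  split_ifs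
  · exact hp _ hpp _ (ih _ ((Nat.div_le_self _ _).trans_lt hlt))
  · exact S.zero_mem

lemma IsEigen.eq_zero {χ : Nat.Primes → ℂ} {h : CuspForm 𝒮ℒ k} (H : IsEigen χ h) (h1 : coef h 1 = 0) : h = 0 := by
  refine eq_of_coef fun n => ?_
  have h0 : coef (0 : CuspForm 𝒮ℒ k) n = 0 := by
    have := coef_smul (0 : ℂ) h n
    rwa [zero_smul, zero_mul] at this
  rw [h0]
  have := H.coef_mem ⊥ (by simp) (by simp) (by simpa using h1) n
  simpa using this

lemma IsEigen.im_eigenvalue {χ : Nat.Primes → ℂ} {h : CuspForm 𝒮ℒ k} (H : IsEigen χ h) (h0 : h ≠ 0) (p : Nat.Primes) :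
    (χ p).im = 0 := by
  have hev : Module.End.HasEigenvalue (hecke k p) (χ p) :=
    Module.End.hasEigenvalue_of_hasEigenvector ⟨Module.End.mem_eigenspace_iff.2 (H p), h0⟩
  exact Complex.conj_eq_iff_im.1 ((hecke_symmetric p).conj_eigenvalue_eq_self hev)

lemma IsEigen.im_coef {χ : Nat.Primes → ℂ} {h : CuspForm 𝒮ℒ k} (H : IsEigen χ h) (h1 : coef h 1 = 1) (n : ℕ) :
    (coef h n).im = 0 := by
  have h0 : h ≠ 0 := by
    rintro rfl
    have := coef_smul (0 : ℂ) (0 : CuspForm 𝒮ℒ k) 1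
    rw [zero_smul, zero_mul, h1] at this
    exact one_ne_zero this
  have hr : ∀ z : ℂ, z ∈ Complex.imAddGroupHom.ker ↔ z.im = 0 := fun z => AddMonoidHom.mem_ker
  have := H.coef_mem Complex.imAddGroupHom.ker ?_ ?_ ?_ n
  · exact (hr _).1 this
  · intro p x hx
    rw [hr] at hx ⊢
    rw [Complex.mul_im, hx, H.im_eigenvalue h0 p]; simp
  · intro p _ x hx
    rw [hr] at hx ⊢
    rw [show ((p : ℂ) ^ (k - 1)) = (((p : ℝ) ^ (k - 1) : ℝ) : ℂ) by push_cast; rfl, Complex.mul_im, hx,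
      Complex.ofReal_im]
    simp
  · rw [hr, h1]; simp

/-- The normalised coefficients. -/
def normCoef (h : CuspForm 𝒮ℒ k) (n : ℕ) : ℝ := (coef h n).re * (n : ℝ) ^ (-(((k : ℝ) - 1) / 2))

lemma normCoef_mul (h : CuspForm 𝒮ℒ k) (n : ℕ) :
    normCoef h n * (n : ℝ) ^ (((k : ℝ) - 1) / 2) = (coef h n).re := by
  rcases Nat.eq_zero_or_pos n with rfl | hn
  · simp [normCoef, coef_zero]
  · rw [normCoef, mul_assoc, ← Real.rpow_add (by positivity)]; simp

lemma IsEigen.heckeRel {χ : Nat.Primes → ℂ} {h : CuspForm 𝒮ℒ k} (H : IsEigen χ h) (h1 : coef h 1 = 1) :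
    HeckeRel (normCoef h) where
  zero := by simp [normCoef, coef_zero]
  one := by simp [normCoef, h1]
  rel := by
    intro p hp n hn
    have hre : ∀ n, coef h n = ((coef h n).re : ℂ) := fun n => Complex.ext rfl (by simp [H.im_coef h1 n])
    have e := H.coef_mul ⟨p, hp⟩ n
    have e1 := H.coef_mul ⟨p, hp⟩ 1
    dsimp only at e e1
    rw [mul_one, h1, mul_one, if_neg (by simpa using hp.one_lt.ne'), sub_zero] at e1
    rw [← e1] at e
    have hp0 : (0 : ℝ) < p := by exact_mod_cast hp.pos
    have e' : (coef h (p * n)).re + (if p ∣ n then (p : ℝ) ^ (((k : ℝ) - 1) / 2) * (p : ℝ) ^ (((k : ℝ) - 1) / 2)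
        * (coef h (n / p)).re else 0) = (coef h p).re * (coef h n).re := by
      rw [← Real.rpow_add hp0, add_halves, show (k : ℝ) - 1 = ((k - 1 : ℤ) : ℝ) by push_cast; rfl, Real.rpow_intCast]
      apply Complex.ofReal_injective
      rw [hre (p * n), hre p, hre n, hre (n / p)] at e
      push_cast
      split_ifs at e ⊢ <;> rw [e] <;> push_cast <;> ring
    generalize hκ : ((k : ℝ) - 1) / 2 = κ at e'
    simp only [normCoef, hκ, Nat.cast_mul]
    rw [Real.mul_rpow hp0.le (Nat.cast_nonneg n), mul_mul_mul_comm, ← e', add_mul, ← mul_assoc]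
    congr 1
    split_ifs with hd
    · obtain ⟨m, rfl⟩ := hd
      rw [Nat.mul_div_cancel_left _ hp.pos, Nat.cast_mul, Real.mul_rpow hp0.le (Nat.cast_nonneg m)]
      have : (p : ℝ) ^ κ * (p : ℝ) ^ (-κ) = 1 := by rw [← Real.rpow_add hp0]; simp
      linear_combination (-(coef h m).re * (m : ℝ) ^ (-κ)) * ((p : ℝ) ^ κ * (p : ℝ) ^ (-κ) + 1) * this
    · simp

lemma exists_eigen_sum (f : CuspForm 𝒮ℒ k) : ∃ (s : Finset (Nat.Primes → ℂ)) (g : (Nat.Primes → ℂ) → CuspForm 𝒮ℒ k),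
    (∀ χ, IsEigen χ (g χ)) ∧ (∀ χ ∈ s, g χ ≠ 0) ∧ ∑ χ ∈ s, g χ = f := by
  classical
  have htop := LinearMap.IsSymmetric.iSup_iInf_eq_top_of_commute (T := hecke k) hecke_symmetric
    (fun p q hpq => hecke_commute hpq)
  have hf : f ∈ ⨆ χ : Nat.Primes → ℂ, ⨅ p, Module.End.eigenspace (hecke k p) (χ p) := htop ▸ Submodule.mem_top
  obtain ⟨g, hg⟩ := (Submodule.mem_iSup_iff_exists_dfinsupp' _ _).1 hf
  refine ⟨g.support, fun χ => g χ, fun χ p => ?_, fun χ hχ => ?_, hg⟩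
  · exact Module.End.mem_eigenspace_iff.1 ((Submodule.mem_iInf _).1 (g χ).2 p)
  · simpa using hχ

lemma IsEigen.inner_eq_zero {χ ψ : Nat.Primes → ℂ} {g h : CuspForm 𝒮ℒ k} (hg : IsEigen χ g) (hh : IsEigen ψ h)
    (hne : χ ≠ ψ) : inner ℂ g h = 0 := by
  have := LinearMap.IsSymmetric.orthogonalFamily_iInf_eigenspaces (T := hecke k) hecke_symmetric hne
    ⟨g, (Submodule.mem_iInf _).2 fun p => Module.End.mem_eigenspace_iff.2 (hg p)⟩
    ⟨h, (Submodule.mem_iInf _).2 fun p => Module.End.mem_eigenspace_iff.2 (hh p)⟩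
  exact this

lemma weight_pos {f : CuspForm 𝒮ℒ k} (hf : f ≠ 0) : 0 < k := by
  by_contra hk
  have := CuspForm.rank_eq_zero_of_weight_lt_twelve (k := k) (by omega)
  rw [rank_zero_iff] at this
  exact hf (Subsingleton.elim _ _)

theorem prime_mass_cusp {f : CuspForm 𝒮ℒ k} (hf : f ≠ 0) :
    ∃ M, 0 < M ∧ ∃ δ, 0 < δ ∧ ∃ y₀, ∀ y, y₀ ≤ y →
      δ ≤ ∑ p ∈ win M y with p.Prime, Real.log p * ‖coef f p‖ ^ 2 / (p : ℝ) ^ (k : ℝ) := by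
  have hk := weight_pos hf
  obtain ⟨s, g, hg, hg0, hsum⟩ := exists_eigen_sum f
  have hc0 : ∀ i : s, coef (g i) 1 ≠ 0 := fun i e => hg0 i i.2 ((hg i).eq_zero e)
  set h : s → CuspForm 𝒮ℒ k := fun i => (coef (g i) 1)⁻¹ • g i with hh
  have hh1 : ∀ i, coef (h i) 1 = 1 := fun i => by rw [hh, coef_smul, inv_mul_cancel₀ (hc0 i)]
  have hhe : ∀ i : s, IsEigen i.1 (h i) := fun i => (hg i).smul _
  have hcoef : ∀ i n, coef (h i) n = ((normCoef (h i) n * (n : ℝ) ^ (((k : ℝ) - 1) / 2) : ℝ) : ℂ) := fun i n => by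
    rw [normCoef_mul]
    exact Complex.ext rfl (by simp [(hhe i).im_coef (hh1 i) n])
  have hz : ∀ i, normCoef (h i) 0 = 0 := fun i => by simp [normCoef, coef_zero]
  have F := RSFamily.of_data (k := (k : ℝ)) (l := fun i => normCoef (h i)) (P := fun i j => density (h i + h j))
    (Q := fun i j => density (h i - h j)) (fun i => (hhe i).heckeRel (hh1 i))
    (fun i j => rsData_of_cusp hk _ (by simp [hz]) fun n => by
      rw [coef_add, hcoef, hcoef]; simp only [Pi.add_apply]; push_cast; ring)
    (fun i j => rsData_of_cusp hk _ (by simp [hz]) fun n => by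
      rw [coef_sub, hcoef, hcoef]; simp only [Pi.sub_apply]; push_cast; ring)
    (fun i => by
      rw [mass_density, mass_density, sub_self, norm_zero, zero_pow two_ne_zero]
      have h2 : h i + h i ≠ 0 := fun e => by
        have := coef_add (h i) (h i) 1
        rw [e, hh1] at this
        have h0 := coef_smul (0 : ℂ) (0 : CuspForm 𝒮ℒ k) 1
        rw [zero_smul, zero_mul] at h0
        rw [h0] at this
        norm_num at this
      have := norm_pos_iff.2 h2
      positivity)
    (fun i j hij => by
      have := (hhe i).inner_eq_zero (hhe j) (fun e => hij (Subtype.ext e))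
      rw [mass_density, mass_density, @norm_add_sq ℂ, @norm_sub_sq ℂ, this]
      simp)
  have hs : s.Nonempty := by
    rw [Finset.nonempty_iff_ne_empty]
    rintro rfl
    exact hf (by rw [← hsum, Finset.sum_empty])
  obtain ⟨χ, hχ⟩ := hs
  obtain ⟨M, hM, δ, hδ, y₀, H⟩ := F.prime_mass (c := fun i : s => coef (g i) 1) (fun e => hc0 ⟨χ, hχ⟩ (congrFun e _))
  refine ⟨M, hM, δ, hδ, y₀, fun y hy => (H y hy).trans_eq (Finset.sum_congr rfl fun p hp => ?_)⟩
  have hp0 : (0 : ℝ) < p := by exact_mod_cast (Finset.mem_filter.1 hp).2.pos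
  have hadd : ∀ t : Finset (Nat.Primes → ℂ), coef (∑ χ ∈ t, g χ) p = ∑ χ ∈ t, coef (g χ) p := by
    intro t
    classical
    induction t using Finset.induction_on with
    | empty =>
      have h0 := coef_smul (0 : ℂ) (0 : CuspForm 𝒮ℒ k) p
      rw [zero_smul, zero_mul] at h0
      simpa using h0
    | insert a t ha ih => rw [Finset.sum_insert ha, Finset.sum_insert ha, coef_add, ih]
  have hfp : coef f p = (∑ i : s, coef (g i) 1 * normCoef (h i) p) * (((p : ℝ) ^ (((k : ℝ) - 1) / 2) : ℝ) : ℂ) := by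
    rw [← hsum, hadd, ← Finset.sum_coe_sort, Finset.sum_mul]
    refine Finset.sum_congr rfl fun i _ => ?_
    have := hcoef i p
    rw [hh, coef_smul, inv_mul_eq_iff_eq_mul₀ (hc0 i)] at this
    rw [this]; push_cast; ring
  rw [hfp, norm_mul, mul_pow, Complex.norm_real, Real.norm_of_nonneg (by positivity), ← Real.rpow_natCast (_ ^ _) 2,
    ← Real.rpow_mul hp0.le, show (((k : ℝ) - 1) / 2) * ((2 : ℕ) : ℝ) = k - 1 by push_cast; ring, Real.rpow_sub hp0, Real.rpow_one]
  have : (0 : ℝ) < (p : ℝ) ^ (k : ℝ) := Real.rpow_pos_of_pos hp0 _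
  field_simp

end
end CuspPrime

namespace CuspPrime
section
open scoped MatrixGroups

variable {k : ℤ}

lemma exists_cusp_of_eq {G : Subgroup (GL (Fin 2) ℝ)} (hG : G = 𝒮ℒ) {f : CuspForm G k} (hf : f ≠ 0) :
    ∃ g : CuspForm 𝒮ℒ k, g ≠ 0 ∧ ∀ τ, g τ = f τ := by
  subst hG
  exact ⟨f, hf, fun _ => rfl⟩

theorem prime_square_lower {f : CuspForm 𝒮ℒ k} (hf : f ≠ 0) :
    ∃ δ : ℝ, 0 < δ ∧ ∃ x₀ : ℝ, ∀ x : ℝ, x₀ ≤ x →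
      δ * x ^ (k : ℝ) / Real.log x ≤ ∑ p ∈ (⌊x⌋₊ + 1).primesBelow, ‖coef f p‖ ^ 2 := by
  have hk : (0 : ℝ) < k := by exact_mod_cast weight_pos hf
  obtain ⟨M, hM, δ, hδ, y₀, H⟩ := prime_mass_cusp hf
  refine ⟨δ * Real.exp (-(2 * M)) ^ (k : ℝ), by positivity, max (Real.exp (y₀ + M)) (Real.exp 1), fun x hx => ?_⟩
  have hx0 : 0 < x := (Real.exp_pos 1).trans_le ((le_max_right _ _).trans hx)
  have hy : y₀ + M ≤ Real.log x := (Real.le_log_iff_exp_le hx0).2 ((le_max_left _ _).trans hx)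
  have hL : 0 < Real.log x := one_pos.trans_le ((Real.le_log_iff_exp_le hx0).2 ((le_max_right _ _).trans hx))
  set X : ℝ := Real.exp (-(2 * M)) * x with hX
  have hX0 : 0 < X := by positivity
  have key : δ ≤ ∑ p ∈ (⌊x⌋₊ + 1).primesBelow, Real.log x * ‖coef f p‖ ^ 2 / X ^ (k : ℝ) := by
    refine (H (Real.log x - M) (by linarith)).trans ?_
    have hwin : ∀ p : ℕ, p ∈ win M (Real.log x - M) → (p : ℝ) ≤ x ∧ X ≤ p := by
      intro p hp
      obtain ⟨h1, h2⟩ := mem_win.1 hp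
      have hp0 : (0 : ℝ) < p := by exact_mod_cast h1
      rw [abs_le] at h2
      refine ⟨(Real.log_le_log_iff hp0 hx0).1 (by linarith), (Real.log_le_log_iff hX0 hp0).1 ?_⟩
      rw [hX, Real.log_mul (Real.exp_pos _).ne' hx0.ne', Real.log_exp]
      linarith
    refine (Finset.sum_le_sum fun p hp => ?_).trans (Finset.sum_le_sum_of_subset_of_nonneg ?_ fun _ _ _ => by positivity)
    · obtain ⟨h1, h2⟩ := hwin p (Finset.mem_filter.1 hp).1
      have hp0 : (0 : ℝ) < p := hX0.trans_le h2
      gcongr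
    · intro p hp
      rw [Finset.mem_filter] at hp
      exact Nat.mem_primesBelow.2 ⟨Nat.lt_succ_of_le (Nat.le_floor (hwin p hp.1).1), hp.2⟩
  rw [← Finset.sum_div, ← Finset.mul_sum, le_div_iff₀ (by positivity), hX, Real.mul_rpow (Real.exp_pos _).le hx0.le,
    ← mul_assoc] at key
  rwa [div_le_iff₀ hL, mul_comm (∑ p ∈ _, _)]

end
end CuspPrime

/-- Rankin–Selberg lower bound: for a nonzero cusp form `f` of weight `k` for `SL₂(ℤ)` with real
Fourier coefficients, `Σ_{p ≤ x} a_f(p)² ≫ x^k / log x`. -/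
theorem cuspform_prime_square_lower (k : ℤ) (f : CuspForm (CongruenceSubgroup.Gamma 1) k)
    (a : ℕ → ℂ) (hf : CuspFormCoeffs k f a) (hne : f ≠ 0)
    (hreal : ∀ n, (a n).im = 0) :
    ∃ δ : ℝ, 0 < δ ∧ ∃ x₀ : ℝ, ∀ x : ℝ, x₀ ≤ x →
      δ * x ^ (k : ℝ) / Real.log x ≤ ∑ p ∈ (⌊x⌋₊ + 1).primesBelow, (a p).re ^ 2 := by
  obtain ⟨g, hg, hgf⟩ := CuspPrime.exists_cusp_of_eq CongruenceSubgroup.Gamma_one_coe_eq_SL hne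
  have ha : ∀ n, CuspPrime.coef g n = a n := CuspPrime.coef_unique fun τ => by
    rw [hgf, (hf.2 τ).2]
    convert (hf.2 τ).1.hasSum using 2 with n
    rw [← Complex.exp_nat_mul]
    congr 2
    ring
  obtain ⟨δ, hδ, x₀, H⟩ := CuspPrime.prime_square_lower hg
  refine ⟨δ, hδ, x₀, fun x hx => (H x hx).trans_eq (Finset.sum_congr rfl fun p _ => ?_)⟩
  rw [ha, show a p = ((a p).re : ℂ) from Complex.ext rfl (by simp [hreal p])]
  simp
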